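/- Let x and y be positive real numbers with x > y and x ≥ 59. Then 2·π(x+y) − π(x) − π(x+2y) > y² / ((x+2y)·(log(x+2y))²) − 1.7576·(x+2y) / (log x)^{3/4} · exp(−√((log x)/9.646)). -/

import Mathlib

open scoped BigOperators

/-- Number of primes not exceeding the real number `x` (so `primePi x = 0` for `x ≤ 1`). -/
noncomputable def primePi (x : ℝ) : ℕ :=
  ((Finset.range (⌊x⌋₊ + 1)).filter Nat.Prime).card

/-- The `n`-th prime, with `nthPrime 1 = 2`, `nthPrime 2 = 3`, etc. -/
noncomputable def nthPrime (n : ℕ) : ℕ := Nat.nth Nat.Prime (n - 1)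

section EntireFunctions
open Filter Topology

/-- Zeros of an entire function of positive order can be divided out at one point. -/
theorem exists_div_out_zero {F : ℂ → ℂ} (hF : Differentiable ℂ F) {a : ℂ}
    (ha : analyticOrderAt F a ≠ ⊤) :
    ∃ g : ℂ → ℂ, Differentiable ℂ g ∧ g a ≠ 0 ∧
      ∀ z, F z = (z - a) ^ analyticOrderNatAt F a * g z := by
  obtain ⟨g, hg, hga, hFg⟩ := ((hF.analyticAt a).analyticOrderAt_ne_top).1 ha
  set n := analyticOrderNatAt F a
  set G : ℂ → ℂ := Function.update (fun z => F z / (z - a) ^ n) a (g a) with hG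
  have hGg : G =ᶠ[𝓝 a] g := by
    filter_upwards [hFg] with z hz
    by_cases h : z = a
    · subst h; simp [hG]
    · have : (z - a) ^ n ≠ 0 := pow_ne_zero _ (sub_ne_zero.2 h)
      simp only [hG, Function.update_of_ne h]
      rw [hz, smul_eq_mul]; field_simp
  refine ⟨G, ?_, by simp [hG, hga], ?_⟩
  · intro z
    by_cases h : z = a
    · subst h
      exact (hg.congr hGg.symm).differentiableAt
    · have h1 : (z - a) ^ n ≠ 0 := pow_ne_zero _ (sub_ne_zero.2 h)
      have h2 : DifferentiableAt ℂ (fun z => F z / (z - a) ^ n) z :=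
        (hF z).div (by fun_prop) h1
      refine h2.congr_of_eventuallyEq ?_
      filter_upwards [isOpen_ne.mem_nhds h] with w hw
      simp only [hG, Function.update_of_ne hw]
  · intro z
    by_cases h : z = a
    · subst h
      simpa [hG] using hFg.self_of_nhds
    · have : (z - a) ^ n ≠ 0 := pow_ne_zero _ (sub_ne_zero.2 h)
      simp only [hG, Function.update_of_ne h]
      field_simp

theorem analyticOrderAt_ne_top_of_differentiable {F : ℂ → ℂ} (hF : Differentiable ℂ F) {b : ℂ}
    (hb : F b ≠ 0) (a : ℂ) : analyticOrderAt F a ≠ ⊤ := by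
  have h : AnalyticOnNhd ℂ F Set.univ := fun z _ => hF.analyticAt z
  refine h.analyticOrderAt_ne_top_of_isPreconnected isPreconnected_univ (Set.mem_univ b)
    (Set.mem_univ a) ?_
  rw [((hF.analyticAt b).analyticOrderAt_eq_zero).2 hb]
  simp

theorem exists_div_out_zeros {F : ℂ → ℂ} (hF : Differentiable ℂ F) {b : ℂ} (hb : F b ≠ 0)
    (S : Finset ℂ) :
    ∃ g : ℂ → ℂ, Differentiable ℂ g ∧ (∀ a ∈ S, g a ≠ 0) ∧
      ∀ z, F z = (∏ a ∈ S, (z - a) ^ analyticOrderNatAt F a) * g z := by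
  classical
  induction S using Finset.induction_on with
  | empty => exact ⟨F, hF, by simp, by simp⟩
  | insert a S ha ih =>
    obtain ⟨g, hg, hgS, hFg⟩ := ih
    set P : ℂ → ℂ := fun z => ∏ a ∈ S, (z - a) ^ analyticOrderNatAt F a with hP
    have hPd : Differentiable ℂ P := by
      intro z; simp only [hP]; fun_prop
    have hPa : P a ≠ 0 := by
      simp only [hP]
      refine Finset.prod_ne_zero_iff.2 fun c hc => pow_ne_zero _ (sub_ne_zero.2 ?_)
      rintro rfl; exact ha hc
    have hgb : g b ≠ 0 := by
      intro h; apply hb; rw [hFg b, h, mul_zero]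
    have hord : analyticOrderNatAt F a = analyticOrderNatAt g a := by
      have hFe : F = P * g := funext fun z => hFg z
      have hP0 : analyticOrderAt P a = 0 := (hPd.analyticAt a).analyticOrderAt_eq_zero.2 hPa
      conv_lhs => rw [hFe]
      rw [analyticOrderNatAt_mul (hPd.analyticAt a) (hg.analyticAt a) (by simp [hP0])
        (analyticOrderAt_ne_top_of_differentiable hg hgb a)]
      simp [analyticOrderNatAt, hP0]
    obtain ⟨h, hh, hha, hgh⟩ := exists_div_out_zero hg
      (analyticOrderAt_ne_top_of_differentiable hg hgb a)
    refine ⟨h, hh, ?_, ?_⟩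
    · intro c hc
      rcases Finset.mem_insert.1 hc with rfl | hc
      · exact hha
      · intro h0
        apply hgS c hc
        rw [hgh, h0, mul_zero]
    · intro z
      rw [Finset.prod_insert ha, hFg z, hgh z, hord]
      ring

theorem finite_zeros_closedBall {F : ℂ → ℂ} (hF : Differentiable ℂ F) {b : ℂ} (hb : F b ≠ 0)
    (R : ℝ) : {z : ℂ | ‖z‖ ≤ R ∧ F z = 0}.Finite := by
  by_contra hinf
  have hsub : {z : ℂ | ‖z‖ ≤ R ∧ F z = 0} ⊆ Metric.closedBall 0 R := by
    intro z hz; simpa using hz.1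
  obtain ⟨x, -, hx⟩ := Set.Infinite.exists_accPt_of_subset_isCompact hinf
    (isCompact_closedBall 0 R) hsub
  rw [accPt_iff_frequently_nhdsNE] at hx
  have h : AnalyticOnNhd ℂ F Set.univ := fun z _ => hF.analyticAt z
  have := h.eqOn_zero_of_preconnected_of_frequently_eq_zero isPreconnected_univ (Set.mem_univ x)
    (hx.mono fun y hy => hy.2)
  exact hb (this (Set.mem_univ b))

/-- Quantitative estimate for the logarithmic derivative of a zero-free function. -/
theorem norm_logDeriv_sub_le {g : ℂ → ℂ} (hg : Differentiable ℂ g) {R B : ℝ} (hR : 0 < R)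
    (hB : 0 < B) (hg0 : ∀ z ∈ Metric.ball (0 : ℂ) R, g z ≠ 0)
    (hgB : ∀ z ∈ Metric.ball (0 : ℂ) R, ‖g z‖ ≤ Real.exp B * ‖g 0‖)
    {z : ℂ} (hz : ‖z‖ < R / 4) :
    ‖logDeriv g z - logDeriv g 0‖ ≤ 64 * B / R ^ 2 * ‖z‖ := by
  have h00 : (0 : ℂ) ∈ Metric.ball (0 : ℂ) R := by simpa
  have hd : DifferentiableOn ℂ (logDeriv g) (Metric.ball 0 R) := by
    intro w hw
    refine DifferentiableAt.differentiableWithinAt ?_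
    have : DifferentiableAt ℂ (deriv g) w := hg.analyticAt w |>.deriv.differentiableAt
    exact this.div (hg w) (hg0 w hw)
  obtain ⟨l, hl0, hl⟩ := hd.isExactOn_ball.with_val_at 0 0
  have hexp : ∀ w ∈ Metric.ball (0 : ℂ) R, g w = g 0 * Complex.exp (l w) := by
    have hk : ∀ w ∈ Metric.ball (0 : ℂ) R,
        HasDerivAt (fun w => g w * Complex.exp (-l w)) 0 w := by
      intro w hw
      have h1 := (hg w).hasDerivAt.mul ((hl w hw).neg.cexp)
      refine h1.congr_deriv ?_
      have := hg0 w hw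
      rw [logDeriv_apply]
      simp only [Pi.neg_apply]
      field_simp
      ring
    intro w hw
    have h2 : ∀ x ∈ Metric.ball (0 : ℂ) R, ∀ y ∈ Metric.ball (0 : ℂ) R,
        g x * Complex.exp (-l x) = g y * Complex.exp (-l y) := by
      intro x hx y hy
      refine (convex_ball (0 : ℂ) R).is_const_of_fderivWithin_eq_zero (𝕜 := ℂ)
        (f := fun w => g w * Complex.exp (-l w)) ?_ ?_ hx hy
      · intro u hu; exact (hk u hu).differentiableAt.differentiableWithinAt
      · intro u hu
        have := (hk u hu).hasFDerivAt.hasFDerivWithinAt (s := Metric.ball (0 : ℂ) R)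
        rw [this.fderivWithin (Metric.isOpen_ball.uniqueDiffWithinAt hu)]
        ext; simp
    have h3 := h2 w hw 0 h00
    rw [hl0, neg_zero, Complex.exp_zero, mul_one] at h3
    rw [← h3, mul_assoc, ← Complex.exp_add]; simp
  have hre : Set.MapsTo l (Metric.ball 0 R) {w | w.re ≤ B} := by
    intro w hw
    have h1 := hgB w hw
    rw [hexp w hw, norm_mul, Complex.norm_exp, mul_comm (Real.exp B)] at h1
    exact Real.exp_le_exp.1 (le_of_mul_le_mul_left h1 (norm_pos_iff.2 (hg0 0 h00)))
  have hld : DifferentiableOn ℂ l (Metric.ball 0 R) := fun w hw =>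
    (hl w hw).differentiableAt.differentiableWithinAt
  have hl2 : ∀ w : ℂ, ‖w‖ ≤ R / 2 → ‖l w‖ ≤ 2 * B := by
    intro w hw
    have hwR : w ∈ Metric.ball (0 : ℂ) R := by simp; linarith
    have h1 := Complex.borelCaratheodory_zero hB hld hre hR hwR hl0
    refine h1.trans ?_
    rw [div_le_iff₀ (by linarith)]
    nlinarith
  have hl4 : ∀ w : ℂ, ‖w‖ < R / 4 → ‖logDeriv g w‖ ≤ 8 * B / R := by
    intro w hw
    have hsub : ∀ u ∈ Metric.closedBall w (R / 4), ‖u‖ ≤ R / 2 := by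
      intro u hu
      have : ‖u - w‖ ≤ R / 4 := by simpa [dist_eq_norm] using hu
      calc ‖u‖ = ‖(u - w) + w‖ := by ring_nf
        _ ≤ ‖u - w‖ + ‖w‖ := norm_add_le _ _
        _ ≤ R / 2 := by linarith
    have hdc : DiffContOnCl ℂ l (Metric.ball w (R / 4)) := by
      refine DifferentiableOn.diffContOnCl ?_
      rw [closure_ball _ (by positivity)]
      refine hld.mono fun u hu => ?_
      have := hsub u hu
      simp; linarith
    have h1 := Complex.norm_deriv_le_of_forall_mem_sphere_norm_le (C := 2 * B) (by positivity) hdc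
      (fun u hu => hl2 u (hsub u (Metric.sphere_subset_closedBall hu)))
    have hwR : w ∈ Metric.ball (0 : ℂ) R := by simp; linarith
    rw [(hl w hwR).deriv] at h1
    refine h1.trans (le_of_eq ?_)
    field_simp; norm_num
  have hl5 : ∀ w : ℂ, ‖w‖ < R / 4 → ‖logDeriv g w - logDeriv g 0‖ ≤ 16 * B / R := by
    intro w hw
    calc _ ≤ ‖logDeriv g w‖ + ‖logDeriv g 0‖ := norm_sub_le _ _
      _ ≤ 8 * B / R + 8 * B / R := add_le_add (hl4 w hw) (hl4 0 (by simp; positivity))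
      _ = _ := by ring
  have h6 := Complex.dist_le_div_mul_dist_of_mapsTo_ball (f := logDeriv g) (c := 0) (z := z)
    (R₁ := R / 4) (R₂ := 16 * B / R)
    (hd.mono (Metric.ball_subset_ball (by linarith)))
    (by
      intro w hw
      rw [Metric.mem_closedBall, dist_eq_norm]
      exact hl5 w (by simpa using hw)) (by simpa using hz)
  rw [dist_eq_norm, dist_zero_right] at h6
  refine h6.trans (le_of_eq ?_)
  field_simp; ring

/-- Hadamard-type expansion of the logarithmic derivative of an even entire function of order less
than two. -/
theorem tendsto_sum_zeros_logDeriv {F : ℂ → ℂ} (hF : Differentiable ℂ F)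
    (heven : ∀ z, F (-z) = F z) {b : ℂ} (hb : F b ≠ 0) {C : ℝ} (hC : 0 ≤ C)
    (hgrow : ∀ z, ‖F z‖ ≤ Real.exp (C * (1 + ‖z‖) ^ (3 / 2 : ℝ)))
    {S : ℕ → Finset ℂ} (hS : ∀ n a, a ∈ S n ↔ ‖a‖ ≤ n ∧ F a = 0) {z : ℂ} (hz : F z ≠ 0) :
    Tendsto (fun n => ∑ a ∈ S n, (analyticOrderNatAt F a : ℂ) / (z - a)) atTop
      (𝓝 (logDeriv F z)) := by
  set m := analyticOrderNatAt F with hm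
  have hmeven : ∀ a, m (-a) = m a := by
    intro a
    have h1 : F ∘ (fun z => -z) = F := funext heven
    have h2 := analyticOrderAt_comp_of_deriv_ne_zero (f := F) (g := fun z : ℂ => -z) (z₀ := a)
      (by fun_prop) (by simp)
    rw [h1] at h2
    simp only [hm, analyticOrderNatAt, h2]
  have hdF : logDeriv F (-z) = -logDeriv F z := by
    have h2 : deriv (fun z => F (-z)) z = deriv F z := by simp_rw [heven]
    rw [deriv_comp_neg] at h2
    rw [logDeriv_apply, logDeriv_apply, heven, ← h2, neg_div, neg_neg]
  have key : ∀ n : ℕ, 0 < n → 8 * (‖z‖ + ‖b‖) < n →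
      ‖(∑ a ∈ S n, (m a : ℂ) / (z - a)) - logDeriv F z‖ ≤
        256 * (C * (1 + 4 * n) ^ (3 / 2 : ℝ) + |Real.log ‖F b‖| + 1) / (n : ℝ) ^ 2 *
          (‖z‖ + ‖b‖) := by
    intro n hn hzn
    have hn' : (0 : ℝ) < n := by exact_mod_cast hn
    have hz0 := norm_nonneg z
    have hb0 := norm_nonneg b
    obtain ⟨g, hg, hgS, hFg⟩ := exists_div_out_zeros hF hb (S n)
    set P : ℂ → ℂ := fun z => ∏ a ∈ S n, (z - a) ^ m a with hP
    have hFg' : ∀ w, F w = P w * g w := hFg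
    have hPd : Differentiable ℂ P := by
      intro z; simp only [hP]; fun_prop
    have hP0 : ∀ w, F w ≠ 0 → P w ≠ 0 := fun w hw h => hw (by rw [hFg', h, zero_mul])
    have hg0 : ∀ w, F w ≠ 0 → g w ≠ 0 := fun w hw h => hw (by rw [hFg', h, mul_zero])
    have hld : ∀ w, F w ≠ 0 →
        logDeriv F w = (∑ a ∈ S n, (m a : ℂ) / (w - a)) + logDeriv g w := by
      intro w hw
      have h1 : F = fun w => P w * g w := funext hFg'
      conv_lhs => rw [h1]
      rw [logDeriv_mul w (hP0 w hw) (hg0 w hw) (hPd w) (hg w)]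
      congr 1
      have hne : ∀ a ∈ S n, w - a ≠ 0 := by
        intro a ha h
        rw [sub_eq_zero.1 h] at hw
        exact hw ((hS n a).1 ha).2
      simp only [hP]
      rw [logDeriv_prod (f := fun a z => (z - a) ^ m a) (fun a ha => pow_ne_zero _ (hne a ha))
        (fun a _ => by fun_prop)]
      refine Finset.sum_congr rfl fun a ha => ?_
      have := logDeriv_fun_pow (f := fun z : ℂ => z - a) (x := w) (by fun_prop) (m a)
      rw [this, logDeriv_apply]
      simp
      ring
    have hsum0 : ∑ a ∈ S n, (m a : ℂ) / (-z - a) = -∑ a ∈ S n, (m a : ℂ) / (z - a) := by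
      rw [← Finset.sum_neg_distrib]
      refine Finset.sum_nbij' (fun a => -a) (fun a => -a) ?_ ?_ ?_ ?_ ?_
      · intro a ha
        rw [hS] at ha ⊢
        rwa [norm_neg, heven]
      · intro a ha
        rw [hS] at ha ⊢
        rwa [norm_neg, heven]
      · intro a _; simp
      · intro a _; simp
      · intro a _
        rw [hmeven, ← div_neg]
        congr 1; ring
    have hlg0 : logDeriv g (-z) = -logDeriv g z := by
      have h1 := hld z hz
      have h2 := hld (-z) (by rwa [heven])
      rw [hdF, hsum0] at h2
      linear_combination (-1 : ℂ) * h2 - h1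
    set B : ℝ := C * (1 + 4 * n) ^ (3 / 2 : ℝ) + |Real.log ‖F b‖| + 1 with hB
    have hBpos : 0 < B := by positivity
    have hgB : ∀ w ∈ Metric.ball (0 : ℂ) (4 * n), ‖g w‖ ≤ Real.exp B * ‖g b‖ := by
      intro w hw
      refine Complex.norm_le_of_forall_mem_frontier_norm_le (U := Metric.ball (0 : ℂ) (4 * n))
        Metric.isBounded_ball hg.diffContOnCl ?_ (subset_closure hw)
      intro u hu
      rw [frontier_ball _ (by positivity), mem_sphere_zero_iff_norm] at hu
      have hPu : ‖P b‖ ≤ ‖P u‖ := by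
        simp only [hP, norm_prod, norm_pow]
        refine Finset.prod_le_prod (fun _ _ => by positivity) fun a ha => ?_
        refine pow_le_pow_left₀ (norm_nonneg _) ?_ _
        have h1 := ((hS n a).1 ha).1
        have h2 := norm_sub_norm_le u a
        have h3 := norm_sub_le b a
        linarith
      have hP00 : 0 < ‖P b‖ := norm_pos_iff.2 (hP0 b hb)
      have h3 : ‖P b‖ * ‖g u‖ ≤ ‖F u‖ := by
        rw [hFg' u, norm_mul]; gcongr
      have h4 : ‖F u‖ ≤ Real.exp B * ‖F b‖ := by
        refine (hgrow u).trans ?_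
        have hF0 : 0 < ‖F b‖ := norm_pos_iff.2 hb
        conv_rhs => rw [← Real.exp_log hF0]
        rw [← Real.exp_add, hu, hB]
        refine Real.exp_le_exp.2 ?_
        have := neg_abs_le (Real.log ‖F b‖)
        linarith
      rw [hFg' b, norm_mul] at h4
      have h5 : ‖P b‖ * ‖g u‖ ≤ ‖P b‖ * (Real.exp B * ‖g b‖) := by linarith
      exact le_of_mul_le_mul_left h5 hP00
    have hball : ∀ w ∈ Metric.ball (0 : ℂ) (n / 2), ‖b + w‖ ≤ n := by
      intro w hw
      have h1 := norm_add_le b w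
      have h2 : ‖w‖ < n / 2 := by simpa using hw
      linarith
    have hest : ∀ w : ℂ, ‖w‖ = ‖z‖ →
        ‖logDeriv g w - logDeriv g b‖ ≤ 64 * B / (n / 2) ^ 2 * (‖z‖ + ‖b‖) := by
      intro w hw
      have hwb : ‖w - b‖ ≤ ‖z‖ + ‖b‖ := by rw [← hw]; exact norm_sub_le w b
      have h1 := norm_logDeriv_sub_le (g := fun w => g (b + w)) (R := n / 2) (B := B)
        (by fun_prop) (by positivity) hBpos ?_ ?_ (z := w - b) (by linarith)
      · simp only [logDeriv_apply, deriv_comp_const_add, add_sub_cancel, add_zero] at h1 ⊢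
        exact h1.trans (by gcongr)
      · intro u hu h
        have hFw : F (b + u) = 0 := by rw [hFg', h, mul_zero]
        exact hgS (b + u) ((hS n _).2 ⟨hball u hu, hFw⟩) h
      · intro u hu
        have := hgB (b + u) (by
          have := hball u hu
          rw [mem_ball_zero_iff]; linarith)
        simpa using this
    have h1 := hest z rfl
    have h2 := hest (-z) (norm_neg z)
    rw [hlg0] at h2
    rw [hld z hz, sub_add_cancel_left, norm_neg]
    have h3 : 2 * ‖logDeriv g z‖ ≤ ‖logDeriv g z - logDeriv g b‖ +
        ‖-logDeriv g z - logDeriv g b‖ := by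
      have := norm_sub_le (logDeriv g z - logDeriv g b) (-logDeriv g z - logDeriv g b)
      rw [show logDeriv g z - logDeriv g b - (-logDeriv g z - logDeriv g b) =
        2 * logDeriv g z by ring, norm_mul, Complex.norm_ofNat] at this
      exact this
    have h4 : 64 * B / (n / 2 : ℝ) ^ 2 = 256 * B / (n : ℝ) ^ 2 := by field_simp; norm_num
    rw [h4] at h1 h2
    linarith
  rw [tendsto_iff_norm_sub_tendsto_zero]
  set c := ‖z‖ + ‖b‖ with hc
  have hc0 : 0 ≤ c := by positivity
  have hlim : Tendsto (fun n : ℕ => 256 * (C * (1 + 4 * n) ^ (3 / 2 : ℝ) + |Real.log ‖F b‖| + 1)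
      / (n : ℝ) ^ 2 * c) atTop (𝓝 0) := by
    have h1 : Tendsto (fun n : ℕ => 256 * (C * (5 : ℝ) ^ (3 / 2 : ℝ) * (n : ℝ) ^ (-(1 / 2) : ℝ) +
        (|Real.log ‖F b‖| + 1) * (n : ℝ) ^ (-2 : ℝ)) * c) atTop (𝓝 0) := by
      have ha := (tendsto_rpow_neg_atTop (y := 1 / 2) (by norm_num)).comp
        (tendsto_natCast_atTop_atTop (R := ℝ))
      have hb := (tendsto_rpow_neg_atTop (y := 2) (by norm_num)).comp
        (tendsto_natCast_atTop_atTop (R := ℝ))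
      have := (((ha.const_mul (C * (5 : ℝ) ^ (3 / 2 : ℝ))).add
        (hb.const_mul (|Real.log ‖F b‖| + 1))).const_mul 256).mul_const c
      simpa using this
    refine squeeze_zero' (.of_forall fun n => by positivity) ?_ h1
    filter_upwards [eventually_gt_atTop 0] with n hn
    have hn' : (1 : ℝ) ≤ n := by exact_mod_cast hn
    have hn0 : (0 : ℝ) < n := by linarith
    have h2 : (1 + 4 * (n : ℝ)) ^ (3 / 2 : ℝ) ≤ (5 : ℝ) ^ (3 / 2 : ℝ) * (n : ℝ) ^ (3 / 2 : ℝ) := by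
      rw [← Real.mul_rpow (by norm_num) hn0.le]
      exact Real.rpow_le_rpow (by positivity) (by linarith) (by norm_num)
    have h3 : (n : ℝ) ^ (-(1 / 2) : ℝ) = (n : ℝ) ^ (3 / 2 : ℝ) / (n : ℝ) ^ 2 := by
      rw [← Real.rpow_natCast, ← Real.rpow_sub hn0]; norm_num
    have h4 : (n : ℝ) ^ (-2 : ℝ) = 1 / (n : ℝ) ^ 2 := by
      rw [Real.rpow_neg hn0.le]; norm_num
    rw [h3, h4, mul_div_assoc]
    gcongr
    rw [div_le_iff₀ (by positivity)]
    have : (C * 5 ^ (3 / 2 : ℝ) * ((n : ℝ) ^ (3 / 2 : ℝ) / (n : ℝ) ^ 2) +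
        (|Real.log ‖F b‖| + 1) * (1 / (n : ℝ) ^ 2)) * (n : ℝ) ^ 2 =
        C * (5 ^ (3 / 2 : ℝ) * (n : ℝ) ^ (3 / 2 : ℝ)) + (|Real.log ‖F b‖| + 1) := by
      field_simp
    rw [this, add_assoc]
    gcongr
  refine squeeze_zero' (.of_forall fun n => norm_nonneg _) ?_ hlim
  obtain ⟨N, hN⟩ := exists_nat_gt (8 * c)
  filter_upwards [eventually_gt_atTop 0, eventually_ge_atTop N] with n hn hNn
  exact key n hn (hN.trans_le (by exact_mod_cast hNn))

end EntireFunctions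

section XiFunction
open Filter Topology MeasureTheory

/-- The entire function `s (s - 1) π ^ (-s / 2) Γ (s / 2) ζ(s)`. -/
noncomputable def entireXi (s : ℂ) : ℂ := s * (s - 1) * completedRiemannZeta₀ s + 1

theorem differentiable_entireXi : Differentiable ℂ entireXi := by
  have := differentiable_completedZeta₀
  unfold entireXi
  fun_prop

theorem entireXi_one_sub (s : ℂ) : entireXi (1 - s) = entireXi s := by
  simp only [entireXi, completedRiemannZeta₀_one_sub]; ring

theorem entireXi_zero : entireXi 0 = 1 := by simp [entireXi]

theorem entireXi_one : entireXi 1 = 1 := by simp [entireXi]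

theorem entireXi_eq {s : ℂ} (h0 : s ≠ 0) (h1 : s ≠ 1) :
    entireXi s = s * (s - 1) * completedRiemannZeta s := by
  have h2 : s - 1 ≠ 0 := sub_ne_zero.2 h1
  have h3 : 1 - s ≠ 0 := sub_ne_zero.2 h1.symm
  rw [completedRiemannZeta_eq, entireXi]
  field_simp
  ring

theorem WeakFEPair.exists_bound_strip (P : WeakFEPair ℂ) (a b : ℝ) :
    ∃ M : ℝ, 0 ≤ M ∧ ∀ s : ℂ, a ≤ s.re → s.re ≤ b → ‖P.Λ₀ s‖ ≤ M := by
  have hconv : ∀ s : ℂ, IntegrableOn (fun t : ℝ => (t : ℂ) ^ (s - 1) • P.f_modif t)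
      (Set.Ioi 0) := by
    intro s
    exact (P.isStrongFEPair_toStrongFEPair.hasMellin s).1
  have hnorm : ∀ s : ℂ, ∀ t ∈ Set.Ioi (0 : ℝ),
      ‖(t : ℂ) ^ (s - 1) • P.f_modif t‖ = t ^ (s.re - 1) * ‖P.f_modif t‖ := by
    intro s t ht
    rw [norm_smul, Complex.norm_cpow_eq_rpow_re_of_pos ht]; simp
  have hreal : ∀ c : ℝ, IntegrableOn (fun t : ℝ => t ^ (c - 1) * ‖P.f_modif t‖) (Set.Ioi 0) := by
    intro c
    refine IntegrableOn.congr_fun (hconv c).norm (fun t ht => ?_) measurableSet_Ioi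
    have := hnorm c t ht
    simpa using this
  refine ⟨∫ t in Set.Ioi (0 : ℝ), (t ^ (a - 1) * ‖P.f_modif t‖ + t ^ (b - 1) * ‖P.f_modif t‖),
    ?_, ?_⟩
  · refine setIntegral_nonneg measurableSet_Ioi fun t ht => ?_
    have : (0 : ℝ) < t := ht
    positivity
  · intro s ha hb
    rw [WeakFEPair.Λ₀, mellin]
    refine (norm_integral_le_integral_norm _).trans ?_
    refine setIntegral_mono_on (hconv s).norm ((hreal a).add (hreal b)) measurableSet_Ioi ?_
    intro t ht
    have ht0 : (0 : ℝ) < t := ht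
    rw [hnorm s t ht, ← add_mul]
    refine mul_le_mul_of_nonneg_right ?_ (norm_nonneg _)
    rcases le_total 1 t with h | h
    · have := Real.rpow_le_rpow_of_exponent_le h (show s.re - 1 ≤ b - 1 by linarith)
      have h2 : 0 < t ^ (a - 1) := Real.rpow_pos_of_pos ht0 _
      linarith
    · have := Real.rpow_le_rpow_of_exponent_ge ht0 h (show a - 1 ≤ s.re - 1 by linarith)
      have h2 : 0 < t ^ (b - 1) := Real.rpow_pos_of_pos ht0 _
      linarith

theorem exists_bound_completedZeta₀_strip (a b : ℝ) :
    ∃ M : ℝ, 0 ≤ M ∧ ∀ s : ℂ, a ≤ s.re → s.re ≤ b → ‖completedRiemannZeta₀ s‖ ≤ M := by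
  obtain ⟨M, hM, h⟩ := (HurwitzZeta.hurwitzEvenFEPair 0).exists_bound_strip (a / 2) (b / 2)
  refine ⟨M, hM, fun s ha hb => ?_⟩
  have h1 := h (s / 2) (by simp; linarith) (by simp; linarith)
  rw [completedRiemannZeta₀, HurwitzZeta.completedHurwitzZetaEven₀, norm_div]
  simp only [Complex.norm_ofNat]
  linarith

theorem Complex.norm_Gamma_le_Gamma_re {s : ℂ} (hs : 0 < s.re) :
    ‖Complex.Gamma s‖ ≤ Real.Gamma s.re := by
  rw [Complex.Gamma_eq_integral hs, Real.Gamma_eq_integral hs, Complex.GammaIntegral]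
  refine (norm_integral_le_integral_norm _).trans (le_of_eq ?_)
  refine setIntegral_congr_fun measurableSet_Ioi fun t ht => ?_
  simp only [norm_mul]
  rw [Complex.norm_cpow_eq_rpow_re_of_pos ht, Complex.norm_real, Real.norm_eq_abs,
    abs_of_pos (Real.exp_pos _)]
  simp

theorem Real.Gamma_le_exp_rpow {x : ℝ} (hx : 1 ≤ x) :
    Real.Gamma x ≤ Real.exp (2 * (1 + x) ^ (3 / 2 : ℝ)) := by
  set n := ⌈x⌉₊ with hn
  have hxn : x ≤ n := Nat.le_ceil x
  have hnx : (n : ℝ) ≤ 1 + x := by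
    have := Nat.ceil_lt_add_one (show 0 ≤ x by linarith); linarith
  have hn0 : (0 : ℝ) < n := by linarith
  have hG : 0 < Real.Gamma x := Real.Gamma_pos_of_pos (by linarith)
  have h1 : Real.Gamma x ≤ Real.Gamma (x + 1) := by
    rw [Real.Gamma_add_one (by linarith)]; nlinarith
  have h2 : Real.Gamma (x + 1) ≤ Real.Gamma (n + 1) :=
    Real.Gamma_strictMonoOn_Ici.monotoneOn (by simp; linarith) (by simp; linarith) (by linarith)
  rw [Real.Gamma_nat_eq_factorial] at h2
  have h3 : ((n.factorial : ℕ) : ℝ) ≤ (n : ℝ) ^ n := by exact_mod_cast Nat.factorial_le_pow n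
  have h4 : (n : ℝ) ^ n = Real.exp (n * Real.log n) := by
    rw [mul_comm, Real.exp_mul, Real.exp_log hn0, Real.rpow_natCast]
  refine h1.trans (h2.trans (h3.trans ?_))
  rw [h4, Real.exp_le_exp]
  have h5 := Real.log_le_rpow_div hn0.le (show (0 : ℝ) < 1 / 2 by norm_num)
  have h6 : (n : ℝ) * (n : ℝ) ^ (1 / 2 : ℝ) = (n : ℝ) ^ (3 / 2 : ℝ) := by
    nth_rewrite 1 [← Real.rpow_one (n : ℝ)]
    rw [← Real.rpow_add hn0]; norm_num
  calc (n : ℝ) * Real.log n ≤ n * ((n : ℝ) ^ (1 / 2 : ℝ) / (1 / 2)) := by gcongr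
    _ = 2 * (n : ℝ) ^ (3 / 2 : ℝ) := by rw [← h6]; ring
    _ ≤ _ := by gcongr

theorem exists_bound_completedZeta :
    ∃ K : ℝ, 1 ≤ K ∧ ∀ s : ℂ, 2 ≤ s.re →
      ‖completedRiemannZeta s‖ ≤ K * Real.exp (2 * (1 + ‖s‖) ^ (3 / 2 : ℝ)) := by
  have hsum : Summable fun n : ℕ => 1 / (n : ℝ) ^ (2 : ℝ) := by
    rw [Real.summable_one_div_nat_rpow]; norm_num
  refine ⟨1 + ∑' n : ℕ, 1 / (n : ℝ) ^ (2 : ℝ), ?_, ?_⟩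
  · have : 0 ≤ ∑' n : ℕ, 1 / (n : ℝ) ^ (2 : ℝ) := tsum_nonneg fun n => by positivity
    linarith
  · intro s hs
    rw [completedZeta_eq_tsum_of_one_lt_re (by linarith), norm_mul, norm_mul]
    have h1 : ‖(Real.pi : ℂ) ^ (-s / 2)‖ ≤ 1 := by
      rw [Complex.norm_cpow_eq_rpow_re_of_pos Real.pi_pos]
      refine Real.rpow_le_one_of_one_le_of_nonpos (by linarith [Real.pi_gt_three]) ?_
      simp; linarith
    have h2 : ‖Complex.Gamma (s / 2)‖ ≤ Real.exp (2 * (1 + ‖s‖) ^ (3 / 2 : ℝ)) := by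
      have hre : (s / 2).re = s.re / 2 := by simp
      refine (Complex.norm_Gamma_le_Gamma_re (by rw [hre]; linarith)).trans ?_
      refine (Real.Gamma_le_exp_rpow (by rw [hre]; linarith)).trans ?_
      have h3 : (s / 2).re ≤ ‖s‖ := by
        rw [hre]; have := Complex.re_le_norm s; linarith
      have h4 : 0 ≤ 1 + (s / 2).re := by rw [hre]; linarith
      gcongr
    have hterm : ∀ n : ℕ, ‖1 / (n : ℂ) ^ s‖ ≤ 1 / (n : ℝ) ^ (2 : ℝ) := by
      intro n
      rcases Nat.eq_zero_or_pos n with rfl | hn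
      · have : s ≠ 0 := by rintro rfl; simp at hs; linarith
        simp [Complex.zero_cpow this]
      · rw [norm_div, norm_one, Complex.norm_natCast_cpow_of_pos hn]
        have : (1 : ℝ) ≤ n := by exact_mod_cast hn
        gcongr
    have h3 : ‖∑' n : ℕ, 1 / (n : ℂ) ^ s‖ ≤ 1 + ∑' n : ℕ, 1 / (n : ℝ) ^ (2 : ℝ) := by
      have := tsum_of_norm_bounded hsum.hasSum hterm
      linarith
    calc _ ≤ 1 * Real.exp (2 * (1 + ‖s‖) ^ (3 / 2 : ℝ)) *
          (1 + ∑' n : ℕ, 1 / (n : ℝ) ^ (2 : ℝ)) := by gcongr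
      _ = _ := by ring

theorem entireXi_half_add_neg (z : ℂ) : entireXi (1 / 2 + -z) = entireXi (1 / 2 + z) := by
  rw [← entireXi_one_sub]; congr 1; ring

theorem exists_growth_entireXi : ∃ C : ℝ, 0 ≤ C ∧
    ∀ z : ℂ, ‖entireXi (1 / 2 + z)‖ ≤ Real.exp (C * (1 + ‖z‖) ^ (3 / 2 : ℝ)) := by
  obtain ⟨M, hM, hMb⟩ := exists_bound_completedZeta₀_strip (1 / 2) 2
  obtain ⟨K, hK, hKb⟩ := exists_bound_completedZeta
  have key : ∀ s : ℂ, 1 / 2 ≤ s.re →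
      ‖entireXi s‖ ≤ (M + K) * Real.exp (4 * (1 + ‖s‖) ^ (3 / 2 : ℝ)) := by
    intro s hs
    set r := 1 + ‖s‖ with hr
    have hr1 : 1 ≤ r := by have := norm_nonneg s; linarith
    have hrr : r ≤ r ^ (3 / 2 : ℝ) := by
      nth_rewrite 1 [← Real.rpow_one r]
      exact Real.rpow_le_rpow_of_exponent_le hr1 (by norm_num)
    have h2 : r ^ 2 ≤ Real.exp (2 * r ^ (3 / 2 : ℝ)) := by
      have h3 : r ≤ Real.exp (r ^ (3 / 2 : ℝ)) := by
        have := Real.add_one_le_exp (r ^ (3 / 2 : ℝ)); linarith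
      calc r ^ 2 ≤ Real.exp (r ^ (3 / 2 : ℝ)) ^ 2 := by gcongr
        _ = _ := by rw [← Real.exp_nat_mul]; norm_num
    have hss : ‖s * (s - 1)‖ ≤ r ^ 2 := by
      rw [norm_mul]
      have h4 : ‖s - 1‖ ≤ r := by
        have := norm_sub_le s 1; rw [norm_one] at this; linarith
      have h5 : ‖s‖ ≤ r := by linarith
      calc _ ≤ r * r := by gcongr
        _ = _ := by ring
    have he : Real.exp (4 * r ^ (3 / 2 : ℝ)) =
        Real.exp (2 * r ^ (3 / 2 : ℝ)) * Real.exp (2 * r ^ (3 / 2 : ℝ)) := by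
      rw [← Real.exp_add]; ring_nf
    have he1 : 1 ≤ Real.exp (2 * r ^ (3 / 2 : ℝ)) := Real.one_le_exp (by positivity)
    rcases le_total s.re 2 with h | h
    · have h6 := hMb s hs h
      calc ‖entireXi s‖ ≤ ‖s * (s - 1)‖ * ‖completedRiemannZeta₀ s‖ + 1 := by
            rw [entireXi]
            refine (norm_add_le _ _).trans ?_
            rw [norm_mul (s * (s - 1)), norm_one]
        _ ≤ Real.exp (2 * r ^ (3 / 2 : ℝ)) * M + 1 := by
            gcongr; exact hss.trans h2
        _ ≤ _ := by
            rw [he]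
            nlinarith [mul_nonneg hM (sub_nonneg.2 he1),
              mul_nonneg (mul_nonneg hM (sub_nonneg.2 he1)) (zero_le_one.trans he1),
              mul_nonneg (sub_nonneg.2 hK) (mul_nonneg (zero_le_one.trans he1)
                (zero_le_one.trans he1)), mul_le_mul he1 he1 zero_le_one (zero_le_one.trans he1)]
    · have h6 := hKb s h
      have h0 : s ≠ 0 := by rintro rfl; simp at h; linarith
      have h1 : s ≠ 1 := by rintro rfl; norm_num at h
      rw [entireXi_eq h0 h1, norm_mul]
      calc _ ≤ Real.exp (2 * r ^ (3 / 2 : ℝ)) * (K * Real.exp (2 * r ^ (3 / 2 : ℝ))) := by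
            gcongr; exact hss.trans h2
        _ ≤ _ := by
          rw [he]
          have := mul_nonneg hM (mul_nonneg (zero_le_one.trans he1) (zero_le_one.trans he1))
          linarith
  have key2 : ∀ z : ℂ, 0 ≤ z.re → ‖entireXi (1 / 2 + z)‖ ≤
      Real.exp ((M + K + 4 * 2 ^ (3 / 2 : ℝ)) * (1 + ‖z‖) ^ (3 / 2 : ℝ)) := by
    intro z hz
    refine (key (1 / 2 + z) (by simpa using hz)).trans ?_
    have h1 : 1 + ‖1 / 2 + z‖ ≤ 2 * (1 + ‖z‖) := by
      have := norm_add_le (1 / 2) z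
      norm_num at this
      have := norm_nonneg z
      norm_num
      linarith
    have h2 : (1 + ‖1 / 2 + z‖) ^ (3 / 2 : ℝ) ≤ 2 ^ (3 / 2 : ℝ) * (1 + ‖z‖) ^ (3 / 2 : ℝ) := by
      rw [← Real.mul_rpow (by norm_num) (by positivity)]
      gcongr
    have h3 : M + K ≤ Real.exp ((M + K) * (1 + ‖z‖) ^ (3 / 2 : ℝ)) := by
      have h4 : 1 ≤ (1 + ‖z‖) ^ (3 / 2 : ℝ) :=
        Real.one_le_rpow (by linarith [norm_nonneg z]) (by norm_num)
      have h5 := Real.add_one_le_exp ((M + K) * (1 + ‖z‖) ^ (3 / 2 : ℝ))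
      nlinarith
    calc _ ≤ Real.exp ((M + K) * (1 + ‖z‖) ^ (3 / 2 : ℝ)) *
          Real.exp (4 * (2 ^ (3 / 2 : ℝ) * (1 + ‖z‖) ^ (3 / 2 : ℝ))) := by gcongr
      _ = _ := by rw [← Real.exp_add]; ring_nf
  refine ⟨M + K + 4 * 2 ^ (3 / 2 : ℝ), by positivity, fun z => ?_⟩
  rcases le_total 0 z.re with h | h
  · exact key2 z h
  · have := key2 (-z) (by simpa using h)
    rwa [entireXi_half_add_neg, norm_neg] at this

theorem entireXi_eq_mul_zeta {s : ℂ} (h0 : 0 < s.re) (h1 : s ≠ 1) :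
    entireXi s = s * (s - 1) * (Complex.Gammaℝ s * riemannZeta s) := by
  have hs0 : s ≠ 0 := by rintro rfl; simp at h0
  have hG : Complex.Gammaℝ s ≠ 0 := Complex.Gammaℝ_ne_zero_of_re_pos h0
  rw [entireXi_eq hs0 h1, riemannZeta_def_of_ne_zero hs0, mul_div_cancel₀ _ hG]

theorem entireXi_ne_zero_of_one_le_re {s : ℂ} (hs : 1 ≤ s.re) : entireXi s ≠ 0 := by
  by_cases h1 : s = 1
  · rw [h1, entireXi_one]; exact one_ne_zero
  have hs0 : s ≠ 0 := by rintro rfl; simp at hs; linarith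
  rw [entireXi_eq_mul_zeta (by linarith) h1]
  exact mul_ne_zero (mul_ne_zero hs0 (sub_ne_zero.2 h1)) (mul_ne_zero
    (Complex.Gammaℝ_ne_zero_of_re_pos (by linarith)) (riemannZeta_ne_zero_of_one_le_re hs))

theorem re_lt_one_of_entireXi_eq_zero {s : ℂ} (hs : entireXi s = 0) : s.re < 1 := by
  by_contra h
  exact entireXi_ne_zero_of_one_le_re (not_lt.1 h) hs

theorem re_pos_of_entireXi_eq_zero {s : ℂ} (hs : entireXi s = 0) : 0 < s.re := by
  have := re_lt_one_of_entireXi_eq_zero (s := 1 - s) (by rwa [entireXi_one_sub])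
  simpa using this

open ComplexConjugate in
theorem entireXi_conj (s : ℂ) : entireXi (conj s) = conj (entireXi s) := by
  have key : ∀ s : ℂ, 0 < s.re → entireXi (conj s) = conj (entireXi s) := by
    intro s hs
    by_cases h1 : s = 1
    · simp [h1, entireXi_one]
    have h2 : conj s ≠ 1 := by
      intro h; apply h1; rw [← Complex.conj_conj s, h, map_one]
    rw [entireXi_eq_mul_zeta hs h1, entireXi_eq_mul_zeta (by simpa using hs) h2,
      riemannZeta_conj]
    simp only [map_mul, map_sub, map_one, Complex.Gammaℝ]
    rw [← Complex.Gamma_conj, map_div₀, Complex.conj_ofNat]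
    congr 3
    have := Complex.conj_cpow (Real.pi : ℂ) (-s / 2)
      (by rw [Complex.arg_ofReal_of_nonneg Real.pi_pos.le]; exact Real.pi_pos.ne)
    rw [Complex.conj_ofReal] at this
    rw [this, Complex.conj_conj]
    simp [Complex.conj_ofNat]
  rcases lt_or_ge 0 s.re with h | h
  · exact key s h
  · have := key (1 - s) (by simp; linarith)
    rw [map_sub, map_one, entireXi_one_sub, entireXi_one_sub] at this
    exact this

/-- Multiplicity of a point as a zero of `entireXi`. -/
noncomputable def xiOrd (ρ : ℂ) : ℕ := analyticOrderNatAt entireXi ρ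

theorem xiOrd_eq_zero {ρ : ℂ} (h : entireXi ρ ≠ 0) : xiOrd ρ = 0 := by
  simp [xiOrd, analyticOrderNatAt,
    ((differentiable_entireXi.analyticAt ρ).analyticOrderAt_eq_zero).2 h]

theorem entireXi_eq_zero_of_xiOrd_ne_zero {ρ : ℂ} (h : xiOrd ρ ≠ 0) : entireXi ρ = 0 := by
  by_contra h0
  exact h (xiOrd_eq_zero h0)

theorem analyticOrderAt_entireXi_ne_top (ρ : ℂ) : analyticOrderAt entireXi ρ ≠ ⊤ :=
  analyticOrderAt_ne_top_of_differentiable differentiable_entireXi (b := 1)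
    (by rw [entireXi_one]; exact one_ne_zero) ρ

theorem xiOrd_one_sub (ρ : ℂ) : xiOrd (1 - ρ) = xiOrd ρ := by
  have h1 : entireXi ∘ (fun z => 1 - z) = entireXi := funext entireXi_one_sub
  have hd : HasDerivAt (fun z : ℂ => 1 - z) (-1) ρ := by
    simpa using (hasDerivAt_id ρ).const_sub 1
  have h2 := analyticOrderAt_comp_of_deriv_ne_zero (f := entireXi) (g := fun z : ℂ => 1 - z)
    (z₀ := ρ) (by fun_prop) (by rw [hd.deriv]; norm_num)
  rw [h1] at h2
  simp only [xiOrd, analyticOrderNatAt, h2]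

open ComplexConjugate in
theorem xiOrd_conj (ρ : ℂ) : xiOrd (conj ρ) = xiOrd ρ := by
  obtain ⟨g, hg, hga, hFg⟩ := exists_div_out_zero differentiable_entireXi
    (analyticOrderAt_entireXi_ne_top ρ)
  have hg' : Differentiable ℂ (conj ∘ g ∘ conj) := fun z => by
    have := (hg (conj z)).conj_conj
    rwa [Complex.conj_conj] at this
  rw [xiOrd]
  rw [(differentiable_entireXi.analyticAt _).analyticOrderNatAt_eq_iff
    (analyticOrderAt_entireXi_ne_top _)]
  refine ⟨conj ∘ g ∘ conj, hg'.analyticAt _, ?_, .of_forall fun z => ?_⟩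
  · simpa using hga
  · have h1 : entireXi z = conj (entireXi (conj z)) := by rw [entireXi_conj, Complex.conj_conj]
    rw [h1, hFg]
    simp [xiOrd]

theorem finite_xiZeros (n : ℕ) : {ρ : ℂ | ‖ρ - 1 / 2‖ ≤ n ∧ entireXi ρ = 0}.Finite := by
  have h1 : Differentiable ℂ fun z => entireXi (1 / 2 + z) := by
    have := differentiable_entireXi; fun_prop
  have h2 := finite_zeros_closedBall h1 (b := 1 / 2) (by
    norm_num [entireXi_one]) n
  refine (h2.image fun z => 1 / 2 + z).subset ?_
  intro ρ hρ
  exact ⟨ρ - 1 / 2, ⟨hρ.1, by simpa using hρ.2⟩, by simp⟩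

/-- Zeros of `entireXi` in the closed disc of radius `n` about `1 / 2`. -/
noncomputable def xiZeros (n : ℕ) : Finset ℂ := (finite_xiZeros n).toFinset

theorem mem_xiZeros {n : ℕ} {ρ : ℂ} : ρ ∈ xiZeros n ↔ ‖ρ - 1 / 2‖ ≤ n ∧ entireXi ρ = 0 := by
  simp [xiZeros]

theorem xiZeros_mono : Monotone xiZeros := by
  intro a b hab ρ hρ
  rw [mem_xiZeros] at hρ ⊢
  exact ⟨hρ.1.trans (by exact_mod_cast hab), hρ.2⟩

theorem tendsto_sum_xiZeros {s : ℂ} (hs : entireXi s ≠ 0) :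
    Tendsto (fun n => ∑ ρ ∈ xiZeros n, (xiOrd ρ : ℂ) / (s - ρ)) atTop
      (𝓝 (logDeriv entireXi s)) := by
  obtain ⟨C, hC, hgrow⟩ := exists_growth_entireXi
  set F : ℂ → ℂ := fun z => entireXi (1 / 2 + z) with hF
  have h1 : Differentiable ℂ F := by
    have := differentiable_entireXi; simp only [hF]; fun_prop
  have hF0 : F (1 / 2) ≠ 0 := by
    norm_num [hF, entireXi_one]
  have h2 := tendsto_sum_zeros_logDeriv (F := F) h1 entireXi_half_add_neg hF0 hC hgrow
    (S := fun n => (xiZeros n).image fun ρ => ρ - 1 / 2) (by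
      intro n a
      simp only [Finset.mem_image, mem_xiZeros, hF]
      constructor
      · rintro ⟨ρ, ⟨h1, h2⟩, rfl⟩
        exact ⟨h1, by simpa using h2⟩
      · rintro ⟨h1, h2⟩
        exact ⟨1 / 2 + a, ⟨by simpa using h1, h2⟩, by ring⟩) (z := s - 1 / 2) (by simpa [hF] using hs)
  have h3 : logDeriv F (s - 1 / 2) = logDeriv entireXi s := by
    simp only [logDeriv_apply, hF]
    rw [deriv_comp_const_add]
    simp
  rw [h3] at h2
  refine h2.congr fun n => ?_
  rw [Finset.sum_image (by intro a _ b _ h; simpa using h)]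
  refine Finset.sum_congr rfl fun ρ _ => ?_
  have h4 : analyticOrderNatAt F (ρ - 1 / 2) = xiOrd ρ := by
    have := analyticOrderAt_comp_of_deriv_ne_zero (f := entireXi) (g := fun z : ℂ => 1 / 2 + z)
      (z₀ := ρ - 1 / 2) (by fun_prop) (by
        rw [deriv_const_add]; simp)
    simp only [xiOrd, analyticOrderNatAt]
    rw [show F = entireXi ∘ fun z => 1 / 2 + z from rfl, this]
    simp
  rw [h4]
  congr 1
  ring

end XiFunction

/-- The real digamma function, as the logarithmic derivative of `Real.Gamma`. -/
theorem Complex.digamma_ofReal {x : ℝ} (hx : 0 < x) :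
    HasDerivAt (fun u => Real.log (Real.Gamma u)) (Complex.digamma x).re x ∧
      Complex.digamma (x : ℂ) = ((Complex.digamma x).re : ℂ) := by
  have hne : ∀ m : ℕ, x ≠ -m := fun m => by
    have : (0 : ℝ) ≤ m := m.cast_nonneg
    linarith
  have hR := (Real.differentiableAt_Gamma hne).hasDerivAt
  have hneC : ∀ m : ℕ, (x : ℂ) ≠ -m := fun m h => hne m (by exact_mod_cast h)
  have h1 := hR.ofReal_comp
  have h2 := (Complex.differentiableAt_Gamma (x : ℂ) hneC).hasDerivAt.comp_ofReal
  have h3 : (fun y : ℝ => ((Real.Gamma y : ℝ) : ℂ)) = fun y : ℝ => Complex.Gamma y := by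
    ext y; rw [Complex.Gamma_ofReal]
  rw [h3] at h1
  have h4 := h1.unique h2
  have h5 : Complex.digamma (x : ℂ) = ((deriv Real.Gamma x / Real.Gamma x : ℝ) : ℂ) := by
    rw [Complex.digamma_def, logDeriv_apply, ← h4, Complex.Gamma_ofReal, Complex.ofReal_div]
  have h6 : (Complex.digamma (x : ℂ)).re = deriv Real.Gamma x / Real.Gamma x := by
    rw [h5, Complex.ofReal_re]
  refine ⟨?_, by rw [h6, h5]⟩
  rw [h6]
  exact hR.log (Real.Gamma_pos_of_pos hx).ne'

theorem Complex.digamma_add_one_of_re_pos {s : ℂ} (hs : 0 < s.re) :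
    Complex.digamma (s + 1) = Complex.digamma s + 1 / s := by
  rw [Complex.digamma_apply_add_one]
  · simp
  · intro m h
    have := congrArg Complex.re h
    simp at this
    have : (0 : ℝ) ≤ m := m.cast_nonneg
    linarith

theorem Complex.re_digamma_le_log {x : ℝ} (hx : 0 < x) : (Complex.digamma x).re ≤ Real.log x := by
  have h := (Complex.digamma_ofReal hx).1
  have hc := Real.convexOn_log_Gamma
  have := hc.le_slope_of_hasDerivAt (x := x) (y := x + 1) (f' := (Complex.digamma x).re)
    (by simpa using hx) (by simp; linarith) (by linarith) h
  rw [slope_def_field] at this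
  simp only [Function.comp] at this
  rwa [Real.Gamma_add_one hx.ne', Real.log_mul hx.ne' (Real.Gamma_pos_of_pos hx).ne',
    add_sub_cancel_right, add_sub_cancel_left, div_one] at this

theorem Complex.log_sub_one_div_le_re_digamma {x : ℝ} (hx : 0 < x) :
    Real.log x - 1 / x ≤ (Complex.digamma x).re := by
  have h := (Complex.digamma_ofReal (x := x + 1) (by linarith)).1
  have hc := Real.convexOn_log_Gamma
  have := hc.slope_le_of_hasDerivAt (x := x) (y := x + 1)
    (by simpa using hx) (by simp; linarith) (by linarith) h
  rw [slope_def_field] at this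
  simp only [Function.comp] at this
  rw [Real.Gamma_add_one hx.ne', Real.log_mul hx.ne' (Real.Gamma_pos_of_pos hx).ne',
    add_sub_cancel_right, add_sub_cancel_left, div_one] at this
  have h2 := Complex.digamma_add_one_of_re_pos (s := (x : ℂ)) (by simpa using hx)
  have h3 : (Complex.digamma ((x + 1 : ℝ) : ℂ)).re = (Complex.digamma x).re + 1 / x := by
    push_cast
    rw [h2, Complex.add_re]
    congr 1
    rw [← Complex.ofReal_one, ← Complex.ofReal_div, Complex.ofReal_re]
  linarith

theorem Complex.digamma_add_natCast {s : ℂ} (hs : 0 < s.re) (N : ℕ) :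
    Complex.digamma (s + N) = Complex.digamma s + ∑ n ∈ Finset.range N, 1 / (s + n) := by
  induction N with
  | zero => simp
  | succ N ih =>
    rw [Finset.sum_range_succ, ← add_assoc, ← ih, Nat.cast_succ, ← add_assoc,
      Complex.digamma_add_one_of_re_pos]
    simp
    positivity

theorem Complex.norm_digamma_term_le {z : ℂ} (hz : 0 ≤ z.re) (n : ℕ) :
    ‖1 / ((n : ℂ) + 1) - 1 / (z + 1 + n)‖ ≤ ‖z‖ * (1 / ((n : ℝ) + 1) ^ 2) := by
  have h1 : ((n : ℂ) + 1) ≠ 0 := by exact_mod_cast n.succ_ne_zero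
  have hre : (n : ℝ) + 1 ≤ (z + 1 + n).re := by simp; linarith
  have hn : (n : ℝ) + 1 ≤ ‖z + 1 + n‖ := hre.trans (Complex.re_le_norm _)
  have hp : (0 : ℝ) < n + 1 := by positivity
  have h2 : (z + 1 + n) ≠ 0 := by
    intro h; rw [h] at hn; simp at hn; linarith
  have : 1 / ((n : ℂ) + 1) - 1 / (z + 1 + n) = z / (((n : ℂ) + 1) * (z + 1 + n)) := by
    field_simp; ring
  rw [this, norm_div, norm_mul]
  have h3 : ‖(n : ℂ) + 1‖ = n + 1 := by
    have : ((n : ℂ) + 1) = ((n + 1 : ℝ) : ℂ) := by push_cast; rfl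
    rw [this, Complex.norm_real, Real.norm_of_nonneg hp.le]
  rw [h3, div_eq_mul_one_div]
  gcongr
  rw [sq]
  gcongr

theorem summable_one_div_succ_sq : Summable (fun n : ℕ => 1 / ((n : ℝ) + 1) ^ 2) := by
  have := (summable_nat_add_iff 1).2 (Real.summable_one_div_nat_pow.2 (one_lt_two))
  simpa using this

theorem Complex.summable_digamma_term {z : ℂ} (hz : 0 ≤ z.re) :
    Summable (fun n : ℕ => 1 / ((n : ℂ) + 1) - 1 / (z + 1 + n)) :=
  Summable.of_norm_bounded (summable_one_div_succ_sq.mul_left ‖z‖)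
    (Complex.norm_digamma_term_le hz)

open Filter Topology in
theorem tendsto_log_add_sub_log (a : ℝ) (ha : 0 ≤ a) :
    Tendsto (fun N : ℕ => Real.log (a + N) - Real.log N) atTop (𝓝 0) := by
  have h1 : Tendsto (fun N : ℕ => Real.log (1 + a / N)) atTop (𝓝 (Real.log (1 + 0))) := by
    refine Tendsto.log (tendsto_const_nhds.add ?_) (by norm_num)
    exact tendsto_const_div_atTop_nhds_zero_nat a
  rw [add_zero, Real.log_one] at h1
  refine h1.congr' ?_
  filter_upwards [eventually_gt_atTop 0] with N hN
  have : (0 : ℝ) < N := by exact_mod_cast hN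
  rw [← Real.log_div (by positivity) (by positivity)]
  congr 1; field_simp; ring

open Filter Topology in
theorem Complex.hasSum_digamma_ofReal {x : ℝ} (hx : 0 < x) :
    HasSum (fun n : ℕ => 1 / ((n : ℂ) + 1) - 1 / ((x : ℂ) + 1 + n))
      (Complex.digamma (x + 1) + Real.eulerMascheroniConstant) := by
  have hsum := Complex.summable_digamma_term (z := x) (by simpa using hx.le)
  have h := hsum.hasSum.tendsto_sum_nat
  suffices hh : Tendsto (fun N : ℕ => ∑ n ∈ Finset.range N,
      (1 / ((n : ℂ) + 1) - 1 / ((x : ℂ) + 1 + n))) atTop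
      (𝓝 (Complex.digamma (x + 1) + Real.eulerMascheroniConstant)) by
    rw [← tendsto_nhds_unique h hh]; exact hsum.hasSum
  have hx1 : 0 < x + 1 := by linarith
  have key : ∀ N : ℕ, ∑ n ∈ Finset.range N, (1 / ((n : ℂ) + 1) - 1 / ((x : ℂ) + 1 + n)) =
      (((harmonic N : ℝ) - Real.log N) - ((Complex.digamma ((x + 1 + N : ℝ) : ℂ)).re - Real.log N)
        : ℝ) + Complex.digamma (x + 1) := by
    intro N
    have h1 := Complex.digamma_add_natCast (s := (x : ℂ) + 1) (by simpa using hx1) N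
    have h2 := (Complex.digamma_ofReal (x := x + 1 + N) (by positivity)).2
    rw [Finset.sum_sub_distrib]
    push_cast at h2 ⊢
    rw [← h2, h1, harmonic]
    push_cast
    simp only [one_div]
    ring
  simp_rw [key]
  rw [add_comm (Complex.digamma _)]
  refine Tendsto.add_const _ ?_
  refine (Complex.continuous_ofReal.tendsto _).comp ?_
  have h1 := Real.tendsto_harmonic_sub_log
  have h2 : Tendsto (fun N : ℕ => (Complex.digamma ((x + 1 + N : ℝ) : ℂ)).re - Real.log N)
      atTop (𝓝 0) := by
    have h3 := tendsto_log_add_sub_log (x + 1) hx1.le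
    have h4 : Tendsto (fun N : ℕ => Real.log (x + 1 + N) - Real.log N - 1 / (x + 1 + N))
        atTop (𝓝 (0 - 0)) := by
      refine h3.sub ?_
      refine Tendsto.div_atTop tendsto_const_nhds ?_
      exact tendsto_atTop_add_const_left _ _ tendsto_natCast_atTop_atTop
    rw [sub_zero] at h4
    refine tendsto_of_tendsto_of_tendsto_of_le_of_le h4 h3 ?_ ?_
    · intro N
      have := Complex.log_sub_one_div_le_re_digamma (x := x + 1 + N) (by positivity)
      simp only; linarith
    · intro N
      have := Complex.re_digamma_le_log (x := x + 1 + N) (by positivity)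
      simp only; linarith
  simpa using h1.sub h2

open Filter Topology in
/-- The partial fraction series of the digamma function. -/
theorem Complex.hasSum_digamma {z : ℂ} (hz : 0 < z.re) :
    HasSum (fun n : ℕ => 1 / ((n : ℂ) + 1) - 1 / (z + 1 + n))
      (Complex.digamma (z + 1) + Real.eulerMascheroniConstant) := by
  have hsum := Complex.summable_digamma_term hz.le
  set M : ℝ := ‖z‖ + 2
  set U : Set ℂ := {w : ℂ | 0 < w.re} ∩ Metric.ball 0 M
  have hUo : IsOpen U := (isOpen_lt continuous_const Complex.continuous_re).inter
    Metric.isOpen_ball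
  have hUc : IsPreconnected U :=
    ((convex_halfSpace_re_gt 0).inter (convex_ball 0 M)).isPreconnected
  have hd : DifferentiableOn ℂ (fun w => ∑' n : ℕ, (1 / ((n : ℂ) + 1) - 1 / (w + 1 + n))) U := by
    refine Complex.differentiableOn_tsum_of_summable_norm
      (summable_one_div_succ_sq.mul_left M) ?_ hUo ?_
    · intro n w hw
      have : w + 1 + n ≠ 0 := by
        intro h
        have := congrArg Complex.re h
        simp at this
        have h1 : 0 < w.re := hw.1
        have : (0 : ℝ) ≤ n := n.cast_nonneg
        linarith
      refine DifferentiableAt.differentiableWithinAt ?_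
      fun_prop (disch := assumption)
    · intro n w hw
      have h1 : 0 < w.re := hw.1
      have h2 : ‖w‖ < M := by simpa using hw.2
      refine (Complex.norm_digamma_term_le h1.le n).trans ?_
      gcongr
  have hd2 : DifferentiableOn ℂ
      (fun w => Complex.digamma (w + 1) + Real.eulerMascheroniConstant) U := by
    have hG : DifferentiableOn ℂ (fun w => Complex.Gamma (w + 1)) U := by
      intro w hw
      have h1 : 0 < w.re := hw.1
      refine DifferentiableAt.differentiableWithinAt ?_
      refine (Complex.differentiableAt_Gamma _ ?_).comp w (by fun_prop)
      intro m h
      have := congrArg Complex.re h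
      simp at this
      have : (0 : ℝ) ≤ m := m.cast_nonneg
      linarith
    have hG' := (hG.deriv hUo)
    refine DifferentiableOn.add_const _ ?_
    refine (hG'.div hG ?_).congr ?_
    · intro w hw
      have h1 : 0 < w.re := hw.1
      exact Complex.Gamma_ne_zero_of_re_pos (by simp; linarith)
    · intro w hw
      rw [Complex.digamma_def, logDeriv_apply, Pi.div_apply, deriv_comp_add_const]
  have h1U : (1 : ℂ) ∈ U := by
    refine ⟨by simp, ?_⟩
    simp [M]
    have := norm_nonneg z
    linarith
  have hzU : z ∈ U := ⟨hz, by simp [M]⟩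
  have hfreq : ∃ᶠ w in 𝓝[≠] (1 : ℂ), (∑' n : ℕ, (1 / ((n : ℂ) + 1) - 1 / (w + 1 + n))) =
      Complex.digamma (w + 1) + Real.eulerMascheroniConstant := by
    have ht : Tendsto (fun x : ℝ => (x : ℂ)) (𝓝[≠] (1 : ℝ)) (𝓝[≠] (1 : ℂ)) := by
      refine tendsto_nhdsWithin_iff.2 ⟨?_, ?_⟩
      · have : Tendsto (fun x : ℝ => (x : ℂ)) (𝓝 (1 : ℝ)) (𝓝 ((1 : ℝ) : ℂ)) :=
          Complex.continuous_ofReal.tendsto _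
        simpa using this.mono_left nhdsWithin_le_nhds
      · filter_upwards [self_mem_nhdsWithin] with x hx
        simpa using hx
    refine ht.frequently ?_
    refine Eventually.frequently ?_
    filter_upwards [nhdsWithin_le_nhds (eventually_gt_nhds (zero_lt_one : (0:ℝ) < 1))] with x hx
    exact (Complex.hasSum_digamma_ofReal hx).tsum_eq
  have heq := (hd.analyticOnNhd hUo).eqOn_of_preconnected_of_frequently_eq
    (hd2.analyticOnNhd hUo) hUc h1U hfreq hzU
  have h := hsum.hasSum
  rwa [show ∑' n : ℕ, (1 / ((n : ℂ) + 1) - 1 / (z + 1 + n)) = _ from heq] at h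

theorem Complex.abs_log_norm_add_one_sub_le {v : ℂ} (hv : 5 / 2 ≤ ‖v‖) :
    |Real.log ‖v + 1‖ - Real.log ‖v‖ - (1 / v).re / 2 - (1 / (v + 1)).re / 2| ≤
      25 / 18 / ‖v‖ ^ 3 := by
  have hv0 : v ≠ 0 := by rintro rfl; norm_num at hv
  have hvp : 0 < ‖v‖ := norm_pos_iff.2 hv0
  set u := 1 / v with hu
  have hun : ‖u‖ = 1 / ‖v‖ := by rw [hu, norm_div, norm_one]
  have hu1 : ‖u‖ ≤ 2 / 5 := by
    rw [hun, div_le_div_iff₀ hvp (by norm_num)]; linarith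
  have hu1' : ‖u‖ < 1 := by linarith
  have h1u : 1 + u ≠ 0 := by
    intro h
    have : u = -1 := by linear_combination h
    rw [this] at hu1; norm_num at hu1
  have h1 := Complex.norm_log_sub_logTaylor_le 2 hu1'
  have hT : Complex.logTaylor 3 u = u - u ^ 2 / 2 := by
    simp [Complex.logTaylor, Finset.sum_range_succ]; ring
  rw [hT] at h1
  have hvv : v + 1 = v * (1 + u) := by rw [hu]; field_simp
  have h2 : Real.log ‖v + 1‖ - Real.log ‖v‖ = (Complex.log (1 + u)).re := by
    rw [Complex.log_re, hvv, norm_mul, Real.log_mul hvp.ne' (norm_ne_zero_iff.2 h1u)]; ring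
  have h3 : 1 / (v + 1) = u / (1 + u) := by
    rw [hvv, hu]; field_simp
  have h4 : Real.log ‖v + 1‖ - Real.log ‖v‖ - u.re / 2 - (1 / (v + 1)).re / 2 =
      ((Complex.log (1 + u) - (u - u ^ 2 / 2)) - u ^ 3 / (2 * (1 + u))).re := by
    have : (Complex.log (1 + u) - (u - u ^ 2 / 2)) - u ^ 3 / (2 * (1 + u)) =
        Complex.log (1 + u) - u / (2 : ℝ) - (u / (1 + u)) / (2 : ℝ) := by
      push_cast
      field_simp; ring
    rw [this, h2, h3, Complex.sub_re, Complex.sub_re, Complex.div_ofReal_re,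
      Complex.div_ofReal_re]
  rw [h4]
  refine (Complex.abs_re_le_norm _).trans ((norm_sub_le _ _).trans ?_)
  have h5 : 1 - ‖u‖ ≤ ‖1 + u‖ := by
    have := norm_sub_norm_le (1 : ℂ) (-u)
    simpa using this
  have h6 : ‖u ^ 3 / (2 * (1 + u))‖ ≤ ‖u‖ ^ 3 * (5 / 6) := by
    have h1n : 0 < ‖1 + u‖ := norm_pos_iff.2 h1u
    rw [norm_div, norm_pow, norm_mul, Complex.norm_ofNat, div_le_iff₀ (by positivity)]
    nlinarith [pow_nonneg (norm_nonneg u) 3]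
  have h7 : ‖Complex.log (1 + u) - (u - u ^ 2 / 2)‖ ≤ ‖u‖ ^ 3 * (5 / 9) := by
    refine h1.trans ?_
    have h8 : (1 - ‖u‖)⁻¹ ≤ 5 / 3 := by
      rw [inv_le_comm₀ (by linarith) (by norm_num)]; linarith
    have h9 : 0 ≤ ‖u‖ ^ 3 := by positivity
    norm_num
    nlinarith
  have h8 : 25 / 18 / ‖v‖ ^ 3 = ‖u‖ ^ 3 * (5 / 9) + ‖u‖ ^ 3 * (5 / 6) := by
    rw [hun]; field_simp; norm_num
  rw [h8]; linarith

open Filter Topology in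
/-- Second-order Stirling-type bound for the real part of the digamma function. -/
theorem Complex.abs_re_digamma_sub_le {w : ℂ} (hw : 1 < w.re) (hn : 5 / 2 ≤ ‖w‖)
    {y : ℝ} (hy : y = |w.im|) (hy0 : 0 < y) :
    |(Complex.digamma w).re - Real.log ‖w‖ + (1 / w).re / 2| ≤ 25 / 9 / y ^ 2 := by
  set x := w.re with hx
  have hnorm : ∀ N : ℕ, ‖w‖ ≤ ‖w + N‖ ∧ (N : ℝ) ≤ ‖w + N‖ ∧
      (x + N) ^ 2 + y ^ 2 = ‖w + N‖ ^ 2 := by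
    intro N
    have hN : (0 : ℝ) ≤ N := N.cast_nonneg
    have h1 : (x + N) ^ 2 + y ^ 2 = ‖w + N‖ ^ 2 := by
      rw [← Complex.normSq_eq_norm_sq, Complex.normSq_apply, hy, sq_abs]; simp; ring
    have h2 : x ^ 2 + y ^ 2 = ‖w‖ ^ 2 := by
      rw [← Complex.normSq_eq_norm_sq, Complex.normSq_apply, hy, sq_abs]; ring
    refine ⟨?_, ?_, h1⟩
    · refine le_of_sq_le_sq ?_ (norm_nonneg _)
      nlinarith
    · refine le_of_sq_le_sq ?_ (norm_nonneg _)
      nlinarith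
  set B : ℕ → ℝ := fun N => Real.log ‖w + N‖ - ∑ n ∈ Finset.range N, (1 / (w + n)).re
    - Real.log ‖w‖ + (1 / w).re / 2 - (1 / (w + N)).re / 2 with hB
  have hBb : ∀ N, |B N| ≤ 25 / 9 / y * (1 / (x - 1 + y) - 1 / (x + N - 1 + y)) := by
    intro N
    induction N with
    | zero => simp [hB]
    | succ N ih =>
      have hN : (0 : ℝ) ≤ N := N.cast_nonneg
      obtain ⟨h1, h2, h3⟩ := hnorm N
      have hs := Complex.abs_log_norm_add_one_sub_le (v := w + N) (hn.trans h1)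
      have hstep : B (N + 1) = B N + (Real.log ‖w + N + 1‖ - Real.log ‖w + N‖
          - (1 / (w + N)).re / 2 - (1 / (w + N + 1)).re / 2) := by
        simp only [hB, Finset.sum_range_succ, Nat.cast_succ, ← add_assoc]; ring
      have hp : 0 < ‖w + N‖ := lt_of_lt_of_le (by linarith) h1
      have hyle : y ≤ ‖w + N‖ := by
        refine le_of_sq_le_sq ?_ hp.le
        nlinarith [sq_nonneg (x + N)]
      have hb : 25 / 18 / ‖w + N‖ ^ 3 ≤
          25 / 9 / y * (1 / (x + N - 1 + y) - 1 / (x + (N + 1) - 1 + y)) := by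
        have e1 : 0 < x + N - 1 + y := by linarith
        have e2 : 0 < x + (N + 1) - 1 + y := by linarith
        have e3 : 1 / (x + N - 1 + y) - 1 / (x + (N + 1) - 1 + y) =
            1 / ((x + N - 1 + y) * (x + (N + 1) - 1 + y)) := by
          field_simp; ring
        rw [e3, div_mul_div_comm, mul_one, div_div, div_le_div_iff₀ (by positivity) (by positivity)]
        have e4 : (x + N - 1 + y) * (x + (N + 1) - 1 + y) ≤ 2 * ‖w + N‖ ^ 2 := by
          rw [← h3]; nlinarith [sq_nonneg (x + N - y)]
        have e5 : y * ((x + N - 1 + y) * (x + (N + 1) - 1 + y)) ≤ ‖w + N‖ * (2 * ‖w + N‖ ^ 2) :=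
          mul_le_mul hyle e4 (by positivity) hp.le
        nlinarith
      rw [hstep]
      push_cast
      calc _ ≤ |B N| + _ := abs_add_le _ _
        _ ≤ 25 / 9 / y * (1 / (x - 1 + y) - 1 / (x + N - 1 + y)) +
          25 / 9 / y * (1 / (x + N - 1 + y) - 1 / (x + (N + 1) - 1 + y)) :=
          add_le_add ih (hs.trans hb)
        _ = _ := by ring
  have hBb2 : ∀ N, |B N| ≤ 25 / 9 / y ^ 2 := by
    intro N
    refine (hBb N).trans ?_
    have hN : (0 : ℝ) ≤ N := N.cast_nonneg
    have e1 : 0 < x + N - 1 + y := by linarith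
    have e2 : 1 / (x - 1 + y) ≤ 1 / y := by gcongr; linarith
    have e3 : 0 < 1 / (x + N - 1 + y) := by positivity
    calc _ ≤ 25 / 9 / y * (1 / y) := by gcongr; linarith
      _ = _ := by field_simp
  have hlim : Tendsto B atTop
      (𝓝 ((Complex.digamma w).re - Real.log ‖w‖ + (1 / w).re / 2)) := by
    have hs := (Complex.hasSum_re (Complex.hasSum_digamma (z := w - 1) (by simp; exact hw))
      ).tendsto_sum_nat
    simp only [sub_add_cancel, Complex.add_re, Complex.ofReal_re, Complex.sub_re] at hs
    have hl : Tendsto (fun N : ℕ => Real.log ‖w + N‖ - Real.log N) atTop (𝓝 0) := by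
      refine tendsto_of_tendsto_of_tendsto_of_le_of_le' tendsto_const_nhds
        (tendsto_log_add_sub_log ‖w‖ (norm_nonneg _)) ?_ ?_
      · filter_upwards [eventually_gt_atTop 0] with N hN
        have : (0 : ℝ) < N := by exact_mod_cast hN
        have := Real.log_le_log this (hnorm N).2.1
        linarith
      · filter_upwards [eventually_gt_atTop 0] with N hN
        have hN' : (0 : ℝ) < N := by exact_mod_cast hN
        have h1 : ‖w + N‖ ≤ ‖w‖ + N := (norm_add_le _ _).trans (by simp)
        have := Real.log_le_log (hN'.trans_le (hnorm N).2.1) h1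
        linarith
    have h0 : Tendsto (fun N : ℕ => (1 / (w + N)).re / 2) atTop (𝓝 0) := by
      have : Tendsto (fun N : ℕ => 1 / (N : ℝ)) atTop (𝓝 0) := tendsto_one_div_atTop_nhds_zero_nat
      refine squeeze_zero_norm' ?_ this
      filter_upwards [eventually_gt_atTop 0] with N hN
      have hN' : (0 : ℝ) < N := by exact_mod_cast hN
      have h1 := (Complex.abs_re_le_norm (1 / (w + N)))
      rw [norm_div, norm_one] at h1
      have h2 : 1 / ‖w + N‖ ≤ 1 / N := by gcongr; exact (hnorm N).2.1
      have h3 := abs_nonneg (1 / (w + N)).re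
      rw [Real.norm_eq_abs, abs_div, abs_two]
      linarith
    have hall := ((((hs.sub Real.tendsto_harmonic_sub_log).add hl).sub_const
      (Real.log ‖w‖)).add_const ((1 / w).re / 2)).sub h0
    refine (hall.congr ?_).trans ?_
    · intro N
      have : ((harmonic N : ℚ) : ℝ) = ∑ n ∈ Finset.range N, (1 / ((n : ℂ) + 1)).re := by
        rw [harmonic]; push_cast
        refine Finset.sum_congr rfl fun n _ => ?_
        have : (1 / ((n : ℂ) + 1)) = ((1 / ((n : ℝ) + 1) : ℝ) : ℂ) := by push_cast; rfl
        rw [this, Complex.ofReal_re, one_div]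
      simp only [hB]
      rw [Finset.sum_sub_distrib, this]; ring
    · refine le_of_eq ?_
      congr 1; ring
  exact le_of_tendsto hlim.abs (Eventually.of_forall hBb2)

open ComplexConjugate in
theorem hasSum_xiOrd_re {s : ℂ} (hs : 1 ≤ s.re) :
    HasSum (fun ρ : ℂ => (xiOrd ρ : ℝ) * (1 / (s - ρ)).re) (logDeriv entireXi s).re := by
  have hnn : ∀ ρ : ℂ, 0 ≤ (xiOrd ρ : ℝ) * (1 / (s - ρ)).re := by
    intro ρ
    by_cases h : xiOrd ρ = 0
    · simp [h]
    have h1 := re_lt_one_of_entireXi_eq_zero (entireXi_eq_zero_of_xiOrd_ne_zero h)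
    refine mul_nonneg (Nat.cast_nonneg _) ?_
    rw [one_div, Complex.inv_re]
    refine div_nonneg ?_ (Complex.normSq_nonneg _)
    rw [Complex.sub_re]; linarith
  have ht := (Complex.continuous_re.tendsto _).comp
    (tendsto_sum_xiZeros (entireXi_ne_zero_of_one_le_re hs))
  have ht' : Filter.Tendsto (fun n => ∑ ρ ∈ xiZeros n, (xiOrd ρ : ℝ) * (1 / (s - ρ)).re)
      Filter.atTop (nhds (logDeriv entireXi s).re) := by
    refine ht.congr fun n => ?_
    simp only [Function.comp, Complex.re_sum]
    refine Finset.sum_congr rfl fun ρ _ => ?_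
    rw [div_eq_mul_one_div, ← Complex.ofReal_natCast, Complex.re_ofReal_mul]
  have hmono : Monotone (fun n => ∑ ρ ∈ xiZeros n, (xiOrd ρ : ℝ) * (1 / (s - ρ)).re) :=
    fun a b hab => Finset.sum_le_sum_of_subset_of_nonneg (xiZeros_mono hab) fun ρ _ _ => hnn ρ
  refine hasSum_of_isLUB_of_nonneg _ hnn ⟨?_, ?_⟩
  · rintro _ ⟨t, rfl⟩
    obtain ⟨n, hn⟩ : ∃ n : ℕ, ∀ ρ ∈ t, ‖ρ - 1 / 2‖ ≤ n := by
      obtain ⟨n, hn⟩ := exists_nat_ge (∑ ρ ∈ t, ‖ρ - 1 / 2‖)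
      exact ⟨n, fun ρ hρ => (Finset.single_le_sum (f := fun ρ : ℂ => ‖ρ - 1 / 2‖)
        (fun _ _ => norm_nonneg _) hρ).trans hn⟩
    refine le_trans ?_ (hmono.ge_of_tendsto ht' n)
    have : ∑ ρ ∈ t, (xiOrd ρ : ℝ) * (1 / (s - ρ)).re =
        ∑ ρ ∈ t with xiOrd ρ ≠ 0, (xiOrd ρ : ℝ) * (1 / (s - ρ)).re := by
      rw [Finset.sum_filter]
      refine Finset.sum_congr rfl fun ρ _ => ?_
      split_ifs with h
      · rfl
      · simp only [not_not] at h; simp [h]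
    simp only [this]
    refine Finset.sum_le_sum_of_subset_of_nonneg ?_ fun ρ _ _ => hnn ρ
    intro ρ hρ
    rw [Finset.mem_filter] at hρ
    exact mem_xiZeros.2 ⟨hn ρ hρ.1, entireXi_eq_zero_of_xiOrd_ne_zero hρ.2⟩
  · intro b hb
    exact le_of_tendsto' ht' fun n => hb ⟨xiZeros n, rfl⟩

open ComplexConjugate in
/-- Symmetrised form under `ρ ↦ 1 - conj ρ`. -/
theorem hasSum_xiOrd_re_symm {s : ℂ} (hs : 1 ≤ s.re) :
    HasSum (fun ρ : ℂ => (xiOrd ρ : ℝ) * (((1 / (s - ρ)).re + (1 / (s - (1 - conj ρ))).re) / 2))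
      (logDeriv entireXi s).re := by
  have h1 := hasSum_xiOrd_re hs
  let e : ℂ ≃ ℂ :=
    ⟨fun ρ => 1 - conj ρ, fun ρ => 1 - conj ρ, fun ρ => by simp, fun ρ => by simp⟩
  have h2 := (Equiv.hasSum_iff e).2 h1
  have h3 := (h1.add h2).div_const 2
  rw [add_self_div_two] at h3
  refine h3.congr_fun ?_
  intro ρ
  simp only [Function.comp, e, Equiv.coe_fn_mk, xiOrd_one_sub, xiOrd_conj]
  ring

theorem logDeriv_Gammaℝ {s : ℂ} (hs : 0 < s.re) :
    logDeriv Complex.Gammaℝ s = -(Real.log Real.pi : ℂ) / 2 + Complex.digamma (s / 2 + 1) / 2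
      - 1 / s := by
  have hs2 : 0 < (s / 2).re := by simpa using hs
  have hG : DifferentiableAt ℂ Complex.Gamma (s / 2) := by
    refine Complex.differentiableAt_Gamma _ fun m h => ?_
    have h0 := congrArg Complex.re h
    have : (0 : ℝ) ≤ m := m.cast_nonneg
    rw [Complex.neg_re, Complex.natCast_re] at h0
    linarith
  have hπ : (Real.pi : ℂ) ≠ 0 := by exact_mod_cast Real.pi_ne_zero
  have hs0 : s ≠ 0 := by rintro rfl; simp at hs
  have h1 : HasDerivAt (fun z : ℂ => (Real.pi : ℂ) ^ (-z / 2))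
      ((Real.pi : ℂ) ^ (-s / 2) * Complex.log Real.pi * (-1 / 2)) s :=
    (((hasDerivAt_id s).neg).div_const 2).const_cpow (Or.inl hπ)
  have h2 : HasDerivAt (fun z : ℂ => Complex.Gamma (z / 2)) (deriv Complex.Gamma (s / 2) * (1 / 2))
      s := hG.hasDerivAt.comp s ((hasDerivAt_id s).div_const 2)
  have e : Complex.Gammaℝ = fun z => (Real.pi : ℂ) ^ (-z / 2) * Complex.Gamma (z / 2) := by
    ext z; exact Complex.Gammaℝ_def z
  have hΓ := Complex.Gamma_ne_zero_of_re_pos hs2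
  have hp : (Real.pi : ℂ) ^ (-s / 2) ≠ 0 := by simp [Complex.cpow_eq_zero_iff, hπ]
  rw [e, logDeriv_mul s hp hΓ h1.differentiableAt h2.differentiableAt,
    logDeriv_apply, logDeriv_apply, h1.deriv, h2.deriv,
    Complex.digamma_add_one_of_re_pos hs2, Complex.digamma_def, logDeriv_apply,
    Complex.ofReal_log Real.pi_pos.le]
  field_simp
  ring

theorem logDeriv_entireXi_eq {s : ℂ} (hs : 1 < s.re) :
    logDeriv entireXi s = 1 / (s - 1) - (Real.log Real.pi : ℂ) / 2
      + Complex.digamma (s / 2 + 1) / 2 + logDeriv riemannZeta s := by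
  have hs1 : s ≠ 1 := by rintro rfl; simp at hs
  have hs0 : s ≠ 0 := by rintro rfl; norm_num at hs
  have hsr : 0 < s.re := by linarith
  have hev : entireXi =ᶠ[nhds s] fun z => (z * (z - 1)) * (Complex.Gammaℝ z * riemannZeta z) := by
    filter_upwards [isOpen_ne.mem_nhds hs1,
      (isOpen_lt continuous_const Complex.continuous_re).mem_nhds hsr] with z h1 h2
    exact entireXi_eq_mul_zeta h2 h1
  have hd : DifferentiableAt ℂ Complex.Gammaℝ s := by
    have := Complex.differentiable_Gammaℝ_inv s
    have h2 := this.inv (inv_ne_zero (Complex.Gammaℝ_ne_zero_of_re_pos hsr))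
    have e : (fun z => (Complex.Gammaℝ z)⁻¹)⁻¹ = Complex.Gammaℝ := by ext z; simp
    rwa [e] at h2
  have hz := differentiableAt_riemannZeta hs1
  have hz0 := riemannZeta_ne_zero_of_one_le_re hs.le
  have hg0 := Complex.Gammaℝ_ne_zero_of_re_pos hsr
  have h10 : s - 1 ≠ 0 := sub_ne_zero.2 hs1
  rw [(logDeriv_congr_nhds hev).eq_of_nhds,
    logDeriv_mul (f := fun z => z * (z - 1)) (g := fun z => Complex.Gammaℝ z * riemannZeta z) s
      (mul_ne_zero hs0 h10) (mul_ne_zero hg0 hz0) (by fun_prop) (hd.mul hz),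
    logDeriv_mul (f := fun z => z) (g := fun z => z - 1) s hs0 h10 (by fun_prop) (by fun_prop),
    logDeriv_mul s hg0 hz0 hd hz,
    logDeriv_Gammaℝ hsr, logDeriv_id']
  have : logDeriv (fun z : ℂ => z - 1) s = 1 / (s - 1) := by
    rw [logDeriv_apply]; simp
  rw [this]; ring

theorem logDeriv_entireXi_one :
    logDeriv entireXi 1 =
      ((1 + Real.eulerMascheroniConstant / 2 - Real.log (4 * Real.pi) / 2 : ℝ) : ℂ) := by
  have hd : HasDerivAt entireXi (completedRiemannZeta₀ 1) 1 := by
    have h0 := (differentiable_completedZeta₀ 1).hasDerivAt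
    have h1 : HasDerivAt (fun s : ℂ => s * (s - 1)) (1 * (1 - 1) + 1 * 1) 1 :=
      (hasDerivAt_id (1 : ℂ)).mul ((hasDerivAt_id (1 : ℂ)).sub_const 1)
    have := (h1.mul h0).add_const 1
    convert! this using 1
    simp
  rw [logDeriv_apply, hd.deriv, entireXi_one, completedRiemannZeta₀_one]
  have : Complex.log (4 * Real.pi) = (Real.log (4 * Real.pi) : ℂ) := by
    rw [Complex.ofReal_log (by positivity)]; push_cast; rfl
  rw [this]; push_cast; ring

theorem log_four_mul_pi_gt : (2.5306 : ℝ) < Real.log (4 * Real.pi) := by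
  rw [Real.log_mul (by norm_num) Real.pi_ne_zero,
    show (4 : ℝ) = 2 ^ 2 by norm_num, Real.log_pow]
  have h2 := Real.log_two_gt_d9
  have hπ : (1.14435 : ℝ) < Real.log Real.pi := by
    rw [Real.lt_log_iff_exp_lt Real.pi_pos]
    have h3 := Real.pi_gt_d4
    have he := Real.exp_one_lt_d9
    have h4 : Real.exp 0.14435 ≤ 1.1553 := by
      have := Real.exp_bound' (x := 0.14435) (by norm_num) (by norm_num) (n := 4) (by norm_num)
      refine this.trans ?_
      norm_num [Finset.sum_range_succ, Nat.factorial]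
    have h5 : Real.exp 1.14435 = Real.exp 1 * Real.exp 0.14435 := by
      rw [← Real.exp_add]; norm_num
    rw [h5]
    have := Real.exp_pos 0.14435
    nlinarith
  push_cast
  linarith

theorem Real.eulerMascheroniConstant_lt_d3 : Real.eulerMascheroniConstant < 0.5851 := by
  refine (Real.eulerMascheroniConstant_lt_eulerMascheroniSeq' 64).trans ?_
  have h1 : Real.eulerMascheroniSeq' 64 = (harmonic 64 : ℝ) - Real.log 64 := by
    simp [Real.eulerMascheroniSeq']
  have h2 : (harmonic 64 : ℚ) < 4.7439 := by decide +kernel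
  have h3 : ((harmonic 64 : ℚ) : ℝ) < ((4.7439 : ℚ) : ℝ) := by exact_mod_cast h2
  rw [h1, show (64 : ℝ) = 2 ^ 6 by norm_num, Real.log_pow]
  have := Real.log_two_gt_d9
  push_cast at h3 ⊢
  linarith

theorem logDeriv_entireXi_one_re_le : (logDeriv entireXi 1).re ≤ 0.0273 := by
  rw [logDeriv_entireXi_one, Complex.ofReal_re]
  have := log_four_mul_pi_gt
  have := Real.eulerMascheroniConstant_lt_d3
  linarith

open ComplexConjugate in
theorem half_div_le_symm_term {ρ : ℂ} (h : xiOrd ρ ≠ 0) :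
    1 / (1 + ρ.im ^ 2) / 2 ≤ ((1 / (1 - ρ)).re + (1 / (1 - (1 - conj ρ))).re) / 2 := by
  have h0 := entireXi_eq_zero_of_xiOrd_ne_zero h
  have h1 := re_lt_one_of_entireXi_eq_zero h0
  have h2 := re_pos_of_entireXi_eq_zero h0
  have e1 : (1 / (1 - ρ)).re = (1 - ρ.re) / ((1 - ρ.re) ^ 2 + ρ.im ^ 2) := by
    rw [one_div, Complex.inv_re, Complex.normSq_apply]; simp; ring
  have e2 : (1 / (1 - (1 - conj ρ))).re = ρ.re / (ρ.re ^ 2 + ρ.im ^ 2) := by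
    rw [sub_sub_cancel, one_div, Complex.inv_re, Complex.normSq_apply]; simp; ring
  rw [e1, e2]
  set β := ρ.re
  set g := ρ.im
  have i1 : (1 - β) / (1 + g ^ 2) ≤ (1 - β) / ((1 - β) ^ 2 + g ^ 2) := by
    apply div_le_div_of_nonneg_left <;> nlinarith [sq_nonneg g]
  have i2 : β / (1 + g ^ 2) ≤ β / (β ^ 2 + g ^ 2) := by
    apply div_le_div_of_nonneg_left <;> nlinarith [sq_nonneg g]
  have : 1 / (1 + g ^ 2) = (1 - β) / (1 + g ^ 2) + β / (1 + g ^ 2) := by ring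
  linarith

open ComplexConjugate in
theorem xiOrd_div_le_symm_term (ρ : ℂ) :
    (xiOrd ρ : ℝ) * (1 / (1 + ρ.im ^ 2)) ≤
      2 * ((xiOrd ρ : ℝ) * (((1 / (1 - ρ)).re + (1 / (1 - (1 - conj ρ))).re) / 2)) := by
  by_cases h : xiOrd ρ = 0
  · simp [h]
  · have := half_div_le_symm_term h
    have h2 : (0 : ℝ) ≤ xiOrd ρ := Nat.cast_nonneg _
    nlinarith

theorem summable_xiOrd_div : Summable (fun ρ : ℂ => (xiOrd ρ : ℝ) * (1 / (1 + ρ.im ^ 2))) :=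
  Summable.of_nonneg_of_le (fun ρ => by positivity) xiOrd_div_le_symm_term
    ((hasSum_xiOrd_re_symm (s := 1) (by simp)).summable.mul_left 2)

theorem tsum_xiOrd_div_le : ∑' ρ : ℂ, (xiOrd ρ : ℝ) * (1 / (1 + ρ.im ^ 2)) ≤ 0.0546 := by
  have h := (hasSum_xiOrd_re_symm (s := 1) (by simp)).mul_left 2
  refine (summable_xiOrd_div.tsum_le_tsum xiOrd_div_le_symm_term h.summable).trans ?_
  rw [h.tsum_eq]
  have := logDeriv_entireXi_one_re_le
  linarith

open ComplexConjugate in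
theorem im_sq_ge_of_xiOrd_ne_zero {ρ : ℂ} (h : xiOrd ρ ≠ 0) : 35 ≤ ρ.im ^ 2 := by
  have hm : (1 : ℝ) ≤ xiOrd ρ := by exact_mod_cast Nat.one_le_iff_ne_zero.2 h
  have hpos : ∀ ρ : ℂ, 0 ≤ (xiOrd ρ : ℝ) * (1 / (1 + ρ.im ^ 2)) := fun ρ => by positivity
  have hle := tsum_xiOrd_div_le
  have himne : ρ.im ≠ 0 := by
    intro h0
    have := summable_xiOrd_div.le_tsum ρ fun j _ => hpos j
    rw [h0] at this
    norm_num at this hle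
    linarith
  have hne : ρ ≠ conj ρ := by
    intro h0
    have := congrArg Complex.im h0
    rw [Complex.conj_im] at this
    apply himne; linarith
  have h2 := summable_xiOrd_div.sum_le_tsum {ρ, conj ρ} fun j _ => hpos j
  rw [Finset.sum_pair hne, xiOrd_conj, Complex.conj_im, neg_sq] at h2
  by_contra hlt
  push Not at hlt
  have h3 : (1 : ℝ) / 36 ≤ 1 / (1 + ρ.im ^ 2) := by
    apply one_div_le_one_div_of_le <;> nlinarith
  nlinarith

theorem one_le_norm_of_xiOrd_ne_zero {ρ : ℂ} (h : xiOrd ρ ≠ 0) : 1 ≤ ‖ρ‖ := by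
  have h1 := im_sq_ge_of_xiOrd_ne_zero h
  have h2 := Complex.abs_im_le_norm ρ
  have h3 : (1 : ℝ) ≤ |ρ.im| := by
    rw [← abs_one, ← sq_le_sq]; linarith
  linarith

theorem summable_xiOrd_div_norm_sq : Summable (fun ρ : ℂ => (xiOrd ρ : ℝ) / ‖ρ‖ ^ 2) := by
  refine Summable.of_nonneg_of_le (fun ρ => by positivity) (fun ρ => ?_)
    (summable_xiOrd_div.mul_left 2)
  by_cases h : xiOrd ρ = 0
  · simp [h]
  have h1 := im_sq_ge_of_xiOrd_ne_zero h
  have h2 : ρ.im ^ 2 ≤ ‖ρ‖ ^ 2 := by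
    rw [← sq_abs]; exact pow_le_pow_left₀ (abs_nonneg _) (Complex.abs_im_le_norm ρ) 2
  have h3 : (0 : ℝ) ≤ xiOrd ρ := Nat.cast_nonneg _
  have h4 : 1 / ‖ρ‖ ^ 2 ≤ 2 * (1 / (1 + ρ.im ^ 2)) := by
    rw [mul_one_div, div_le_div_iff₀ (by nlinarith) (by positivity)]
    nlinarith
  calc (xiOrd ρ : ℝ) / ‖ρ‖ ^ 2 = xiOrd ρ * (1 / ‖ρ‖ ^ 2) := by ring
    _ ≤ xiOrd ρ * (2 * (1 / (1 + ρ.im ^ 2))) := by gcongr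
    _ = _ := by ring

theorem hasSum_xiOrd_logDeriv {s : ℂ} (hs : 1 < s.re) :
    HasSum (fun ρ : ℂ => (xiOrd ρ : ℂ) * (1 / (s - ρ) + 1 / ρ))
      (logDeriv entireXi s - logDeriv entireXi 0) := by
  have hsum : Summable (fun ρ : ℂ => (xiOrd ρ : ℂ) * (1 / (s - ρ) + 1 / ρ)) := by
    set K : ℝ := ‖s‖ * ((1 + (s.re - 1) + ‖s‖) / (s.re - 1)) with hK
    refine Summable.of_norm_bounded (summable_xiOrd_div_norm_sq.mul_left K) fun ρ => ?_
    by_cases h : xiOrd ρ = 0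
    · simp [h]
    have h1 := one_le_norm_of_xiOrd_ne_zero h
    have hre := re_lt_one_of_entireXi_eq_zero (entireXi_eq_zero_of_xiOrd_ne_zero h)
    have hρ : ρ ≠ 0 := by rintro rfl; simp at h1; linarith
    have h2 : s.re - 1 ≤ ‖s - ρ‖ := by
      have := Complex.re_le_norm (s - ρ)
      rw [Complex.sub_re] at this; linarith
    have h2' : 0 < ‖s - ρ‖ := by linarith
    have h3 : ‖ρ‖ * (s.re - 1) ≤ ‖s - ρ‖ * (1 + (s.re - 1) + ‖s‖) := by
      have h4 : ‖ρ‖ ≤ ‖s - ρ‖ + ‖s‖ := by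
        have := norm_sub_le s (s - ρ)
        rw [sub_sub_cancel] at this; linarith
      have := norm_nonneg s
      nlinarith
    have h5 : s - ρ ≠ 0 := norm_pos_iff.1 h2'
    have e : 1 / (s - ρ) + 1 / ρ = s / ((s - ρ) * ρ) := by field_simp; ring
    have hp : 0 < ‖ρ‖ := by linarith
    rw [e, norm_mul, norm_div, norm_mul, Complex.norm_natCast]
    have hs1 : 0 < s.re - 1 := by linarith
    have h6 : ‖s‖ / (‖s - ρ‖ * ‖ρ‖) ≤ K * (1 / ‖ρ‖ ^ 2) := by
      rw [hK, mul_one_div, div_le_div_iff₀ (by positivity) (by positivity), mul_assoc]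
      refine mul_le_mul_of_nonneg_left ?_ (norm_nonneg s)
      rw [div_mul_eq_mul_div, le_div_iff₀ hs1]
      nlinarith
    calc _ ≤ (xiOrd ρ : ℝ) * (K * (1 / ‖ρ‖ ^ 2)) := by gcongr
      _ = _ := by ring
  have h0 : entireXi 0 ≠ 0 := by simp [entireXi_zero]
  have ht := (tendsto_sum_xiZeros (entireXi_ne_zero_of_one_le_re hs.le)).sub
    (tendsto_sum_xiZeros h0)
  suffices hh : Filter.Tendsto (fun n => ∑ ρ ∈ xiZeros n, (xiOrd ρ : ℂ) * (1 / (s - ρ) + 1 / ρ))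
      Filter.atTop (nhds (∑' ρ : ℂ, (xiOrd ρ : ℂ) * (1 / (s - ρ) + 1 / ρ))) by
    have e : ∀ n, ∑ ρ ∈ xiZeros n, (xiOrd ρ : ℂ) * (1 / (s - ρ) + 1 / ρ) =
        ∑ ρ ∈ xiZeros n, (xiOrd ρ : ℂ) / (s - ρ) - ∑ ρ ∈ xiZeros n, (xiOrd ρ : ℂ) / (0 - ρ) := by
      intro n
      rw [← Finset.sum_sub_distrib]
      refine Finset.sum_congr rfl fun ρ _ => ?_
      rw [zero_sub, div_neg]; ring
    simp_rw [e] at hh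
    rw [tendsto_nhds_unique ht hh]
    exact hsum.hasSum
  rw [Filter.tendsto_def]
  intro u hu
  obtain ⟨t, ht⟩ := Filter.mem_atTop_sets.1 (hsum.hasSum hu)
  obtain ⟨N, hN⟩ : ∃ n : ℕ, ∀ ρ ∈ t, ‖ρ - 1 / 2‖ ≤ n := by
    obtain ⟨n, hn⟩ := exists_nat_ge (∑ ρ ∈ t, ‖ρ - 1 / 2‖)
    exact ⟨n, fun ρ hρ => (Finset.single_le_sum (f := fun ρ : ℂ => ‖ρ - 1 / 2‖)
      (fun _ _ => norm_nonneg _) hρ).trans hn⟩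
  filter_upwards [Filter.eventually_ge_atTop N] with n hn
  have h1 := ht (xiZeros n ∪ t) Finset.subset_union_right
  rw [Set.mem_preimage] at h1 ⊢
  have h2 := Finset.sum_subset (s₁ := xiZeros n) (s₂ := xiZeros n ∪ t)
    (f := fun ρ : ℂ => (xiOrd ρ : ℂ) * (1 / (s - ρ) + 1 / ρ)) Finset.subset_union_left (by
      intro ρ h3 h4
      have h5 : ρ ∈ t := (Finset.mem_union.1 h3).resolve_left h4
      rw [xiOrd_eq_zero]
      · simp
      · intro h6
        exact h4 (mem_xiZeros.2 ⟨(hN ρ h5).trans (by exact_mod_cast hn), h6⟩))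
  rw [h2]
  exact h1

theorem logDeriv_entireXi_zero : logDeriv entireXi 0 = -logDeriv entireXi 1 := by
  have h : entireXi = fun z => entireXi (1 - z) := by ext z; rw [entireXi_one_sub]
  have h2 : deriv entireXi 0 = -deriv entireXi 1 := by
    conv_lhs => rw [h]
    rw [deriv_comp_const_sub, sub_zero]
  rw [logDeriv_apply, logDeriv_apply, h2, entireXi_zero, entireXi_one]; ring

/-- The abscissa paired with `σ` in Stechkin's argument; `τ (τ - 1) = σ ^ 2`. -/
noncomputable def stechkinAbscissa (σ : ℝ) : ℝ := (1 + Real.sqrt (1 + 4 * σ ^ 2)) / 2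

theorem stechkinAbscissa_mul (σ : ℝ) :
    stechkinAbscissa σ ^ 2 - stechkinAbscissa σ = σ ^ 2 := by
  have := Real.sq_sqrt (show (0 : ℝ) ≤ 1 + 4 * σ ^ 2 by positivity)
  unfold stechkinAbscissa
  nlinarith

theorem lt_stechkinAbscissa (σ : ℝ) : σ + 1 / 2 ≤ stechkinAbscissa σ := by
  have : 2 * σ ≤ Real.sqrt (1 + 4 * σ ^ 2) := by
    apply Real.le_sqrt_of_sq_le; nlinarith
  unfold stechkinAbscissa; linarith

theorem stechkin_mul_le {σ κ : ℝ} (hσ : 1 ≤ σ) (hκ2 : 5 * κ ^ 2 ≤ 1) :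
    κ * (2 * stechkinAbscissa σ - 1) ≤ σ := by
  have h1 := stechkinAbscissa_mul σ
  have h2 := lt_stechkinAbscissa σ
  set τ := stechkinAbscissa σ
  refine le_of_sq_le_sq ?_ (by linarith)
  have : (κ * (2 * τ - 1)) ^ 2 = κ ^ 2 * (1 + 4 * σ ^ 2) := by
    rw [← h1]; ring
  rw [this]
  nlinarith

theorem stechkin_real {σ κ β y : ℝ} (hσ : 1 < σ) (hκ : 0 ≤ κ) (hκ2 : 5 * κ ^ 2 ≤ 1)
    (hβ0 : 0 < β) (hβ1 : β < 1) :
    κ * ((stechkinAbscissa σ - β) / ((stechkinAbscissa σ - β) ^ 2 + y ^ 2) +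
      (stechkinAbscissa σ - (1 - β)) / ((stechkinAbscissa σ - (1 - β)) ^ 2 + y ^ 2)) ≤
    (σ - β) / ((σ - β) ^ 2 + y ^ 2) + (σ - (1 - β)) / ((σ - (1 - β)) ^ 2 + y ^ 2) := by
  have h1 := stechkinAbscissa_mul σ
  have h2 := lt_stechkinAbscissa σ
  have h3 := stechkin_mul_le hσ.le hκ2
  set τ := stechkinAbscissa σ
  have comb : ∀ a b : ℝ, 0 < a → 0 < b → a / (a ^ 2 + y ^ 2) + b / (b ^ 2 + y ^ 2) =
      (a + b) * (a * b + y ^ 2) / ((a * b + y ^ 2) ^ 2 + y ^ 2 * (a - b) ^ 2) := by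
    intro a b ha hb
    have e1 : 0 < a ^ 2 + y ^ 2 := by positivity
    have e2 : 0 < b ^ 2 + y ^ 2 := by positivity
    have e3 : (a * b + y ^ 2) ^ 2 + y ^ 2 * (a - b) ^ 2 = (a ^ 2 + y ^ 2) * (b ^ 2 + y ^ 2) := by
      ring
    rw [e3, div_add_div _ _ e1.ne' e2.ne']
    congr 1; ring
  rw [comb _ _ (by linarith) (by linarith), comb _ _ (by linarith) (by linarith)]
  have hd : 0 < β * (1 - β) := mul_pos hβ0 (by linarith)
  have hd4 : (1 - 2 * β) ^ 2 ≤ 1 := by nlinarith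
  have hM : 0 < (σ - β) * (σ - (1 - β)) := mul_pos (by linarith) (by linarith)
  set M := (σ - β) * (σ - (1 - β)) with hMdef
  have eS : (τ - β) * (τ - (1 - β)) = M + σ := by
    rw [hMdef]; nlinarith
  rw [eS]
  have eY : 0 ≤ y ^ 2 := sq_nonneg y
  generalize y ^ 2 = Y at *
  have hlow : σ / (M + σ + Y) ≤
      (σ - β + (σ - (1 - β))) * (M + Y) / ((M + Y) ^ 2 + Y * (σ - β - (σ - (1 - β))) ^ 2) := by
    rw [div_le_div_iff₀ (by linarith) (by positivity)]
    have e : (σ - β - (σ - (1 - β))) ^ 2 = (1 - 2 * β) ^ 2 := by ring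
    have e2 : σ - β + (σ - (1 - β)) = 2 * σ - 1 := by ring
    rw [e, e2]
    have i1 : σ * (Y * (1 - 2 * β) ^ 2) ≤ σ * Y := by
      have : Y * (1 - 2 * β) ^ 2 ≤ Y * 1 := mul_le_mul_of_nonneg_left hd4 eY
      nlinarith
    have i2 : 0 ≤ (σ - 1) * (M + Y) ^ 2 := mul_nonneg (by linarith) (sq_nonneg _)
    have i3 : 0 ≤ (2 * σ - 2) * σ * (M + Y) :=
      mul_nonneg (mul_nonneg (by linarith) (by linarith)) (by linarith)
    have i4 : 0 < σ * M := mul_pos (by linarith) hM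
    nlinarith
  refine le_trans ?_ hlow
  have hS : 0 < M + σ + Y := by linarith
  have e2 : τ - β + (τ - (1 - β)) = 2 * τ - 1 := by ring
  rw [e2, ← mul_div_assoc]
  rw [div_le_div_iff₀ (by positivity) hS]
  have i1 : κ * (2 * τ - 1) * (M + σ + Y) ^ 2 ≤ σ * (M + σ + Y) ^ 2 :=
    mul_le_mul_of_nonneg_right h3 (sq_nonneg _)
  have i2 : 0 ≤ σ * (Y * (τ - β - (τ - (1 - β))) ^ 2) :=
    mul_nonneg (by linarith) (mul_nonneg eY (sq_nonneg _))
  nlinarith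

theorem stechkin_real_extra {σ κ β : ℝ} (hσ : 1 < σ) (hκ : 0 ≤ κ) (hκ2 : 5 * κ ^ 2 ≤ 1)
    (hβ0 : 0 < β) (hβ1 : β < 1) :
    κ * (1 / (stechkinAbscissa σ - β) + 1 / (stechkinAbscissa σ - (1 - β))) ≤
      1 / (σ - (1 - β)) := by
  have h1 := stechkinAbscissa_mul σ
  have h2 := lt_stechkinAbscissa σ
  have h3 := stechkin_mul_le hσ.le hκ2
  set τ := stechkinAbscissa σ
  have p1 : 0 < τ - β := by linarith
  have p2 : 0 < τ - (1 - β) := by linarith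
  have p3 : 0 < σ - (1 - β) := by linarith
  have e : 1 / (τ - β) + 1 / (τ - (1 - β)) = (2 * τ - 1) / (σ ^ 2 + β * (1 - β)) := by
    have : σ ^ 2 + β * (1 - β) = (τ - β) * (τ - (1 - β)) := by rw [← h1]; ring
    rw [this]; field_simp; ring
  rw [e, ← mul_div_assoc, div_le_div_iff₀ (by nlinarith) p3, one_mul]
  calc κ * (2 * τ - 1) * (σ - (1 - β)) ≤ σ * (σ - (1 - β)) :=
        mul_le_mul_of_nonneg_right h3 p3.le
    _ ≤ _ := by nlinarith

open ComplexConjugate in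
/-- The contribution of the pair `ρ, 1 - conj ρ` at the point `σ + t i`. -/
noncomputable def zeroPairTerm (σ t : ℝ) (ρ : ℂ) : ℝ :=
  ((σ - ρ.re) / ((σ - ρ.re) ^ 2 + (t - ρ.im) ^ 2) +
    (σ - (1 - ρ.re)) / ((σ - (1 - ρ.re)) ^ 2 + (t - ρ.im) ^ 2)) / 2

theorem hasSum_zeroPairTerm {σ : ℝ} (hσ : 1 ≤ σ) (t : ℝ) :
    HasSum (fun ρ : ℂ => (xiOrd ρ : ℝ) * zeroPairTerm σ t ρ)
      (logDeriv entireXi (⟨σ, t⟩ : ℂ)).re := by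
  refine (hasSum_xiOrd_re_symm (s := (⟨σ, t⟩ : ℂ)) hσ).congr_fun fun ρ => ?_
  unfold zeroPairTerm
  rw [one_div, one_div, Complex.inv_re, Complex.inv_re, Complex.normSq_apply,
    Complex.normSq_apply]
  simp [sq]

theorem stechkin_term {σ κ t : ℝ} (hσ : 1 < σ) (hκ : 0 ≤ κ) (hκ2 : 5 * κ ^ 2 ≤ 1) (ρ : ℂ) :
    0 ≤ (xiOrd ρ : ℝ) * zeroPairTerm σ t ρ -
      κ * ((xiOrd ρ : ℝ) * zeroPairTerm (stechkinAbscissa σ) t ρ) := by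
  by_cases h : xiOrd ρ = 0
  · simp [h]
  have h0 := entireXi_eq_zero_of_xiOrd_ne_zero h
  have := stechkin_real (y := t - ρ.im) hσ hκ hκ2 (re_pos_of_entireXi_eq_zero h0)
    (re_lt_one_of_entireXi_eq_zero h0)
  have hm : (0 : ℝ) ≤ xiOrd ρ := Nat.cast_nonneg _
  have e : (xiOrd ρ : ℝ) * zeroPairTerm σ t ρ -
      κ * ((xiOrd ρ : ℝ) * zeroPairTerm (stechkinAbscissa σ) t ρ) =
      xiOrd ρ * (zeroPairTerm σ t ρ - κ * zeroPairTerm (stechkinAbscissa σ) t ρ) := by ring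
  rw [e]
  refine mul_nonneg hm ?_
  unfold zeroPairTerm
  linarith

theorem stechkin_logDeriv {σ κ : ℝ} (t : ℝ) (hσ : 1 < σ) (hκ : 0 ≤ κ) (hκ2 : 5 * κ ^ 2 ≤ 1) :
    κ * (logDeriv entireXi (⟨stechkinAbscissa σ, t⟩ : ℂ)).re ≤
      (logDeriv entireXi (⟨σ, t⟩ : ℂ)).re := by
  have h2 := lt_stechkinAbscissa σ
  have := ((hasSum_zeroPairTerm hσ.le t).sub
    ((hasSum_zeroPairTerm (σ := stechkinAbscissa σ) (by linarith) t).mul_left κ)).nonneg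
    (fun ρ => stechkin_term hσ hκ hκ2 ρ)
  linarith

open ComplexConjugate in
theorem stechkin_logDeriv_zero {σ κ : ℝ} {ρ : ℂ} (hσ : 1 < σ) (hκ : 0 ≤ κ) (hκ2 : 5 * κ ^ 2 ≤ 1)
    (hρ : xiOrd ρ ≠ 0) (hβ : 1 / 2 < ρ.re) :
    1 / (σ - ρ.re) + κ * (logDeriv entireXi (⟨stechkinAbscissa σ, ρ.im⟩ : ℂ)).re ≤
      (logDeriv entireXi (⟨σ, ρ.im⟩ : ℂ)).re := by
  have h2 := lt_stechkinAbscissa σ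
  have hs := (hasSum_zeroPairTerm hσ.le ρ.im).sub
    ((hasSum_zeroPairTerm (σ := stechkinAbscissa σ) (by linarith) ρ.im).mul_left κ)
  have hne : ρ ≠ 1 - conj ρ := by
    intro h
    have := congrArg Complex.re h
    simp at this; linarith
  have h0 := entireXi_eq_zero_of_xiOrd_ne_zero hρ
  have hb0 := re_pos_of_entireXi_eq_zero h0
  have hb1 := re_lt_one_of_entireXi_eq_zero h0
  have hm : (1 : ℝ) ≤ xiOrd ρ := by exact_mod_cast Nat.one_le_iff_ne_zero.2 hρ
  have key := sum_le_hasSum {ρ, 1 - conj ρ} (fun j _ => stechkin_term hσ hκ hκ2 j) hs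
  rw [Finset.sum_pair hne, xiOrd_one_sub, xiOrd_conj] at key
  have hex := stechkin_real_extra hσ hκ hκ2 hb0 hb1
  have e1 : ∀ a : ℝ, 0 < a → a / (a ^ 2 + (ρ.im - ρ.im) ^ 2) = 1 / a := by
    intro a ha; rw [sub_self]; field_simp; ring
  have hpt : ∀ a : ℝ, 1 < a → zeroPairTerm a ρ.im ρ = (1 / (a - ρ.re) + 1 / (a - (1 - ρ.re))) / 2 := by
    intro a ha
    unfold zeroPairTerm
    rw [e1 _ (by linarith), e1 _ (by linarith)]
  have hpt2 : ∀ a : ℝ, zeroPairTerm a ρ.im (1 - conj ρ) = zeroPairTerm a ρ.im ρ := by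
    intro a
    unfold zeroPairTerm
    simp
    ring
  rw [hpt2, hpt2, hpt _ hσ, hpt _ (by linarith)] at key
  set D := (1 / (σ - ρ.re) + 1 / (σ - (1 - ρ.re))) -
    κ * (1 / (stechkinAbscissa σ - ρ.re) + 1 / (stechkinAbscissa σ - (1 - ρ.re))) with hD
  have hD1 : 1 / (σ - ρ.re) ≤ D := by rw [hD]; linarith
  have hD0 : 0 ≤ D := le_trans (by have : 0 < σ - ρ.re := by linarith
                                   positivity) hD1
  nlinarith

theorem trig_poly_nonneg (θ : ℝ) :
    0 ≤ 11.1859355312082048 + 19.073344004352 * Real.cos θ + 11.67618784 * Real.cos (2 * θ)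
      + 4.7568 * Real.cos (3 * θ) + Real.cos (4 * θ) := by
  have h4 : Real.cos (4 * θ) = 2 * Real.cos (2 * θ) ^ 2 - 1 := by
    rw [← Real.cos_two_mul]; ring_nf
  rw [h4, Real.cos_three_mul, Real.cos_two_mul]
  have := sq_nonneg ((Real.cos θ + 0.9126) * (Real.cos θ + 0.2766))
  nlinarith

open ArithmeticFunction in
theorem hasSum_neg_logDeriv_riemannZeta {s : ℂ} (hs : 1 < s.re) :
    HasSum (fun n : ℕ => vonMangoldt n * (n : ℝ) ^ (-s.re) * Real.cos (s.im * Real.log n))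
      (-(logDeriv riemannZeta s)).re := by
  have h := (LSeriesSummable_vonMangoldt hs).hasSum
  have h2 := ArithmeticFunction.LSeries_vonMangoldt_eq_deriv_riemannZeta_div hs
  rw [LSeries] at h2
  rw [h2, neg_div] at h
  have h3 := Complex.hasSum_re h
  rw [← logDeriv_apply] at h3
  convert h3 using 2 with n
  rcases eq_or_ne n 0 with rfl | hn
  · simp [LSeries.term]
  have hn' : (n : ℂ) ≠ 0 := by exact_mod_cast hn
  have hpos : (0 : ℝ) < n := by positivity
  rw [LSeries.term_of_ne_zero hn, div_eq_mul_inv, ← Complex.cpow_neg, Complex.re_ofReal_mul,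
    Complex.cpow_def_of_ne_zero hn', Complex.exp_re, Complex.natCast_log.symm,
    Complex.re_ofReal_mul, Complex.im_ofReal_mul, Real.rpow_def_of_pos hpos]
  simp only [Complex.neg_re, Complex.neg_im, mul_neg, Real.cos_neg]
  rw [mul_comm s.im, mul_assoc]

open ArithmeticFunction in
/-- The trigonometric inequality behind the zero-free region, with Stechkin's weights. -/
theorem zeta_trig_ineq {σ τ κ : ℝ} (hσ : 1 < σ) (hτ : σ ≤ τ) (hκ1 : κ ≤ 1) (t : ℝ)
    {V : ℝ → ℝ} (hV : ∀ u, V u = (-(logDeriv riemannZeta ⟨σ, u⟩)).re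
      - κ * (-(logDeriv riemannZeta ⟨τ, u⟩)).re) :
    0 ≤ 11.1859355312082048 * V 0 + 19.073344004352 * V t + 11.67618784 * V (2 * t)
      + 4.7568 * V (3 * t) + V (4 * t) := by
  have key (u : ℝ) : HasSum (fun n : ℕ => vonMangoldt n * ((n : ℝ) ^ (-σ) - κ * (n : ℝ) ^ (-τ))
      * Real.cos (u * Real.log n)) (V u) := by
    have h1 := hasSum_neg_logDeriv_riemannZeta (s := ⟨σ, u⟩) hσ
    have h2 := hasSum_neg_logDeriv_riemannZeta (s := ⟨τ, u⟩) (hσ.trans_le hτ)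
    rw [hV]
    have h3 := h1.sub (h2.mul_left κ)
    have h4 : (fun n : ℕ => vonMangoldt n * ((n : ℝ) ^ (-σ) - κ * (n : ℝ) ^ (-τ))
        * Real.cos (u * Real.log n)) = fun n : ℕ =>
        vonMangoldt n * (n : ℝ) ^ (-σ) * Real.cos (u * Real.log n)
          - κ * (vonMangoldt n * (n : ℝ) ^ (-τ) * Real.cos (u * Real.log n)) := by
      funext n; ring
    rw [h4]
    exact h3
  have := ((((key 0).mul_left 11.1859355312082048).add ((key t).mul_left 19.073344004352)).add
    ((key (2 * t)).mul_left 11.67618784)).add ((key (3 * t)).mul_left 4.7568) |>.add (key (4 * t))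
  refine this.nonneg fun n => ?_
  rcases eq_or_ne n 0 with rfl | hn
  · simp
  have h1 : (1 : ℝ) ≤ n := by exact_mod_cast Nat.one_le_iff_ne_zero.2 hn
  have h2 : (n : ℝ) ^ (-τ) ≤ (n : ℝ) ^ (-σ) := Real.rpow_le_rpow_of_exponent_le h1 (by linarith)
  have h3 : 0 ≤ (n : ℝ) ^ (-τ) := by positivity
  have h4 : 0 ≤ vonMangoldt n * ((n : ℝ) ^ (-σ) - κ * (n : ℝ) ^ (-τ)) :=
    mul_nonneg vonMangoldt_nonneg (by nlinarith)
  have h5 := mul_nonneg h4 (trig_poly_nonneg (t * Real.log n))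
  simp only [zero_mul, Real.cos_zero, mul_one, mul_assoc] at h5 ⊢
  linarith

/-- The combination of logarithmic derivatives used in Stechkin's argument. -/
noncomputable def stechkinComb (κ σ u : ℝ) : ℝ :=
  (-(logDeriv riemannZeta ⟨σ, u⟩)).re
    - κ * (-(logDeriv riemannZeta ⟨stechkinAbscissa σ, u⟩)).re

theorem re_neg_logDeriv_riemannZeta {s : ℂ} (hs : 1 < s.re) :
    (-(logDeriv riemannZeta s)).re = (1 / (s - 1)).re - Real.log Real.pi / 2
      + (Complex.digamma (s / 2 + 1)).re / 2 - (logDeriv entireXi s).re := by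
  rw [logDeriv_entireXi_eq hs]
  have : (Complex.digamma (s / 2 + 1) / 2).re = (Complex.digamma (s / 2 + 1)).re / 2 := by
    rw [show (2 : ℂ) = ((2 : ℝ) : ℂ) by norm_num, Complex.div_ofReal_re]
  have h2 : ((Real.log Real.pi : ℂ) / 2).re = Real.log Real.pi / 2 := by
    rw [show (2 : ℂ) = ((2 : ℝ) : ℂ) by norm_num, Complex.div_ofReal_re, Complex.ofReal_re]
  simp only [Complex.add_re, Complex.sub_re, Complex.neg_re, this, h2]
  ring

theorem stechkinAbscissa_le {σ : ℝ} (hσ : 1 < σ) (hσ2 : σ ≤ 1.211) :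
    stechkinAbscissa σ ≤ 1.812 := by
  have h1 := stechkinAbscissa_mul σ
  have h2 := lt_stechkinAbscissa σ
  nlinarith

theorem re_one_div_mk (a b : ℝ) : (1 / (⟨a, b⟩ : ℂ)).re = a / (a ^ 2 + b ^ 2) := by
  rw [one_div, Complex.inv_re, Complex.normSq_apply]; simp [sq]

theorem stechkinComb_zero_le {κ σ : ℝ} (hσ : 1 < σ) (hσ2 : σ ≤ 1.211) (hκ : 0 ≤ κ)
    (hκ2 : 5 * κ ^ 2 ≤ 1) :
    stechkinComb κ σ 0 ≤ 1 / (σ - 1) - κ / 0.812 - (1 - κ) / 2 * Real.log Real.pi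
      + Real.log 1.6055 / 2 := by
  have h1 := stechkinAbscissa_le hσ hσ2
  have h2 := lt_stechkinAbscissa σ
  set τ := stechkinAbscissa σ with hτ
  have h3 := stechkin_logDeriv 0 hσ hκ hκ2
  rw [stechkinComb, re_neg_logDeriv_riemannZeta (by simpa using hσ),
    re_neg_logDeriv_riemannZeta (by simp; linarith)]
  have e (a : ℝ) : (1 / ((⟨a, 0⟩ : ℂ) - 1)).re = 1 / (a - 1) := by
    rw [show (⟨a, 0⟩ : ℂ) - 1 = ((a - 1 : ℝ) : ℂ) by apply Complex.ext <;> simp, one_div,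
      ← Complex.ofReal_inv, Complex.ofReal_re, one_div]
  have e2 (a : ℝ) : (⟨a, 0⟩ : ℂ) / 2 + 1 = ((a / 2 + 1 : ℝ) : ℂ) := by
    rw [show (⟨a, 0⟩ : ℂ) = (a : ℂ) from rfl]; push_cast; ring
  rw [e, e, e2, e2]
  have h4 := Complex.re_digamma_le_log (x := σ / 2 + 1) (by linarith)
  have h5 := Complex.log_sub_one_div_le_re_digamma (x := τ / 2 + 1) (by linarith)
  have h6 : Real.log (σ / 2 + 1) ≤ Real.log 1.6055 := Real.log_le_log (by linarith) (by linarith)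
  have h7 : 0 ≤ Real.log (τ / 2 + 1) - 1 / (τ / 2 + 1) := by
    have := Real.one_sub_inv_le_log_of_pos (x := (τ / 2 + 1) / 2) (by linarith)
    rw [Real.log_div (by linarith) two_ne_zero] at this
    have hl := Real.log_two_gt_d9
    have h8 : 1 / (τ / 2 + 1) ≤ 1 / 1.8 := by
      have h9 : 1.6 ≤ τ := by nlinarith [stechkinAbscissa_mul σ]
      exact one_div_le_one_div_of_le (by norm_num) (by linarith)
    rw [inv_div, div_eq_mul_one_div] at this
    norm_num at *
    linarith
  have h8 : 1 / 0.812 ≤ 1 / (τ - 1) := one_div_le_one_div_of_le (by linarith) (by linarith)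
  have h9 : 0 ≤ κ * (Complex.digamma ((τ / 2 + 1 : ℝ) : ℂ)).re :=
    mul_nonneg hκ (by linarith)
  have h10 := mul_le_mul_of_nonneg_left h8 hκ
  rw [mul_one_div] at h10
  linarith

theorem stechkinComb_le {κ σ u : ℝ} (hσ : 1 < σ) (hσ2 : σ ≤ 1.211) (hκ : 0 ≤ κ)
    (hκ2 : κ ≤ 0.44722) (hu : 5 ≤ u) :
    stechkinComb κ σ u ≤ (1 - κ) / 2 * (Real.log u - Real.log (2 * Real.pi)) + 11.7 / u ^ 2
      - ((logDeriv entireXi ⟨σ, u⟩).re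
        - κ * (logDeriv entireXi ⟨stechkinAbscissa σ, u⟩).re) := by
  have h1 := stechkinAbscissa_le hσ hσ2
  have h2 := lt_stechkinAbscissa σ
  set τ := stechkinAbscissa σ with hτ
  rw [stechkinComb, re_neg_logDeriv_riemannZeta (by simpa using hσ),
    re_neg_logDeriv_riemannZeta (by simp; linarith)]
  have e (a : ℝ) : (1 / ((⟨a, u⟩ : ℂ) - 1)).re = (a - 1) / ((a - 1) ^ 2 + u ^ 2) := by
    rw [show (⟨a, u⟩ : ℂ) - 1 = ⟨a - 1, u⟩ by apply Complex.ext <;> simp, re_one_div_mk]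
  have e2 (a : ℝ) : (⟨a, u⟩ : ℂ) / 2 + 1 = ⟨a / 2 + 1, u / 2⟩ := by
    rw [show (2 : ℂ) = ((2 : ℝ) : ℂ) by norm_num]
    apply Complex.ext <;> simp
  rw [e, e, e2, e2]
  have n52 (a : ℝ) : 5 / 2 ≤ ‖(⟨a, u / 2⟩ : ℂ)‖ :=
    le_trans (by simp; rw [abs_of_pos (by linarith)]; linarith) (Complex.abs_im_le_norm _)
  have d (a : ℝ) (ha : 1 < a) := Complex.abs_re_digamma_sub_le (w := ⟨a, u / 2⟩) ha (n52 a)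
    (y := u / 2) (by simp; rw [abs_of_pos (by linarith)]) (by linarith)
  have ln (a : ℝ) : Real.log ‖(⟨a, u / 2⟩ : ℂ)‖ = Real.log (a ^ 2 + (u / 2) ^ 2) / 2 := by
    rw [Complex.norm_def, Real.log_sqrt (Complex.normSq_nonneg _), Complex.normSq_mk]
    ring_nf
  have hu2 : 0 < u ^ 2 := by positivity
  have lu : Real.log ((u / 2) ^ 2) = 2 * (Real.log u - Real.log 2) := by
    rw [Real.log_pow, Real.log_div (by linarith) two_ne_zero]; norm_num
  have lpi : Real.log (2 * Real.pi) = Real.log 2 + Real.log Real.pi :=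
    Real.log_mul two_ne_zero Real.pi_ne_zero
  have up : (Complex.digamma ⟨σ / 2 + 1, u / 2⟩).re ≤ Real.log u - Real.log 2 + 16.3 / u ^ 2 := by
    have h := (abs_le.1 (d (σ / 2 + 1) (by linarith))).2
    rw [ln, re_one_div_mk] at h
    have h3 : 0 ≤ (σ / 2 + 1) / ((σ / 2 + 1) ^ 2 + (u / 2) ^ 2) := by positivity
    have h4 : Real.log ((σ / 2 + 1) ^ 2 + (u / 2) ^ 2)
        ≤ Real.log ((u / 2) ^ 2) + (σ / 2 + 1) ^ 2 / (u / 2) ^ 2 := by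
      have := Real.log_le_sub_one_of_pos
        (x := ((σ / 2 + 1) ^ 2 + (u / 2) ^ 2) / (u / 2) ^ 2) (by positivity)
      rw [Real.log_div (by positivity) (by positivity), add_div, div_self (by positivity)] at this
      linarith
    have h5 : (σ / 2 + 1) ^ 2 / (u / 2) ^ 2 ≤ 10.32 / u ^ 2 := by
      rw [div_pow u, div_div_eq_mul_div]
      gcongr
      nlinarith
    have h6 : 25 / 9 / (u / 2) ^ 2 = 100 / 9 / u ^ 2 := by field_simp; norm_num
    have h7 : (16.3 : ℝ) / u ^ 2 = 100 / 9 / u ^ 2 + 10.32 / u ^ 2 / 2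
      + (16.3 - 100 / 9 - 10.32 / 2) / u ^ 2 := by ring
    have h8 : 0 ≤ (16.3 - 100 / 9 - 10.32 / 2) / u ^ 2 := by
      apply div_nonneg _ hu2.le; norm_num
    rw [lu] at h4
    linarith
  have lo : Real.log u - Real.log 2 - 14.93 / u ^ 2 ≤ (Complex.digamma ⟨τ / 2 + 1, u / 2⟩).re := by
    have h := (abs_le.1 (d (τ / 2 + 1) (by linarith))).1
    rw [ln, re_one_div_mk] at h
    have h3 : (τ / 2 + 1) / ((τ / 2 + 1) ^ 2 + (u / 2) ^ 2) ≤ 1.906 / (u / 2) ^ 2 := by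
      gcongr
      · linarith
      · nlinarith
    have h4 : Real.log ((u / 2) ^ 2) ≤ Real.log ((τ / 2 + 1) ^ 2 + (u / 2) ^ 2) := by
      apply Real.log_le_log (by positivity); nlinarith
    have h6 : 25 / 9 / (u / 2) ^ 2 = 100 / 9 / u ^ 2 := by field_simp; norm_num
    have h7 : (14.93 : ℝ) / u ^ 2 = 100 / 9 / u ^ 2 + 1.906 / (u / 2) ^ 2 / 2
      + (14.93 - 100 / 9 - 1.906 * 2) / u ^ 2 := by ring
    have h8 : 0 ≤ (14.93 - 100 / 9 - 1.906 * 2) / u ^ 2 := by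
      apply div_nonneg _ hu2.le; norm_num
    rw [lu] at h4
    linarith
  have p1 : (σ - 1) / ((σ - 1) ^ 2 + u ^ 2) ≤ 0.211 / u ^ 2 := by
    gcongr
    · linarith
    · nlinarith
  have p2 : 0 ≤ κ * ((τ - 1) / ((τ - 1) ^ 2 + u ^ 2)) :=
    mul_nonneg hκ (div_nonneg (by linarith) (by positivity))
  have lo' := mul_le_mul_of_nonneg_left lo hκ
  have h7 : (11.7 : ℝ) / u ^ 2 = 0.211 / u ^ 2 + 16.3 / u ^ 2 / 2 + κ * (14.93 / u ^ 2) / 2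
      + (11.7 - 0.211 - 16.3 / 2 - κ * 14.93 / 2) / u ^ 2 := by ring
  have h8 : 0 ≤ (11.7 - 0.211 - 16.3 / 2 - κ * 14.93 / 2) / u ^ 2 := by
    apply div_nonneg _ hu2.le; norm_num; linarith
  rw [h7, lpi]
  nlinarith

theorem log_two_mul_pi_bounds : 1.83745 < Real.log (2 * Real.pi) ∧ 1.1443 < Real.log Real.pi := by
  have h1 := log_four_mul_pi_gt
  have h2 := Real.log_two_lt_d9
  rw [show 4 * Real.pi = 2 * (2 * Real.pi) by ring,
    Real.log_mul two_ne_zero (by positivity)] at h1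
  have h3 := Real.log_mul two_ne_zero Real.pi_ne_zero
  constructor <;> linarith

theorem log_zero_height_bound {t : ℝ} (ht : 35 ≤ t ^ 2) (ht0 : 0 < t) :
    10.09011 * Real.log t - 21.5 + 264.3 / t ^ 2
      ≤ 10.09011 * Real.log (max t 40 / 8) := by
  have l2 := Real.log_two_lt_d9
  have l2' := Real.log_two_gt_d9
  have l3 := Real.log_three_lt_d9
  have l5 := Real.log_five_lt_d9
  have l5' := Real.log_five_gt_d9
  have l10 := Real.log_ten_eq
  have l8 : Real.log 8 = 3 * Real.log 2 := by
    rw [show (8 : ℝ) = 2 ^ 3 by norm_num, Real.log_pow]; norm_num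
  have frac (c : ℝ) (hc : 0 < c) (h : c ≤ t ^ 2) : 264.3 / t ^ 2 ≤ 264.3 / c := by gcongr
  rcases le_total t 40 with h | h
  · rw [max_eq_right h, show (40 : ℝ) / 8 = 5 by norm_num]
    rcases le_total t 10 with h1 | h1
    · have := frac 35 (by norm_num) ht
      have := Real.log_le_log ht0 h1
      norm_num at *; linarith
    rcases le_total t 30 with h2 | h2
    · have := frac 100 (by norm_num) (by nlinarith)
      have := Real.log_le_log ht0 h2
      rw [show (30 : ℝ) = 3 * 10 by norm_num, Real.log_mul (by norm_num) (by norm_num)] at this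
      norm_num at *; linarith
    · have := frac 900 (by norm_num) (by nlinarith)
      have := Real.log_le_log ht0 h
      rw [show (40 : ℝ) = 8 * 5 by norm_num, Real.log_mul (by norm_num) (by norm_num)] at this
      norm_num at *; linarith
  · rw [max_eq_left h, Real.log_div ht0.ne' (by norm_num), l8]
    have := frac 1600 (by norm_num) (by nlinarith)
    norm_num at *; linarith

theorem zero_free_region_aux {ρ : ℂ} (hρ : xiOrd ρ ≠ 0) (hβ : 1 / 2 < ρ.re) (hγ : 0 < ρ.im)
    {σ : ℝ} (hσ : 1 < σ) (hσ2 : σ ≤ 1.211) :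
    19.073344 / (σ - ρ.re) ≤ 11.185935532 / (σ - 1)
      + 10.09011 * Real.log (max ρ.im 40 / 8) := by
  set t := ρ.im with ht
  have h35 := im_sq_ge_of_xiOrd_ne_zero hρ
  have ht5 : 5 ≤ t := by nlinarith
  have hκ0 : (0 : ℝ) ≤ 0.4472135 := by norm_num
  have hκ1 : (0.4472135 : ℝ) ≤ 0.44722 := by norm_num
  have hκ2 : 5 * (0.4472135 : ℝ) ^ 2 ≤ 1 := by norm_num
  have key := zeta_trig_ineq (κ := 0.4472135) (τ := stechkinAbscissa σ) hσ
    (by linarith [lt_stechkinAbscissa σ]) (by norm_num) t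
    (V := stechkinComb 0.4472135 σ) (fun u => rfl)
  have v0 := stechkinComb_zero_le hσ hσ2 hκ0 hκ2
  have v (u : ℝ) (hu : 5 ≤ u) := stechkinComb_le hσ hσ2 hκ0 hκ1 hu
  have s (u : ℝ) := stechkin_logDeriv u hσ hκ0 hκ2
  have v1 := v t ht5
  have s1 := stechkin_logDeriv_zero hσ hκ0 hκ2 hρ hβ
  rw [← ht] at s1
  have v2 := v (2 * t) (by linarith)
  have s2 := s (2 * t)
  have v3 := v (3 * t) (by linarith)
  have s3 := s (3 * t)
  have v4 := v (4 * t) (by linarith)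
  have s4 := s (4 * t)
  have ht0 : t ≠ 0 := by linarith
  rw [Real.log_mul (by norm_num) ht0] at v2 v3 v4
  have l2 := Real.log_two_lt_d9
  have l3 := Real.log_three_lt_d9
  have l4 := Real.log_four_eq
  obtain ⟨lp, lp'⟩ := log_two_mul_pi_bounds
  have hb := log_zero_height_bound h35 hγ
  have lx : Real.log 1.6055 ≤ 0.4735 := by
    rw [Real.log_le_iff_le_exp (by norm_num)]
    have := Real.sum_le_exp_of_nonneg (x := 0.4735) (by norm_num) 6
    refine le_trans ?_ this
    norm_num [Finset.sum_range_succ, Nat.factorial]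
  have e2 : 11.7 / (2 * t) ^ 2 = 11.7 / t ^ 2 / 4 := by field_simp; norm_num
  have e3 : 11.7 / (3 * t) ^ 2 = 11.7 / t ^ 2 / 9 := by field_simp; norm_num
  have e4 : 11.7 / (4 * t) ^ 2 = 11.7 / t ^ 2 / 16 := by field_simp; norm_num
  have e5 : 264.3 / t ^ 2 = 11.7 / t ^ 2 * (264.3 / 11.7) := by field_simp
  rw [e2] at v2
  rw [e3] at v3
  rw [e4] at v4
  rw [e5] at hb
  have hq : 0 ≤ 11.7 / t ^ 2 := by positivity
  have hlt : 0 ≤ Real.log t := Real.log_nonneg (by linarith)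
  have hβ1 := re_lt_one_of_entireXi_eq_zero (entireXi_eq_zero_of_xiOrd_ne_zero hρ)
  have hz : 0 ≤ 1 / (σ - ρ.re) := by
    apply one_div_nonneg.2; linarith
  have hd : 0 ≤ 1 / (σ - 1) := by
    apply one_div_nonneg.2; linarith
  rw [← ht] at hb
  rw [div_eq_mul_one_div 19.073344, div_eq_mul_one_div 11.185935532]
  generalize 1 / (σ - ρ.re) = Z at *
  generalize 1 / (σ - 1) = D at *
  linarith

/-- An explicit zero-free region. -/
theorem zero_free_region {ρ : ℂ} (hρ : xiOrd ρ ≠ 0) :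
    1 / (9.646 * Real.log (max |ρ.im| 40 / 8)) ≤ 1 - ρ.re := by
  have hβ1 := re_lt_one_of_entireXi_eq_zero (entireXi_eq_zero_of_xiOrd_ne_zero hρ)
  wlog hγ : 0 < ρ.im generalizing ρ with H
  · have h35 := im_sq_ge_of_xiOrd_ne_zero hρ
    have h := H (ρ := (starRingEnd ℂ) ρ) (by rwa [xiOrd_conj]) (by simpa using hβ1)
      (by
        have : ρ.im ≠ 0 := by intro h; rw [h] at h35; norm_num at h35
        simp only [Complex.conj_im]
        have := lt_of_le_of_ne (not_lt.1 hγ) this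
        linarith)
    simpa using h
  rw [abs_of_pos hγ]
  have hl : 1.6094379123 < Real.log (max ρ.im 40 / 8) := by
    refine Real.log_five_gt_d9.trans_le (Real.log_le_log (by norm_num) ?_)
    have := le_max_right ρ.im 40
    linarith
  set l := Real.log (max ρ.im 40 / 8) with hl'
  rcases le_or_gt ρ.re (1 / 2) with hβ | hβ
  · have : 1 / (9.646 * l) ≤ 1 / 2 := by
      apply one_div_le_one_div_of_le <;> linarith
    linarith
  have hq : 0.33902 / l ≤ 0.211 := by rw [div_le_iff₀ (by linarith)]; linarith
  have hq0 : 0 < 0.33902 / l := by apply div_pos <;> linarith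
  have h := zero_free_region_aux hρ hβ hγ (σ := 1 + 0.33902 / l) (by linarith) (by linarith)
  rw [← hl', add_sub_cancel_left, div_div_eq_mul_div, div_le_iff₀ (by linarith)] at h
  rw [div_le_iff₀ (by linarith)]
  have e : 0.33902 / l * l = 0.33902 := by field_simp
  set η := 1 - ρ.re with hη
  have h2 : 1 + 0.33902 / l - ρ.re = 0.33902 / l + η := by ring
  rw [h2] at h
  have h3 : 19.073344 ≤ (11.185935532 / 0.33902 + 10.09011) * (0.33902 + η * l) := by
    calc (19.073344 : ℝ) ≤ _ := h
      _ = (11.185935532 / 0.33902 + 10.09011) * (0.33902 / l * l + η * l) := by ring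
      _ = _ := by rw [e]
  norm_num at h3 ⊢
  linarith

/-- Continuous functions supported on the positive half-line with an exponential bound
of rate `3 / 2`. -/
def IsCausal (f : ℝ → ℂ) (C : ℝ) : Prop :=
  Continuous f ∧ (∀ v ≤ 0, f v = 0) ∧ ∀ v, ‖f v‖ ≤ C * Real.exp (3 / 2 * v)

section

open MeasureTheory Set Filter Topology

theorem IsCausal.norm_mul_exp_le {f : ℝ → ℂ} {C : ℝ} (hf : IsCausal f C) {s : ℂ} (hs : s.re = 2)
    (v : ℝ) : ‖f v * Complex.exp (-s * v)‖ ≤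
      (Ioi (0 : ℝ)).indicator (fun v => C * Real.exp (-(1 / 2) * v)) v := by
  by_cases hv : 0 < v
  · rw [indicator_of_mem (mem_Ioi.2 hv), norm_mul, Complex.norm_exp]
    have : (-s * v).re = -2 * v := by simp [hs]
    rw [this]
    calc ‖f v‖ * Real.exp (-2 * v) ≤ C * Real.exp (3 / 2 * v) * Real.exp (-2 * v) := by
          gcongr; exact hf.2.2 v
      _ = _ := by rw [mul_assoc, ← Real.exp_add]; ring_nf
  · rw [indicator_of_notMem (by simpa using hv), hf.2.1 v (not_lt.1 hv)]
    simp

theorem integrable_indicator_exp (C : ℝ) :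
    Integrable ((Ioi (0 : ℝ)).indicator (fun v => C * Real.exp (-(1 / 2) * v))) := by
  rw [integrable_indicator_iff measurableSet_Ioi]
  exact (integrableOn_exp_mul_Ioi (by norm_num) 0).const_mul C

theorem IsCausal.integrable {f : ℝ → ℂ} {C : ℝ} (hf : IsCausal f C) {s : ℂ} (hs : s.re = 2) :
    Integrable fun v : ℝ => f v * Complex.exp (-s * v) := by
  refine (integrable_indicator_exp C).mono' ?_ (ae_of_all _ (hf.norm_mul_exp_le hs))
  have := hf.1
  exact (by fun_prop : Continuous fun v : ℝ => f v * Complex.exp (-s * v)).aestronglyMeasurable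

theorem IsCausal.add {f g : ℝ → ℂ} {C D : ℝ} (hf : IsCausal f C) (hg : IsCausal g D) :
    IsCausal (fun v => f v + g v) (C + D) := by
  refine ⟨hf.1.add hg.1, fun v hv => by simp [hf.2.1 v hv, hg.2.1 v hv], fun v => ?_⟩
  rw [add_mul]
  exact (norm_add_le _ _).trans (add_le_add (hf.2.2 v) (hg.2.2 v))

theorem IsCausal.integral_add {f g : ℝ → ℂ} {C D : ℝ} (hf : IsCausal f C) (hg : IsCausal g D)
    {s : ℂ} (hs : s.re = 2) : ∫ v : ℝ, (f v + g v) * Complex.exp (-s * v)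
      = (∫ v : ℝ, f v * Complex.exp (-s * v)) + ∫ v : ℝ, g v * Complex.exp (-s * v) := by
  simp_rw [add_mul]
  exact MeasureTheory.integral_add (hf.integrable hs) (hg.integrable hs)

theorem IsCausal.const_mul {f : ℝ → ℂ} {C : ℝ} (hf : IsCausal f C) (c : ℂ) :
    IsCausal (fun v => c * f v) (‖c‖ * C) := by
  refine ⟨continuous_const.mul hf.1, fun v hv => by simp [hf.2.1 v hv], fun v => ?_⟩
  rw [norm_mul, mul_assoc]
  exact mul_le_mul_of_nonneg_left (hf.2.2 v) (norm_nonneg _)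

theorem IsCausal.summable {ι : Type*} {f : ι → ℝ → ℂ} {b : ι → ℝ} (hb : Summable b)
    (hf : ∀ i, IsCausal (f i) (b i)) (v : ℝ) : Summable fun i => f i v :=
  Summable.of_norm_bounded (hb.mul_right _) fun i => (hf i).2.2 v

theorem IsCausal.tsum {ι : Type*} {f : ι → ℝ → ℂ} {b : ι → ℝ} (hb : Summable b)
    (hf : ∀ i, IsCausal (f i) (b i)) : IsCausal (fun v => ∑' i, f i v) (∑' i, b i) := by
  refine ⟨?_, fun v hv => ?_, fun v => ?_⟩
  · rw [← continuousOn_univ, ← iUnion_Iio (α := ℝ)]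
    refine continuousOn_of_forall_continuousAt ?_
    intro v hv
    obtain ⟨B, hB⟩ := mem_iUnion.1 hv
    have : ContinuousOn (fun v => ∑' i, f i v) (Iio B) := by
      refine continuousOn_tsum (u := fun i => b i * Real.exp (3 / 2 * B))
        (fun i => (hf i).1.continuousOn) (hb.mul_right _) fun i x hx => ?_
      refine ((hf i).2.2 x).trans ?_
      have h0 : 0 ≤ b i := by
        have := (norm_nonneg _).trans ((hf i).2.2 0)
        simpa using this
      have : x ≤ B := (mem_Iio.1 hx).le
      gcongr
    exact this.continuousAt (Iio_mem_nhds hB)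
  · exact (tsum_congr fun i => (hf i).2.1 v hv).trans tsum_zero
  · rw [← tsum_mul_right]
    exact tsum_of_norm_bounded (hb.mul_right _).hasSum fun i => (hf i).2.2 v

theorem IsCausal.hasSum_integral {ι : Type*} [Countable ι] {f : ι → ℝ → ℂ} {b : ι → ℝ}
    (hb : Summable b) (hf : ∀ i, IsCausal (f i) (b i)) {s : ℂ} (hs : s.re = 2) :
    HasSum (fun i => ∫ v : ℝ, f i v * Complex.exp (-s * v))
      (∫ v : ℝ, (∑' i, f i v) * Complex.exp (-s * v)) := by
  simp_rw [← tsum_mul_right]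
  refine hasSum_integral_of_summable_integral_norm (fun i => (hf i).integrable hs) ?_
  refine Summable.of_nonneg_of_le (fun i => integral_nonneg fun v => norm_nonneg _) (fun i =>
    integral_mono ((hf i).integrable hs).norm (integrable_indicator_exp (b i))
      ((hf i).norm_mul_exp_le hs)) ?_
  have e (i : ι) : ∫ v, (Ioi (0 : ℝ)).indicator (fun v => b i * Real.exp (-(1 / 2) * v)) v
      = b i * ∫ v in Ioi (0 : ℝ), Real.exp (-(1 / 2) * v) := by
    rw [integral_indicator measurableSet_Ioi, integral_const_mul]
  simp_rw [e]
  exact hb.mul_right _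

open FourierTransform in
theorem IsCausal.eq_zero {f : ℝ → ℂ} {C : ℝ} (hf : IsCausal f C)
    (h : ∀ s : ℂ, s.re = 2 → ∫ v : ℝ, f v * Complex.exp (-s * v) = 0) (v : ℝ) : f v = 0 := by
  set g : ℝ → ℂ := fun v => f v * Complex.exp (-(2 : ℂ) * v) with hg
  have hgi : Integrable g := hf.integrable (by simp)
  have hgc : Continuous g := by
    have := hf.1
    fun_prop
  have hF : 𝓕 g = 0 := by
    funext w
    rw [Real.fourier_real_eq_integral_exp_smul]
    have := h (2 + 2 * Real.pi * w * Complex.I) (by simp)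
    rw [Pi.zero_apply, ← this]
    congr 1 with v
    rw [hg, smul_eq_mul, mul_left_comm, ← Complex.exp_add]
    congr 2
    push_cast
    ring
  have hinv := hgc.fourierInv_fourier_eq hgi (by rw [hF]; exact integrable_zero _ _ _)
  have h1 : g v = 0 := by
    rw [← hinv, hF, Real.fourierInv_eq]
    simp
  exact (mul_eq_zero.1 h1).resolve_right (Complex.exp_ne_zero _)

theorem tendsto_pow_mul_cexp {a : ℂ} (ha : a.re < 0) (k : ℕ) :
    Tendsto (fun v : ℝ => (v : ℂ) ^ k * Complex.exp (a * v)) atTop (𝓝 0) := by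
  rw [tendsto_zero_iff_norm_tendsto_zero]
  have h := (isLittleO_pow_exp_pos_mul_atTop k (b := -a.re) (by linarith)).tendsto_div_nhds_zero
  refine (h.congr' ?_)
  filter_upwards [eventually_ge_atTop 0] with v hv
  rw [norm_mul, norm_pow, Complex.norm_exp, Complex.norm_real, Real.norm_of_nonneg hv,
    div_eq_mul_inv, ← Real.exp_neg]
  simp

/-- The transform pair of `(1 / (s - p) + 1 / p) / s ^ 3`. -/
noncomputable def expKernel (p : ℂ) (v : ℝ) : ℂ :=
  (Complex.exp (p * (max v 0 : ℝ)) - 1 - p * (max v 0 : ℝ)) / p ^ 3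

/-- The transform pair of `1 / s ^ 3`. -/
noncomputable def sqKernel (v : ℝ) : ℂ := ((max v 0 ^ 2 / 2 : ℝ) : ℂ)

theorem isCausal_expKernel {p : ℂ} (hp : 1 ≤ ‖p‖) (hp1 : p.re ≤ 1) :
    IsCausal (expKernel p) (3 / ‖p‖ ^ 2) := by
  have hp0 : 0 < ‖p‖ := by linarith
  refine ⟨by unfold expKernel; fun_prop, fun v hv => by simp [expKernel, max_eq_right hv],
    fun v => ?_⟩
  rcases le_or_gt v 0 with hv | hv
  · simp only [expKernel, max_eq_right hv]
    simp only [Complex.ofReal_zero, mul_zero, Complex.exp_zero, sub_self, zero_div, norm_zero]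
    positivity
  simp only [expKernel, max_eq_left hv.le]
  rw [norm_div, norm_pow, div_le_iff₀ (by positivity)]
  have h1 : ‖Complex.exp (p * v)‖ ≤ Real.exp (3 / 2 * v) := by
    rw [Complex.norm_exp]
    apply Real.exp_le_exp.2
    simp; nlinarith
  have h2 : 1 + v ≤ Real.exp (3 / 2 * v) := by
    have := Real.add_one_le_exp (3 / 2 * v); linarith
  have h3 : ‖p * v‖ = ‖p‖ * v := by
    rw [norm_mul, Complex.norm_real, Real.norm_of_nonneg hv.le]
  calc ‖Complex.exp (p * v) - 1 - p * v‖ ≤ ‖Complex.exp (p * v)‖ + ‖(1 : ℂ)‖ + ‖p * v‖ :=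
        (norm_sub_le _ _).trans (by gcongr; exact norm_sub_le _ _)
    _ ≤ Real.exp (3 / 2 * v) + 1 + ‖p‖ * v := by rw [h3, norm_one]; gcongr
    _ ≤ ‖p‖ * (3 * Real.exp (3 / 2 * v)) := by nlinarith
    _ = _ := by field_simp

theorem isCausal_sqKernel : IsCausal sqKernel 1 := by
  refine ⟨by unfold sqKernel; fun_prop, fun v hv => by simp [sqKernel, max_eq_right hv],
    fun v => ?_⟩
  rw [sqKernel, Complex.norm_real, Real.norm_of_nonneg (by positivity), one_mul]
  rcases le_or_gt v 0 with hv | hv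
  · rw [max_eq_right hv]; simp; positivity
  rw [max_eq_left hv.le]
  have := Real.quadratic_le_exp_of_nonneg (x := 3 / 2 * v) (by linarith)
  nlinarith

theorem IsCausal.integral_eq {f : ℝ → ℂ} {C : ℝ} (hf : IsCausal f C) {s : ℂ} (hs : s.re = 2)
    {g : ℝ → ℂ} (hg : ∀ v, 0 < v → HasDerivAt g (f v * Complex.exp (-s * v)) v)
    (hgc : Continuous g) (hg0 : Tendsto g atTop (𝓝 0)) :
    ∫ v : ℝ, f v * Complex.exp (-s * v) = -g 0 := by
  have h1 : ∫ v : ℝ, f v * Complex.exp (-s * v)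
      = ∫ v in Ioi (0 : ℝ), f v * Complex.exp (-s * v) := by
    rw [setIntegral_eq_integral_of_forall_compl_eq_zero]
    intro v hv
    rw [hf.2.1 v (by simpa using hv), zero_mul]
  rw [h1, integral_Ioi_of_hasDerivAt_of_tendsto hgc.continuousWithinAt (fun v hv => hg v hv)
    (hf.integrable hs).integrableOn hg0, zero_sub]

theorem integral_sqKernel {s : ℂ} (hs : s.re = 2) :
    ∫ v : ℝ, sqKernel v * Complex.exp (-s * v) = 1 / s ^ 3 := by
  have hs0 : s ≠ 0 := by rintro rfl; norm_num at hs
  rw [isCausal_sqKernel.integral_eq hs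
    (g := fun v : ℝ => -((v : ℂ) ^ 2 * Complex.exp (-s * v)) / (2 * s)
      - (v : ℂ) ^ 1 * Complex.exp (-s * v) / s ^ 2 - (v : ℂ) ^ 0 * Complex.exp (-s * v) / s ^ 3)]
  · simp
  · intro v hv
    have hd : HasDerivAt (fun v : ℝ => Complex.exp (-s * v)) (Complex.exp (-s * v) * (-s * 1)) v :=
      ((hasDerivAt_id v).ofReal_comp.const_mul (-s)).cexp
    have hv1 : HasDerivAt (fun v : ℝ => (v : ℂ)) 1 v := (hasDerivAt_id v).ofReal_comp
    convert! ((((hv1.pow 2).mul hd).neg.div_const (2 * s)).sub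
      (((hv1.pow 1).mul hd).div_const (s ^ 2))).sub (((hv1.pow 0).mul hd).div_const (s ^ 3)) using 1
    simp only [sqKernel, max_eq_left hv.le]
    push_cast
    field_simp
    simp
    ring
  · fun_prop
  · have := fun k => tendsto_pow_mul_cexp (a := -s) (by simp [hs]) k
    simpa using (((this 2).neg.div_const (2 * s)).sub ((this 1).div_const (s ^ 2))).sub
      ((this 0).div_const (s ^ 3))

theorem integral_expKernel {p s : ℂ} (hp : 1 ≤ ‖p‖) (hp1 : p.re ≤ 1) (hs : s.re = 2) :
    ∫ v : ℝ, expKernel p v * Complex.exp (-s * v) = (1 / (s - p) + 1 / p) / s ^ 3 := by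
  have hs0 : s ≠ 0 := by rintro rfl; norm_num at hs
  have hp0 : p ≠ 0 := by rintro rfl; norm_num at hp
  have hps : p - s ≠ 0 := by intro h; have := congrArg Complex.re h; simp at this; linarith
  have hsp : s - p ≠ 0 := by intro h; have := congrArg Complex.re h; simp at this; linarith
  rw [(isCausal_expKernel hp hp1).integral_eq hs
    (g := fun v : ℝ => ((v : ℂ) ^ 0 * Complex.exp ((p - s) * v) / (p - s)
      + (v : ℂ) ^ 0 * Complex.exp (-s * v) * ((1 / s + p / s ^ 2))
      + (v : ℂ) ^ 1 * Complex.exp (-s * v) * (p / s)) / p ^ 3)]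
  · simp
    field_simp
    ring
  · intro v hv
    have hd (a : ℂ) :
        HasDerivAt (fun v : ℝ => Complex.exp (a * v)) (Complex.exp (a * v) * (a * 1)) v :=
      ((hasDerivAt_id v).ofReal_comp.const_mul a).cexp
    have hv1 : HasDerivAt (fun v : ℝ => (v : ℂ)) 1 v := (hasDerivAt_id v).ofReal_comp
    convert! (((((hv1.pow 0).mul (hd (p - s))).div_const (p - s)).add
      (((hv1.pow 0).mul (hd (-s))).mul_const (1 / s + p / s ^ 2))).add
      (((hv1.pow 1).mul (hd (-s))).mul_const (p / s))).div_const (p ^ 3) using 1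
    simp only [expKernel, max_eq_left hv.le]
    have : Complex.exp ((p - s) * v) = Complex.exp (p * v) * Complex.exp (-s * v) := by
      rw [← Complex.exp_add]; ring_nf
    rw [this]
    field_simp
    simp
    ring
  · fun_prop
  · have := fun k => tendsto_pow_mul_cexp (a := -s) (by simp [hs]) k
    have h2 := tendsto_pow_mul_cexp (a := p - s) (by simp [hs]; linarith) 0
    simpa using (((h2.div_const (p - s)).add ((this 0).mul_const (1 / s + p / s ^ 2))).add
      ((this 1).mul_const (p / s))).div_const (p ^ 3)

end

section

open MeasureTheory Set Filter Topology

theorem countable_support_xiOrd : (Function.support xiOrd).Countable := by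
  refine summable_xiOrd_div_norm_sq.countable_support.mono fun ρ hρ => ?_
  have h1 := one_le_norm_of_xiOrd_ne_zero (Function.mem_support.1 hρ)
  have h2 : (xiOrd ρ : ℝ) ≠ 0 := by exact_mod_cast Function.mem_support.1 hρ
  exact div_ne_zero h2 (by positivity)

instance : Countable (Function.support xiOrd) := countable_support_xiOrd

/-- The doubly integrated Chebyshev function. -/
noncomputable def psiTwo (v : ℝ) : ℂ :=
  ∑' n : ℕ, (ArithmeticFunction.vonMangoldt n : ℂ) * sqKernel (v - Real.log n)

theorem isCausal_psiTwo_term (n : ℕ) :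
    IsCausal (fun v => (ArithmeticFunction.vonMangoldt n : ℂ) * sqKernel (v - Real.log n))
      (ArithmeticFunction.vonMangoldt n * (n : ℝ) ^ (-(3 / 2) : ℝ)) := by
  have hΛ := ArithmeticFunction.vonMangoldt_nonneg (n := n)
  refine ⟨continuous_const.mul (isCausal_sqKernel.1.comp (by fun_prop)), fun v hv => ?_,
    fun v => ?_⟩
  · have := Real.log_natCast_nonneg n
    simp [isCausal_sqKernel.2.1 (v - Real.log n) (by linarith)]
  · rcases eq_or_ne n 0 with rfl | hn
    · simp
    have hpos : (0 : ℝ) < n := by positivity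
    rw [norm_mul, Complex.norm_real, Real.norm_of_nonneg hΛ, mul_assoc]
    refine mul_le_mul_of_nonneg_left ((isCausal_sqKernel.2.2 _).trans_eq ?_) hΛ
    rw [one_mul, Real.rpow_def_of_pos hpos, ← Real.exp_add]
    ring_nf

theorem summable_psiTwo_bound : Summable fun n : ℕ =>
    ArithmeticFunction.vonMangoldt n * (n : ℝ) ^ (-(3 / 2) : ℝ) := by
  have h := (hasSum_neg_logDeriv_riemannZeta (s := ((3 / 2 : ℝ) : ℂ))
    (by simp; norm_num)).summable
  simpa using h

theorem integral_psiTwo_term {s : ℂ} (hs : s.re = 2) (n : ℕ) :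
    ∫ v : ℝ, (ArithmeticFunction.vonMangoldt n : ℂ) * sqKernel (v - Real.log n)
      * Complex.exp (-s * v)
      = LSeries.term (fun n => (ArithmeticFunction.vonMangoldt n : ℂ)) s n * (1 / s ^ 3) := by
  rcases eq_or_ne n 0 with rfl | hn
  · simp
  have hn' : (n : ℂ) ≠ 0 := by exact_mod_cast hn
  rw [← integral_sqKernel hs, LSeries.term_of_ne_zero hn, div_eq_mul_inv, ← Complex.cpow_neg,
    Complex.cpow_def_of_ne_zero hn', ← integral_const_mul,
    ← integral_add_right_eq_self _ (Real.log n)]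
  congr 1 with v
  rw [add_sub_cancel_right, ← Complex.natCast_log]
  have : Complex.exp (-s * ((v + Real.log n : ℝ) : ℂ))
      = Complex.exp ((Real.log n : ℂ) * -s) * Complex.exp (-s * v) := by
    rw [← Complex.exp_add]; push_cast; ring_nf
  rw [this]
  ring

theorem hasSum_trivialZeros {s : ℂ} (hs : s.re = 2) :
    HasSum (fun n : ℕ => 1 / (s - (-2 * ((n : ℂ) + 1))) + 1 / (-2 * ((n : ℂ) + 1)))
      (-(Complex.digamma (s / 2 + 1) + Real.eulerMascheroniConstant) / 2) := by
  have h := (Complex.hasSum_digamma (z := s / 2) (by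
    rw [show (2 : ℂ) = ((2 : ℝ) : ℂ) by norm_num, Complex.div_ofReal_re, hs]; norm_num)).neg.div_const 2
  have hne (n : ℕ) : s + 2 + 2 * n ≠ 0 := by
    intro h; have := congrArg Complex.re h; simp [hs] at this
    have hn : (0 : ℝ) ≤ n := by positivity
    linarith
  have e : (fun n : ℕ => 1 / (s - (-2 * ((n : ℂ) + 1))) + 1 / (-2 * ((n : ℂ) + 1)))
      = fun n : ℕ => -(1 / ((n : ℂ) + 1) - 1 / (s / 2 + 1 + n)) / 2 := by
    funext n
    have h1 := hne n
    have h2 : (n : ℂ) + 1 ≠ 0 := by exact_mod_cast n.succ_ne_zero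
    have h3 : s / 2 + 1 + n ≠ 0 := by
      intro h; apply h1; linear_combination 2 * h
    rw [show s - (-2 * ((n : ℂ) + 1)) = 2 * (s / 2 + 1 + n) by ring, neg_mul]
    generalize s / 2 + 1 + (n : ℂ) = a at *
    generalize (n : ℂ) + 1 = b at *
    field_simp
    ring
  rw [e]
  exact h

theorem isCausal_zero_term (ρ : Function.support xiOrd) :
    IsCausal (fun v => (xiOrd ρ : ℂ) * expKernel ρ v) ((xiOrd ρ : ℝ) / ‖(ρ : ℂ)‖ ^ 2 * 3) := by
  have h := (isCausal_expKernel (one_le_norm_of_xiOrd_ne_zero ρ.2)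
    (re_lt_one_of_entireXi_eq_zero (entireXi_eq_zero_of_xiOrd_ne_zero ρ.2)).le).const_mul (xiOrd ρ)
  convert h using 1
  rw [Complex.norm_natCast]; ring

theorem isCausal_trivialZero_term (n : ℕ) :
    IsCausal (expKernel (-2 * ((n : ℂ) + 1))) (3 / ‖-2 * ((n : ℂ) + 1)‖ ^ 2) := by
  apply isCausal_expKernel
  · rw [norm_mul, norm_neg, show (n : ℂ) + 1 = ((n + 1 : ℕ) : ℂ) by push_cast; rfl,
      Complex.norm_natCast, Complex.norm_ofNat]
    push_cast; have : (0 : ℝ) ≤ n := by positivity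
    linarith
  · simp; have : (0 : ℝ) ≤ n := by positivity
    linarith

theorem summable_trivialZero_bound :
    Summable fun n : ℕ => 3 / ‖-2 * ((n : ℂ) + 1)‖ ^ 2 := by
  refine (summable_one_div_succ_sq.mul_left (3 / 4)).congr fun n => ?_
  rw [norm_mul, norm_neg, show (n : ℂ) + 1 = ((n + 1 : ℕ) : ℂ) by push_cast; rfl,
    Complex.norm_natCast, Complex.norm_ofNat]
  push_cast
  field_simp
  norm_num

/-- The explicit formula for the doubly integrated Chebyshev function. -/
theorem psiTwo_eq (v : ℝ) : psiTwo v = expKernel 1 v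
    - ∑' ρ : Function.support xiOrd, (xiOrd ρ : ℂ) * expKernel ρ v
    - ∑' n : ℕ, expKernel (-2 * ((n : ℂ) + 1)) v - (Real.log (2 * Real.pi) : ℂ) * sqKernel v := by
  have c1 := IsCausal.tsum summable_psiTwo_bound isCausal_psiTwo_term
  have c2 := (isCausal_expKernel (p := 1) (by simp) (by simp)).const_mul (-1)
  have hsρ : Summable fun ρ : Function.support xiOrd => (xiOrd ρ : ℝ) / ‖(ρ : ℂ)‖ ^ 2 * 3 :=
    (summable_xiOrd_div_norm_sq.subtype _).mul_right 3
  have c3 := IsCausal.tsum hsρ isCausal_zero_term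
  have c4 := IsCausal.tsum summable_trivialZero_bound isCausal_trivialZero_term
  have c5 := isCausal_sqKernel.const_mul (Real.log (2 * Real.pi) : ℂ)
  have key := (((c1.add c2).add c3).add c4).add c5 |>.eq_zero (fun s hs => ?_) v
  · rw [psiTwo]
    linear_combination key
  · have hs1 : 1 < s.re := by rw [hs]; norm_num
    have i1 := (IsCausal.hasSum_integral summable_psiTwo_bound isCausal_psiTwo_term hs)
    have i3 := (IsCausal.hasSum_integral hsρ isCausal_zero_term hs)
    have i4 := (IsCausal.hasSum_integral summable_trivialZero_bound isCausal_trivialZero_term hs)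
    have t1 := (((c1.add c2).add c3).add c4).integral_add c5 hs
    have t2 := ((c1.add c2).add c3).integral_add c4 hs
    have t3 := (c1.add c2).integral_add c3 hs
    have t4 := c1.integral_add c2 hs
    refine t1.trans ((congrArg (· + _) (t2.trans (congrArg (· + _) (t3.trans
      (congrArg (· + _) t4))))).trans ?_)
    have e1 : ∫ v : ℝ, (∑' n : ℕ, (ArithmeticFunction.vonMangoldt n : ℂ)
        * sqKernel (v - Real.log n)) * Complex.exp (-s * v)
        = -(logDeriv riemannZeta s) * (1 / s ^ 3) := by
      simp_rw [integral_psiTwo_term hs] at i1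
      rw [← i1.tsum_eq, tsum_mul_right, logDeriv_apply, ← neg_div]
      congr 1
      exact ArithmeticFunction.LSeries_vonMangoldt_eq_deriv_riemannZeta_div hs1
    have e3 : ∫ v : ℝ, (∑' ρ : Function.support xiOrd, (xiOrd ρ : ℂ) * expKernel ρ v)
        * Complex.exp (-s * v) = (logDeriv entireXi s - logDeriv entireXi 0) * (1 / s ^ 3) := by
      rw [← i3.tsum_eq]
      have t (ρ : Function.support xiOrd) : ∫ v : ℝ, (xiOrd ρ : ℂ) * expKernel ρ v
          * Complex.exp (-s * v) = (xiOrd ρ : ℂ) * (1 / (s - ρ) + 1 / ρ) * (1 / s ^ 3) := by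
        simp_rw [mul_assoc]
        rw [integral_const_mul, integral_expKernel (one_le_norm_of_xiOrd_ne_zero ρ.2)
          (re_lt_one_of_entireXi_eq_zero (entireXi_eq_zero_of_xiOrd_ne_zero ρ.2)).le hs]
        ring
      simp_rw [t]
      rw [tsum_mul_right, ← (hasSum_xiOrd_logDeriv hs1).tsum_eq]
      congr 1
      refine tsum_subtype_eq_of_support_subset
        (f := fun ρ : ℂ => (xiOrd ρ : ℂ) * (1 / (s - ρ) + 1 / ρ)) fun ρ hρ => ?_
      rw [Function.mem_support] at hρ ⊢
      intro h0; apply hρ; rw [h0]; simp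
    have e4 : ∫ v : ℝ, (∑' n : ℕ, expKernel (-2 * ((n : ℂ) + 1)) v) * Complex.exp (-s * v)
        = -(Complex.digamma (s / 2 + 1) + Real.eulerMascheroniConstant) / 2 * (1 / s ^ 3) := by
      rw [← i4.tsum_eq, ← (hasSum_trivialZeros hs).tsum_eq, ← tsum_mul_right]
      congr 1 with n
      obtain ⟨h1, h2⟩ : 1 ≤ ‖-2 * ((n : ℂ) + 1)‖ ∧ (-2 * ((n : ℂ) + 1)).re ≤ 1 := by
        have : (0 : ℝ) ≤ n := by positivity
        constructor
        · rw [norm_mul, norm_neg, show (n : ℂ) + 1 = ((n + 1 : ℕ) : ℂ) by push_cast; rfl,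
            Complex.norm_natCast, Complex.norm_ofNat]
          push_cast; linarith
        · simp; linarith
      rw [integral_expKernel h1 h2 hs]
      ring
    have e2 : ∫ v : ℝ, -1 * expKernel 1 v * Complex.exp (-s * v)
        = -(1 / (s - 1) + 1) * (1 / s ^ 3) := by
      simp_rw [mul_assoc]
      rw [integral_const_mul, integral_expKernel (by simp) (by simp) hs]
      ring
    have e5 : ∫ v : ℝ, (Real.log (2 * Real.pi) : ℂ) * sqKernel v * Complex.exp (-s * v)
        = (Real.log (2 * Real.pi) : ℂ) * (1 / s ^ 3) := by
      simp_rw [mul_assoc]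
      rw [integral_const_mul, integral_sqKernel hs]
    rw [e1, e2, e3, e4, e5, logDeriv_entireXi_eq hs1, logDeriv_entireXi_zero,
      logDeriv_entireXi_one]
    have l1 : Real.log (4 * Real.pi) = Real.log 4 + Real.log Real.pi :=
      Real.log_mul (by norm_num) Real.pi_ne_zero
    have l2 : Real.log (2 * Real.pi) = Real.log 2 + Real.log Real.pi :=
      Real.log_mul (by norm_num) Real.pi_ne_zero
    rw [l1, l2, Real.log_four_eq]
    push_cast
    ring

end

section

open MeasureTheory Set Filter Topology

/-- The second difference of `f` with step `h`, starting at `v`. -/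
noncomputable def secondDiff (f : ℝ → ℂ) (h v : ℝ) : ℂ := f (v + 2 * h) - 2 * f (v + h) + f v

theorem hasSum_secondDiff {ι : Type*} {f : ι → ℝ → ℂ} (hf : ∀ v, Summable fun i => f i v)
    (h v : ℝ) :
    HasSum (fun i => secondDiff (f i) h v) (secondDiff (fun v => ∑' i, f i v) h v) :=
  (((hf _).hasSum.sub ((hf _).hasSum.mul_left 2)).add (hf _).hasSum)

theorem secondDiff_sqKernel {h v : ℝ} (hh : 0 ≤ h) (hv : 0 ≤ v) :
    secondDiff sqKernel h v = ((h ^ 2 : ℝ) : ℂ) := by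
  rw [secondDiff, sqKernel, sqKernel, sqKernel, max_eq_left hv, max_eq_left (by linarith),
    max_eq_left (by linarith)]
  push_cast; ring

theorem secondDiff_expKernel {p : ℂ} {h v : ℝ} (hh : 0 ≤ h) (hv : 0 ≤ v) :
    secondDiff (expKernel p) h v = Complex.exp (p * v) * (Complex.exp (p * h) - 1) ^ 2 / p ^ 3 := by
  rw [secondDiff, expKernel, expKernel, expKernel, max_eq_left hv, max_eq_left (by linarith),
    max_eq_left (by linarith),
    show p * ((v + 2 * h : ℝ) : ℂ) = p * v + p * h + p * h by push_cast; ring,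
    show p * ((v + h : ℝ) : ℂ) = p * v + p * h by push_cast; ring, Complex.exp_add,
    Complex.exp_add]
  ring

theorem re_secondDiff_sqKernel (h v : ℝ) : (secondDiff sqKernel h v).re
    = max (v + 2 * h) 0 ^ 2 / 2 - 2 * (max (v + h) 0 ^ 2 / 2) + max v 0 ^ 2 / 2 := by
  rw [secondDiff, sqKernel, sqKernel, sqKernel, ← Complex.ofReal_ofNat, ← Complex.ofReal_mul,
    ← Complex.ofReal_sub, ← Complex.ofReal_add, Complex.ofReal_re]

theorem re_secondDiff_sqKernel_nonneg {h : ℝ} (hh : 0 ≤ h) (v : ℝ) :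
    0 ≤ (secondDiff sqKernel h v).re := by
  rw [re_secondDiff_sqKernel]
  rcases max_cases (v + 2 * h) 0 with ⟨e1, i1⟩ | ⟨e1, i1⟩ <;>
  rcases max_cases (v + h) 0 with ⟨e2, i2⟩ | ⟨e2, i2⟩ <;>
  rcases max_cases v 0 with ⟨e3, i3⟩ | ⟨e3, i3⟩ <;> rw [e1, e2, e3] <;> nlinarith

theorem re_secondDiff_sqKernel_le {h : ℝ} (hh : 0 ≤ h) (v : ℝ) :
    (secondDiff sqKernel h v).re ≤ h ^ 2 := by
  rw [re_secondDiff_sqKernel]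
  rcases max_cases (v + 2 * h) 0 with ⟨e1, i1⟩ | ⟨e1, i1⟩ <;>
  rcases max_cases (v + h) 0 with ⟨e2, i2⟩ | ⟨e2, i2⟩ <;>
  rcases max_cases v 0 with ⟨e3, i3⟩ | ⟨e3, i3⟩ <;> rw [e1, e2, e3] <;> nlinarith

theorem re_secondDiff_sqKernel_eq_zero {h v : ℝ} (hh : 0 ≤ h) (hv : v + 2 * h ≤ 0) :
    (secondDiff sqKernel h v).re = 0 := by
  rw [re_secondDiff_sqKernel, max_eq_right hv, max_eq_right (by linarith),
    max_eq_right (by linarith)]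
  ring

theorem hasSum_secondDiff_psiTwo (h v : ℝ) :
    HasSum (fun n : ℕ => ArithmeticFunction.vonMangoldt n *
      (secondDiff sqKernel h (v - Real.log n)).re) (secondDiff psiTwo h v).re := by
  have hs := hasSum_secondDiff
    (fun v => IsCausal.summable summable_psiTwo_bound isCausal_psiTwo_term v) h v
  have := Complex.hasSum_re hs
  refine this.congr_fun ?_
  intro n
  rw [← Complex.re_ofReal_mul]
  congr 1
  simp only [secondDiff]
  rw [show v + 2 * h - Real.log n = v - Real.log n + 2 * h by ring,
    show v + h - Real.log n = v - Real.log n + h by ring]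
  ring

theorem sq_mul_psi_le_secondDiff {h : ℝ} (hh : 0 ≤ h) (v : ℝ) :
    h ^ 2 * Chebyshev.psi (Real.exp v) ≤ (secondDiff psiTwo h v).re := by
  have hs := hasSum_secondDiff_psiTwo h v
  have := hs.summable.sum_le_tsum (Finset.Ioc 0 ⌊Real.exp v⌋₊) fun n _ =>
    mul_nonneg ArithmeticFunction.vonMangoldt_nonneg (re_secondDiff_sqKernel_nonneg hh _)
  rw [hs.tsum_eq] at this
  refine le_trans (le_of_eq ?_) this
  rw [Chebyshev.psi, Finset.mul_sum]
  refine Finset.sum_congr rfl fun n hn => ?_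
  rw [Finset.mem_Ioc] at hn
  have h1 : (n : ℝ) ≤ Real.exp v := (Nat.le_floor_iff (Real.exp_pos v).le).1 hn.2
  have h2 : Real.log n ≤ v := (Real.log_le_iff_le_exp (by exact_mod_cast hn.1)).2 h1
  rw [secondDiff_sqKernel hh (by linarith), Complex.ofReal_re, mul_comm]

theorem secondDiff_le_sq_mul_psi {h : ℝ} (hh : 0 ≤ h) (v : ℝ) :
    (secondDiff psiTwo h v).re ≤ h ^ 2 * Chebyshev.psi (Real.exp (v + 2 * h)) := by
  have hs := hasSum_secondDiff_psiTwo h v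
  rw [← hs.tsum_eq, tsum_eq_sum (s := Finset.Ioc 0 ⌊Real.exp (v + 2 * h)⌋₊), Chebyshev.psi,
    Finset.mul_sum]
  · refine Finset.sum_le_sum fun n _ => ?_
    rw [mul_comm]
    exact mul_le_mul_of_nonneg_right (re_secondDiff_sqKernel_le hh _)
      ArithmeticFunction.vonMangoldt_nonneg
  · intro n hn
    rcases Nat.eq_zero_or_pos n with rfl | hn0
    · simp
    have hn1 : ¬ n ≤ ⌊Real.exp (v + 2 * h)⌋₊ := fun h => hn (Finset.mem_Ioc.2 ⟨hn0, h⟩)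
    rw [Nat.le_floor_iff (Real.exp_pos _).le, ← Real.log_le_iff_le_exp (by exact_mod_cast hn0),
      not_le] at hn1
    rw [re_secondDiff_sqKernel_eq_zero hh (by linarith), mul_zero]

theorem secondDiff_psiTwo_eq {h v : ℝ} (hh : 0 ≤ h) (hv : 0 ≤ v) :
    (secondDiff psiTwo h v).re = Real.exp v * (Real.exp h - 1) ^ 2
      - (∑' ρ : Function.support xiOrd, (xiOrd ρ : ℝ) *
          (Complex.exp (ρ * v) * (Complex.exp (ρ * h) - 1) ^ 2 / (ρ : ℂ) ^ 3).re)
      + (∑' n : ℕ, Real.exp (-2 * (n + 1) * v) * (Real.exp (-2 * (n + 1) * h) - 1) ^ 2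
          / (8 * ((n : ℝ) + 1) ^ 3)) - Real.log (2 * Real.pi) * h ^ 2 := by
  have hsρ : Summable fun ρ : Function.support xiOrd => (xiOrd ρ : ℝ) / ‖(ρ : ℂ)‖ ^ 2 * 3 :=
    (summable_xiOrd_div_norm_sq.subtype _).mul_right 3
  have h1 := Complex.hasSum_re
    (hasSum_secondDiff (fun v => IsCausal.summable hsρ isCausal_zero_term v) h v)
  have h2 := Complex.hasSum_re (hasSum_secondDiff
    (fun v => IsCausal.summable summable_trivialZero_bound isCausal_trivialZero_term v) h v)
  have e : secondDiff psiTwo h v = secondDiff (expKernel 1) h v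
      - secondDiff (fun v => ∑' ρ : Function.support xiOrd, (xiOrd ρ : ℂ) * expKernel ρ v) h v
      - secondDiff (fun v => ∑' n : ℕ, expKernel (-2 * ((n : ℂ) + 1)) v) h v
      - (Real.log (2 * Real.pi) : ℂ) * secondDiff sqKernel h v := by
    simp only [secondDiff, psiTwo_eq]; ring
  rw [e, Complex.sub_re, Complex.sub_re, Complex.sub_re, ← h1.tsum_eq, ← h2.tsum_eq,
    secondDiff_sqKernel hh hv, secondDiff_expKernel hh hv, ← Complex.ofReal_mul,
    Complex.ofReal_re]
  have e1 : (Complex.exp (1 * v) * (Complex.exp (1 * h) - 1) ^ 2 / 1 ^ 3).re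
      = Real.exp v * (Real.exp h - 1) ^ 2 := by
    rw [one_mul, one_mul, one_pow, div_one]
    rw [← Complex.ofReal_exp, ← Complex.ofReal_exp, ← Complex.ofReal_one, ← Complex.ofReal_sub,
      ← Complex.ofReal_pow, ← Complex.ofReal_mul, Complex.ofReal_re]
  have e2 : ∀ ρ : Function.support xiOrd,
      (secondDiff (fun v => (xiOrd ρ : ℂ) * expKernel ρ v) h v).re = (xiOrd ρ : ℝ) *
          (Complex.exp (ρ * v) * (Complex.exp (ρ * h) - 1) ^ 2 / (ρ : ℂ) ^ 3).re := fun ρ => by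
    rw [← secondDiff_expKernel hh hv, ← Complex.re_ofReal_mul, Complex.ofReal_natCast]
    congr 1
    simp only [secondDiff]; ring
  have e3 : ∀ n : ℕ, (secondDiff (expKernel (-2 * ((n : ℂ) + 1))) h v).re
      = -(Real.exp (-2 * (n + 1) * v) * (Real.exp (-2 * (n + 1) * h) - 1) ^ 2
          / (8 * ((n : ℝ) + 1) ^ 3)) := fun n => by
    rw [secondDiff_expKernel hh hv, ← Complex.ofReal_re (-(_ : ℝ))]
    congr 1
    push_cast
    rw [mul_pow (-2 : ℂ), ← div_neg]
    norm_num
  rw [e1, tsum_congr e2, tsum_congr e3, tsum_neg]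
  ring

/-- The contribution of the trivial zeros never outweighs the constant term. -/
theorem tsum_trivialZero_le {h v : ℝ} (hh : 0 ≤ h) (hv : 1 / 2 ≤ v) :
    0 ≤ (∑' n : ℕ, Real.exp (-2 * (n + 1) * v) * (Real.exp (-2 * (n + 1) * h) - 1) ^ 2
          / (8 * ((n : ℝ) + 1) ^ 3)) ∧
    (∑' n : ℕ, Real.exp (-2 * (n + 1) * v) * (Real.exp (-2 * (n + 1) * h) - 1) ^ 2
          / (8 * ((n : ℝ) + 1) ^ 3)) ≤ Real.log (2 * Real.pi) * h ^ 2 := by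
  have key : ∀ n : ℕ, Real.exp (-2 * (n + 1) * v) * (Real.exp (-2 * (n + 1) * h) - 1) ^ 2
          / (8 * ((n : ℝ) + 1) ^ 3) ≤ h ^ 2 / 2 * (1 / ((n : ℝ) + 1) ^ 2) := fun n => by
    have hk : (1 : ℝ) ≤ (n : ℝ) + 1 := by have : (0 : ℝ) ≤ n := by positivity
                                          linarith
    generalize (n : ℝ) + 1 = k at hk
    have h1 : Real.exp (-2 * k * v) ≤ 1 / k := by
      rw [show -2 * k * v = -(2 * k * v) by ring, Real.exp_neg, ← one_div]
      apply one_div_le_one_div_of_le (by linarith)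
      nlinarith [Real.add_one_le_exp (2 * k * v)]
    have h2 : (Real.exp (-2 * k * h) - 1) ^ 2 ≤ (2 * k * h) ^ 2 := by
      have a : -(2 * k * h) ≤ Real.exp (-2 * k * h) - 1 := by
        linarith [Real.add_one_le_exp (-2 * k * h)]
      have b : Real.exp (-2 * k * h) ≤ 1 := Real.exp_le_one_iff.2 (by nlinarith [mul_nonneg (by linarith : 0 ≤ k) hh])
      nlinarith
    rw [div_le_iff₀ (by positivity)]
    calc _ ≤ 1 / k * (2 * k * h) ^ 2 := by gcongr
      _ = _ := by field_simp; ring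
  have hz : HasSum (fun n : ℕ => 1 / ((n : ℝ) + 1) ^ 2) (Real.pi ^ 2 / 6) := by
    have := (hasSum_nat_add_iff' 1).2 hasSum_zeta_two
    simpa using this
  have hb := hz.mul_left (h ^ 2 / 2)
  have hnn : ∀ n : ℕ, 0 ≤ Real.exp (-2 * (n + 1) * v) * (Real.exp (-2 * (n + 1) * h) - 1) ^ 2
          / (8 * ((n : ℝ) + 1) ^ 3) := fun n => by positivity
  refine ⟨tsum_nonneg hnn, ?_⟩
  refine ((Summable.of_nonneg_of_le hnn key hb.summable).tsum_le_tsum key hb.summable).trans ?_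
  rw [hb.tsum_eq]
  have := log_two_mul_pi_bounds.1
  have : Real.pi ^ 2 ≤ 3.15 ^ 2 := by
    have := Real.pi_lt_d2; have := Real.pi_pos; gcongr
  nlinarith [sq_nonneg h]

end

section

open MeasureTheory Set Filter Topology

theorem re_logDeriv_riemannZeta_nonpos {x : ℝ} (hx : 1 < x) :
    (logDeriv riemannZeta (x : ℂ)).re ≤ 0 := by
  have h := hasSum_neg_logDeriv_riemannZeta (s := (x : ℂ)) (by simpa using hx)
  have := h.nonneg fun n => by
    simp only [Complex.ofReal_im, zero_mul, Real.cos_zero, mul_one]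
    exact mul_nonneg ArithmeticFunction.vonMangoldt_nonneg (by positivity)
  simpa using this

theorem re_logDeriv_entireXi_le {b : ℝ} (hb : 0 < b) :
    (logDeriv entireXi ((b + 1 : ℝ) : ℂ)).re
      ≤ 1 / b + Real.log ((b + 3) / (2 * Real.pi)) / 2 := by
  rw [logDeriv_entireXi_eq (by simpa using hb)]
  have h1 := re_logDeriv_riemannZeta_nonpos (x := b + 1) (by linarith)
  have h2 := Complex.re_digamma_le_log (x := (b + 3) / 2) (by linarith)
  have e1 : 1 / (((b + 1 : ℝ) : ℂ) - 1) = ((1 / b : ℝ) : ℂ) := by push_cast; ring_nf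
  have e2 : ((b + 1 : ℝ) : ℂ) / 2 + 1 = (((b + 3) / 2 : ℝ) : ℂ) := by push_cast; ring
  rw [e1, e2, Complex.add_re, Complex.add_re, Complex.sub_re, Complex.ofReal_re,
    Complex.div_ofNat_re, Complex.div_ofNat_re, Complex.ofReal_re]
  have : Real.log ((b + 3) / (2 * Real.pi)) = Real.log ((b + 3) / 2) - Real.log Real.pi := by
    rw [← Real.log_div (by positivity) Real.pi_ne_zero]; congr 1; field_simp
  linarith

theorem xiOrd_mul_le_re {b : ℝ} (hb : 0 < b) (ρ : ℂ) :
    (xiOrd ρ : ℝ) * (b ^ 2 / (b ^ 2 + ρ.im ^ 2))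
      ≤ (b + 1) * ((xiOrd ρ : ℝ) * (1 / (((b + 1 : ℝ) : ℂ) - ρ)).re) := by
  by_cases h0 : xiOrd ρ = 0
  · simp [h0]
  have h1 := re_lt_one_of_entireXi_eq_zero (entireXi_eq_zero_of_xiOrd_ne_zero h0)
  have h2 := re_pos_of_entireXi_eq_zero (entireXi_eq_zero_of_xiOrd_ne_zero h0)
  have : (1 / (((b + 1 : ℝ) : ℂ) - ρ)).re
      = (b + (1 - ρ.re)) / ((b + (1 - ρ.re)) ^ 2 + ρ.im ^ 2) := by
    rw [one_div, Complex.inv_re, Complex.normSq_apply]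
    simp only [Complex.sub_re, Complex.ofReal_re, Complex.sub_im, Complex.ofReal_im]
    congr 1 <;> ring
  rw [this, mul_left_comm]
  refine mul_le_mul_of_nonneg_left ?_ (by positivity)
  have hu0 : 0 < 1 - ρ.re := by linarith
  have hu1 : 1 - ρ.re < 1 := by linarith
  generalize 1 - ρ.re = u at hu0 hu1
  have hg := sq_nonneg ρ.im
  generalize ρ.im ^ 2 = g at hg
  rw [← mul_div_assoc, div_le_div_iff₀ (by positivity) (by positivity)]
  have a1 : b ^ 2 * g ≤ (b + 1) * (b + u) * g := mul_le_mul_of_nonneg_right (by nlinarith) hg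
  have a2 : b ^ 2 * (b + u) ^ 2 ≤ (b + 1) * (b + u) * b ^ 2 := by
    have : (b + u) ^ 2 ≤ (b + 1) * (b + u) := by nlinarith
    nlinarith [sq_nonneg b]
  linarith

theorem tsum_xiOrd_mul_le {b : ℝ} (hb : 0 < b) :
    Summable (fun ρ : ℂ => (xiOrd ρ : ℝ) * (b ^ 2 / (b ^ 2 + ρ.im ^ 2))) ∧
    ∑' ρ : ℂ, (xiOrd ρ : ℝ) * (b ^ 2 / (b ^ 2 + ρ.im ^ 2))
      ≤ (b + 1) * (1 / b + Real.log ((b + 3) / (2 * Real.pi)) / 2) := by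
  have h := (hasSum_xiOrd_re (s := ((b + 1 : ℝ) : ℂ)) (by simpa using hb.le)).mul_left (b + 1)
  have hs := Summable.of_nonneg_of_le (fun ρ => by positivity) (xiOrd_mul_le_re hb) h.summable
  refine ⟨hs, (hs.tsum_le_tsum (xiOrd_mul_le_re hb) h.summable).trans ?_⟩
  rw [h.tsum_eq]
  exact mul_le_mul_of_nonneg_left (re_logDeriv_entireXi_le hb) (by linarith)

theorem tsum_xiOrd_div_im_sq_le :
    Summable (fun ρ : ℂ => (xiOrd ρ : ℝ) / ρ.im ^ 2) ∧
    ∑' ρ : ℂ, (xiOrd ρ : ℝ) / ρ.im ^ 2 ≤ 0.0562 := by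
  have hle (ρ : ℂ) : (xiOrd ρ : ℝ) / ρ.im ^ 2
      ≤ 36 / 35 * ((xiOrd ρ : ℝ) * (1 / (1 + ρ.im ^ 2))) := by
    by_cases h0 : xiOrd ρ = 0
    · simp [h0]
    have h1 := im_sq_ge_of_xiOrd_ne_zero h0
    rw [mul_one_div, mul_div, div_le_div_iff₀ (by linarith) (by linarith)]
    have : (0 : ℝ) ≤ xiOrd ρ := by positivity
    nlinarith
  have hs := summable_xiOrd_div.mul_left (36 / 35)
  have h := Summable.of_nonneg_of_le (fun ρ => by positivity) hle hs
  refine ⟨h, (h.tsum_le_tsum hle hs).trans ?_⟩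
  rw [tsum_mul_left]
  linarith [tsum_xiOrd_div_le]

theorem norm_exp_sub_one_sq_le {ρ : ℂ} {h : ℝ} (hh : 0 < h) (h1 : ρ.re ≤ 1)
    (hγ : ρ.im ≠ 0) : ‖(Complex.exp (ρ * h) - 1) ^ 2 / ρ ^ 3‖
      ≤ Real.exp (2 * h) * h ^ 2 * (min 1 ((2 / h) ^ 2 / ρ.im ^ 2) / |ρ.im|) := by
  have hle := Complex.abs_im_le_norm ρ
  have hg : 0 < |ρ.im| := abs_pos.2 hγ
  have hn : 0 < ‖ρ‖ := hg.trans_le hle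
  have he : Real.exp (2 * h) = Real.exp h ^ 2 := by rw [← Real.exp_nat_mul]; push_cast; ring_nf
  have hre : (ρ * h).re ≤ h := by rw [Complex.re_mul_ofReal]; nlinarith
  have b1 : ‖Complex.exp (ρ * h) - 1‖ ≤ ‖ρ‖ * h * Real.exp h := by
    have := (convex_halfSpace_re_le h).norm_image_sub_le_of_norm_deriv_le (𝕜 := ℂ)
      (f := Complex.exp) (C := Real.exp h) (x := 0) (y := ρ * h)
      (fun x _ => Complex.differentiableAt_exp)
      (fun x hx => by
        rw [Complex.deriv_exp, Complex.norm_exp]; exact Real.exp_le_exp.2 hx)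
      (by simpa using hh.le) hre
    rw [Complex.exp_zero, sub_zero, norm_mul, Complex.norm_real, Real.norm_of_nonneg hh.le] at this
    linarith
  have b2 : ‖Complex.exp (ρ * h) - 1‖ ≤ 2 * Real.exp h := by
    refine (norm_sub_le _ _).trans ?_
    rw [Complex.norm_exp, norm_one]
    have := Real.exp_le_exp.2 hre
    have := Real.one_le_exp hh.le
    linarith
  rw [norm_div, norm_pow, norm_pow, div_le_iff₀ (by positivity), he]
  have c : ‖ρ‖ ^ 2 ≤ 1 / |ρ.im| * ‖ρ‖ ^ 3 := by
    rw [one_div_mul_eq_div, le_div_iff₀ hg, pow_succ (‖ρ‖) 2]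
    exact mul_le_mul_of_nonneg_left hle (by positivity)
  have key : ‖Complex.exp (ρ * h) - 1‖ ^ 2
      ≤ Real.exp h ^ 2 * h ^ 2 * min 1 ((2 / h) ^ 2 / ρ.im ^ 2) * ‖ρ‖ ^ 2 := by
    rcases min_choice 1 ((2 / h) ^ 2 / ρ.im ^ 2) with h | h <;> rw [h]
    · calc _ ≤ (‖ρ‖ * _ * Real.exp _) ^ 2 := by gcongr
        _ = _ := by ring
    · calc _ ≤ (2 * Real.exp _) ^ 2 := by gcongr
        _ ≤ (2 * Real.exp _) ^ 2 * (‖ρ‖ ^ 2 / ρ.im ^ 2) := by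
          refine le_mul_of_one_le_right (by positivity) ?_
          rw [one_le_div (by positivity), ← sq_abs ρ.im]; gcongr
        _ = _ := by field_simp
  calc _ ≤ Real.exp h ^ 2 * h ^ 2 * min 1 ((2 / h) ^ 2 / ρ.im ^ 2) * ‖ρ‖ ^ 2 := key
    _ ≤ Real.exp h ^ 2 * h ^ 2 * min 1 ((2 / h) ^ 2 / ρ.im ^ 2) * (1 / |ρ.im| * ‖ρ‖ ^ 3) := by
      gcongr
    _ = _ := by ring

/-- A zero near the line `re = 1` is high up, which balances its size. -/
theorem exp_re_mul_le {ρ : ℂ} (hρ : xiOrd ρ ≠ 0) {v : ℝ} (hv : 0 ≤ v) :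
    Real.exp (ρ.re * v)
      ≤ Real.exp v * (Real.exp (-(2 * √(v / 9.646))) * (max |ρ.im| 40 / 8)) := by
  have hz := zero_free_region hρ
  set M := max |ρ.im| 40 / 8 with hM
  have hM5 : 5 ≤ M := by
    have := le_max_right |ρ.im| 40
    rw [hM]; linarith
  have hl : 0 < Real.log M := Real.log_pos (by linarith)
  have h1 : 2 * √(v / 9.646) ≤ (1 - ρ.re) * v + Real.log M := by
    have e : v / (9.646 * Real.log M) = √(v / 9.646) ^ 2 / Real.log M := by
      rw [Real.sq_sqrt (by positivity)]; field_simp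
    have e2 : v / (9.646 * Real.log M) ≤ (1 - ρ.re) * v := by
      calc _ = 1 / (9.646 * Real.log M) * v := by ring
        _ ≤ _ := by gcongr
    have e3 : 2 * √(v / 9.646) ≤ √(v / 9.646) ^ 2 / Real.log M + Real.log M := by
      rw [← sub_nonneg]
      have : √(v / 9.646) ^ 2 / Real.log M + Real.log M - 2 * √(v / 9.646)
        = (√(v / 9.646) - Real.log M) ^ 2 / Real.log M := by field_simp; ring
      rw [this]; positivity
    linarith
  calc Real.exp (ρ.re * v) ≤ Real.exp (v + (-(2 * √(v / 9.646)) + Real.log M)) :=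
        Real.exp_le_exp.2 (by linarith)
    _ = _ := by rw [Real.exp_add, Real.exp_add, Real.exp_log (by linarith)]

theorem min_one_div_le {r g : ℝ} (hr : 0 < r) (hg : 0 < g) :
    min 1 (r / g) ≤ 2 * (r / (r + g)) := by
  rcases le_total r g with h | h
  · refine (min_le_right _ _).trans ?_
    rw [← mul_div_assoc, div_le_div_iff₀ hg (by positivity)]
    nlinarith
  · refine (min_le_left _ _).trans ?_
    rw [← mul_div_assoc, le_div_iff₀ (by positivity)]
    linarith

theorem pair_le_of_half_le {ρ : ℂ} (hρ : xiOrd ρ ≠ 0) (hβ : 1 / 2 ≤ ρ.re) {v r : ℝ} (hv : 0 ≤ v)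
    (hr : 0 < r) :
    min 1 (r / ρ.im ^ 2) / |ρ.im| * (Real.exp (ρ.re * v) + Real.exp ((1 - ρ.re) * v))
      ≤ 2 * (Real.exp v * (Real.exp (-(2 * √(v / 9.646))) / 8 *
        (r / (r + ρ.im ^ 2) + 200 * (1 / ρ.im ^ 2)) + Real.exp (-(v / 2)) / 5 *
          (r / (r + ρ.im ^ 2)))) := by
  have h35 := im_sq_ge_of_xiOrd_ne_zero hρ
  have hg5 : 5 ≤ |ρ.im| := by
    rw [← sq_abs] at h35; nlinarith [abs_nonneg ρ.im]
  have hE := exp_re_mul_le hρ hv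
  have hE2 : Real.exp ((1 - ρ.re) * v) ≤ Real.exp v * Real.exp (-(v / 2)) := by
    rw [← Real.exp_add]; exact Real.exp_le_exp.2 (by nlinarith)
  have hm := min_one_div_le hr (by linarith : 0 < ρ.im ^ 2)
  have hm1 : min 1 (r / ρ.im ^ 2) ≤ 1 := min_le_left _ _
  have hm0 : 0 ≤ min 1 (r / ρ.im ^ 2) := by positivity
  have hg2 : ρ.im ^ 2 = |ρ.im| ^ 2 := (sq_abs _).symm
  rw [hg2] at hm hm1 hm0 ⊢
  generalize |ρ.im| = g at *
  generalize min 1 (r / g ^ 2) = M at *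
  have hmax : M / g * (max g 40 / 8) ≤ (M + 400 / g ^ 2) / 8 := by
    rcases max_cases g 40 with ⟨e, _⟩ | ⟨e, _⟩ <;> rw [e]
    · have : M / g * (g / 8) = M / 8 := by field_simp
      have : 0 ≤ 400 / g ^ 2 := by positivity
      linarith
    · have : M * (40 / g - 1) ≤ 1 * (40 / g - 1) := by
        refine mul_le_mul_of_nonneg_right hm1 ?_
        rw [sub_nonneg, le_div_iff₀ (by linarith)]; linarith
      have h2 : 40 / g - 1 ≤ 400 / g ^ 2 := by
        rw [← sub_nonneg]
        have : 400 / g ^ 2 - (40 / g - 1) = (g - 20) ^ 2 / g ^ 2 := by field_simp; ring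
        rw [this]; positivity
      have : M / g * (40 / 8) = M * (40 / g) / 8 := by ring
      linarith
  have hM5 : M / g ≤ M / 5 := by gcongr
  calc M / g * (Real.exp (ρ.re * v) + Real.exp ((1 - ρ.re) * v))
      ≤ M / g * (Real.exp v * (Real.exp (-(2 * √(v / 9.646))) * (max g 40 / 8))
        + Real.exp v * Real.exp (-(v / 2))) := by gcongr
    _ = Real.exp v * (Real.exp (-(2 * √(v / 9.646))) * (M / g * (max g 40 / 8))
        + Real.exp (-(v / 2)) * (M / g)) := by ring
    _ ≤ Real.exp v * (Real.exp (-(2 * √(v / 9.646))) * ((M + 400 / g ^ 2) / 8)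
        + Real.exp (-(v / 2)) * (M / 5)) := by gcongr
    _ ≤ Real.exp v * (Real.exp (-(2 * √(v / 9.646))) * ((2 * (r / (r + g ^ 2)) + 400 / g ^ 2) / 8)
        + Real.exp (-(v / 2)) * (2 * (r / (r + g ^ 2)) / 5)) := by gcongr
    _ = _ := by ring

theorem pair_le {ρ : ℂ} (hρ : xiOrd ρ ≠ 0) {v r : ℝ} (hv : 0 ≤ v) (hr : 0 < r) :
    min 1 (r / ρ.im ^ 2) / |ρ.im| * (Real.exp (ρ.re * v) + Real.exp ((1 - ρ.re) * v))
      ≤ 2 * (Real.exp v * (Real.exp (-(2 * √(v / 9.646))) / 8 *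
        (r / (r + ρ.im ^ 2) + 200 * (1 / ρ.im ^ 2)) + Real.exp (-(v / 2)) / 5 *
          (r / (r + ρ.im ^ 2)))) := by
  rcases le_total (1 / 2) ρ.re with h | h
  · exact pair_le_of_half_le hρ h hv hr
  · have := pair_le_of_half_le (ρ := 1 - ρ) (by rwa [xiOrd_one_sub])
      (by rw [Complex.sub_re, Complex.one_re]; linarith) hv hr
    simpa [add_comm] using this

/-- The total contribution of the nontrivial zeros. -/
theorem abs_tsum_zero_le {h v : ℝ} (hh : 0 < h) (hv : 0 ≤ v) {b : ℝ} (hb : b = 2 / h) {N : ℝ}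
    (hN : (b + 1) * (1 / b + Real.log ((b + 3) / (2 * Real.pi)) / 2) ≤ N) :
    |∑' ρ : Function.support xiOrd, (xiOrd ρ : ℝ) *
          (Complex.exp (ρ * v) * (Complex.exp (ρ * h) - 1) ^ 2 / (ρ : ℂ) ^ 3).re|
      ≤ Real.exp v * h ^ 2 * (Real.exp (2 * h) * (Real.exp (-(2 * √(v / 9.646))) / 8 *
        (N + 11.24) + Real.exp (-(v / 2)) / 5 * N)) := by
  have hb0 : 0 < b := by rw [hb]; positivity
  set q : ℂ → ℝ := fun ρ =>
    (xiOrd ρ : ℝ) * (min 1 (b ^ 2 / ρ.im ^ 2) / |ρ.im| * Real.exp (ρ.re * v)) with hq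
  obtain ⟨s1, t1⟩ := tsum_xiOrd_mul_le hb0
  obtain ⟨s2, t2⟩ := tsum_xiOrd_div_im_sq_le
  have hq0 (ρ : ℂ) : 0 ≤ q ρ := by positivity
  have hqs : Summable q := by
    refine Summable.of_nonneg_of_le hq0 (fun ρ => ?_) (s2.mul_left (b ^ 2 * Real.exp v))
    by_cases h0 : xiOrd ρ = 0
    · simp [hq, h0]
    have h35 := im_sq_ge_of_xiOrd_ne_zero h0
    have h1 := re_lt_one_of_entireXi_eq_zero (entireXi_eq_zero_of_xiOrd_ne_zero h0)
    have hg5 : 1 ≤ |ρ.im| := by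
      rw [← sq_abs] at h35; nlinarith [abs_nonneg ρ.im]
    calc q ρ ≤ (xiOrd ρ : ℝ) * ((b ^ 2 / ρ.im ^ 2) * Real.exp v) := by
          refine mul_le_mul_of_nonneg_left (mul_le_mul ?_ ?_ ?_ ?_) (by positivity)
          · exact (div_le_self (by positivity) hg5).trans (min_le_right _ _)
          · exact Real.exp_le_exp.2 (by nlinarith)
          · positivity
          · positivity
      _ = _ := by ring
  have hterm (ρ : Function.support xiOrd) : ‖(xiOrd ρ : ℝ) *
          (Complex.exp (ρ * v) * (Complex.exp (ρ * h) - 1) ^ 2 / (ρ : ℂ) ^ 3).re‖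
      ≤ Real.exp (2 * h) * h ^ 2 * q ρ := by
    have h0 : xiOrd ρ ≠ 0 := ρ.2
    have h1 := re_lt_one_of_entireXi_eq_zero (entireXi_eq_zero_of_xiOrd_ne_zero h0)
    have h35 := im_sq_ge_of_xiOrd_ne_zero h0
    have hγ : (ρ : ℂ).im ≠ 0 := by rintro h; norm_num [h] at h35
    have hn := norm_exp_sub_one_sq_le hh h1.le hγ
    rw [← hb] at hn
    rw [norm_mul, Real.norm_natCast, mul_div_assoc]
    calc _ ≤ (xiOrd ρ : ℝ) * ‖Complex.exp (ρ * v) *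
            ((Complex.exp (ρ * h) - 1) ^ 2 / (ρ : ℂ) ^ 3)‖ := by
          gcongr; exact Complex.abs_re_le_norm _
      _ ≤ (xiOrd ρ : ℝ) * (Real.exp ((ρ : ℂ).re * v) * (Real.exp (2 * h) * h ^ 2 *
            (min 1 (b ^ 2 / (ρ : ℂ).im ^ 2) / |(ρ : ℂ).im|))) := by
          rw [norm_mul, Complex.norm_exp, Complex.re_mul_ofReal]; gcongr
      _ = _ := by rw [hq]; ring
  have hsub : ∑' ρ : Function.support xiOrd, q ρ = ∑' ρ, q ρ :=
    tsum_subtype_eq_of_support_subset fun ρ hρ => by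
      simp only [Function.mem_support, hq] at hρ ⊢
      exact fun h0 => hρ (by simp [h0])
  have hle : |∑' ρ : Function.support xiOrd, (xiOrd ρ : ℝ) *
          (Complex.exp (ρ * v) * (Complex.exp (ρ * h) - 1) ^ 2 / (ρ : ℂ) ^ 3).re|
      ≤ Real.exp (2 * h) * h ^ 2 * ∑' ρ, q ρ := by
    rw [← hsub, ← tsum_mul_left, ← Real.norm_eq_abs]
    exact tsum_of_norm_bounded ((hqs.subtype _).mul_left _).hasSum hterm
  refine hle.trans ?_
  let e : ℂ ≃ ℂ :=
    ⟨fun ρ => 1 - (starRingEnd ℂ) ρ, fun ρ => 1 - (starRingEnd ℂ) ρ, fun ρ => by simp,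
      fun ρ => by simp⟩
  have hsum := hqs.hasSum.add ((Equiv.hasSum_iff e).2 hqs.hasSum)
  have hB := (((s1.hasSum.add (s2.hasSum.mul_left 200)).mul_left
    (Real.exp (-(2 * √(v / 9.646))) / 8)).add
    (s1.hasSum.mul_left (Real.exp (-(v / 2)) / 5))).mul_left (2 * Real.exp v)
  have hcmp := hasSum_le (fun ρ => ?_) hsum hB
  · have hQ : ∑' ρ, q ρ ≤ Real.exp v * (Real.exp (-(2 * √(v / 9.646))) / 8 *
        (N + 11.24) + Real.exp (-(v / 2)) / 5 * N) := by
      have : Real.exp (-(2 * √(v / 9.646))) / 8 *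
          ((∑' ρ : ℂ, (xiOrd ρ : ℝ) * (b ^ 2 / (b ^ 2 + ρ.im ^ 2)))
            + 200 * ∑' ρ : ℂ, (xiOrd ρ : ℝ) / ρ.im ^ 2)
          + Real.exp (-(v / 2)) / 5 * (∑' ρ : ℂ, (xiOrd ρ : ℝ) * (b ^ 2 / (b ^ 2 + ρ.im ^ 2)))
          ≤ Real.exp (-(2 * √(v / 9.646))) / 8 * (N + 11.24) + Real.exp (-(v / 2)) / 5 * N := by
        gcongr <;> linarith
      have := mul_le_mul_of_nonneg_left this (Real.exp_pos v).le
      linarith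
    calc _ ≤ Real.exp (2 * h) * h ^ 2 * _ := mul_le_mul_of_nonneg_left hQ (by positivity)
      _ = _ := by ring
  · by_cases h0 : xiOrd ρ = 0
    · simp [hq, e, h0, xiOrd_one_sub, xiOrd_conj]
    have hp := pair_le h0 hv (by positivity : 0 < b ^ 2)
    have := mul_le_mul_of_nonneg_left hp (Nat.cast_nonneg (α := ℝ) (xiOrd ρ))
    simp only [hq, e, Function.comp, Equiv.coe_fn_mk, xiOrd_one_sub, xiOrd_conj, Complex.sub_im,
      Complex.one_im, Complex.conj_im, zero_sub, neg_neg, Complex.sub_re, Complex.one_re,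
      Complex.conj_re]
    calc _ = (xiOrd ρ : ℝ) * (min 1 (b ^ 2 / ρ.im ^ 2) / |ρ.im|
          * (Real.exp (ρ.re * v) + Real.exp ((1 - ρ.re) * v))) := by ring
      _ ≤ _ := this
      _ = _ := by ring

/-- Upper bound for `ψ` in terms of the smoothing parameter `h`. -/
theorem psi_exp_le {h v : ℝ} (hh : 0 < h) (hv : 1 / 2 ≤ v) {b : ℝ} (hb : b = 2 / h) {N : ℝ}
    (hN : (b + 1) * (1 / b + Real.log ((b + 3) / (2 * Real.pi)) / 2) ≤ N) :
    Chebyshev.psi (Real.exp v) ≤ Real.exp v * (((Real.exp h - 1) / h) ^ 2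
      + Real.exp (2 * h) * (Real.exp (-(2 * √(v / 9.646))) / 8 *
        (N + 11.24) + Real.exp (-(v / 2)) / 5 * N)) := by
  have h1 := sq_mul_psi_le_secondDiff hh.le v
  rw [secondDiff_psiTwo_eq hh.le (by linarith)] at h1
  have h2 := (abs_le.1 (abs_tsum_zero_le hh (by linarith : 0 ≤ v) hb hN)).1
  have h3 := (tsum_trivialZero_le hh.le hv).2
  refine le_of_mul_le_mul_left (a := h ^ 2) ?_ (by positivity)
  have e : h ^ 2 * (Real.exp v * (((Real.exp h - 1) / h) ^ 2
      + Real.exp (2 * h) * (Real.exp (-(2 * √(v / 9.646))) / 8 *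
        (N + 11.24) + Real.exp (-(v / 2)) / 5 * N)))
      = Real.exp v * (Real.exp h - 1) ^ 2 + Real.exp v * h ^ 2 * (Real.exp (2 * h) *
        (Real.exp (-(2 * √(v / 9.646))) / 8 * (N + 11.24) + Real.exp (-(v / 2)) / 5 * N)) := by
    field_simp
  rw [e]
  linarith

/-- Lower bound for `ψ` in terms of the smoothing parameter `h`. -/
theorem le_psi_exp {h v : ℝ} (hh : 0 < h) (hv : 1 / 2 ≤ v) {b : ℝ} (hb : b = 2 / h) {N : ℝ}
    (hN : (b + 1) * (1 / b + Real.log ((b + 3) / (2 * Real.pi)) / 2) ≤ N) :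
    Real.exp v * (((Real.exp h - 1) / h) ^ 2
      - Real.exp (2 * h) * (Real.exp (-(2 * √(v / 9.646))) / 8 *
        (N + 11.24) + Real.exp (-(v / 2)) / 5 * N)) - Real.log (2 * Real.pi)
      ≤ Chebyshev.psi (Real.exp (v + 2 * h)) := by
  have h1 := secondDiff_le_sq_mul_psi hh.le v
  rw [secondDiff_psiTwo_eq hh.le (by linarith)] at h1
  have h2 := (abs_le.1 (abs_tsum_zero_le hh (by linarith : 0 ≤ v) hb hN)).2
  have h3 := (tsum_trivialZero_le hh.le hv).1
  refine le_of_mul_le_mul_left (a := h ^ 2) ?_ (by positivity)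
  have e : h ^ 2 * (Real.exp v * (((Real.exp h - 1) / h) ^ 2
      - Real.exp (2 * h) * (Real.exp (-(2 * √(v / 9.646))) / 8 *
        (N + 11.24) + Real.exp (-(v / 2)) / 5 * N)) - Real.log (2 * Real.pi))
      = Real.exp v * (Real.exp h - 1) ^ 2 - Real.exp v * h ^ 2 * (Real.exp (2 * h) *
        (Real.exp (-(2 * √(v / 9.646))) / 8 * (N + 11.24) + Real.exp (-(v / 2)) / 5 * N))
        - Real.log (2 * Real.pi) * h ^ 2 := by
    field_simp
  rw [e]
  linarith

end

theorem mul_exp_neg_le {a X : ℝ} (ha : 1 / 2 ≤ a) (hX : a ≤ X) :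
    X * Real.exp (-(2 * X)) ≤ a * Real.exp (-(2 * a)) := by
  have h := Real.add_one_le_exp (2 * (X - a))
  have e : Real.exp (-(2 * a)) = Real.exp (2 * (X - a)) * Real.exp (-(2 * X)) := by
    rw [← Real.exp_add]; ring_nf
  rw [e, ← mul_assoc]
  refine mul_le_mul_of_nonneg_right ?_ (Real.exp_pos _).le
  nlinarith

theorem exp_numeric_bounds : 264 ≤ Real.exp 5.576 ∧ 16.2 ≤ Real.exp 2.788 ∧
    2980 ≤ Real.exp 8 ∧ Real.exp 0.6 ≤ 1.825 := by
  have h1 := Real.exp_one_gt_d9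
  have a : Real.exp 5.576 = Real.exp 1 ^ 5 * Real.exp 0.576 := by
    rw [← Real.exp_nat_mul, ← Real.exp_add]; norm_num
  have b : Real.exp 2.788 = Real.exp 1 ^ 2 * Real.exp 0.788 := by
    rw [← Real.exp_nat_mul, ← Real.exp_add]; norm_num
  have c : Real.exp 8 = Real.exp 1 ^ 8 := by
    rw [← Real.exp_nat_mul]; norm_num
  have h5 : (148.4131 : ℝ) ≤ Real.exp 1 ^ 5 :=
    le_trans (by norm_num) (pow_le_pow_left₀ (by norm_num) h1.le 5)
  have h2 : (7.389 : ℝ) ≤ Real.exp 1 ^ 2 :=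
    le_trans (by norm_num) (pow_le_pow_left₀ (by norm_num) h1.le 2)
  have h8 : (2980 : ℝ) ≤ Real.exp 1 ^ 8 :=
    le_trans (by norm_num) (pow_le_pow_left₀ (by norm_num) h1.le 8)
  have l1 := Real.sum_le_exp_of_nonneg (x := 0.576) (by norm_num) 6
  have l2 := Real.sum_le_exp_of_nonneg (x := 0.788) (by norm_num) 6
  have l3 := Real.exp_bound' (x := 0.6) (by norm_num) (by norm_num) (n := 6) (by norm_num)
  norm_num [Finset.sum_range_succ, Nat.factorial] at l1 l2 l3
  refine ⟨?_, ?_, c ▸ h8, by linarith⟩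
  · rw [a]
    calc (264 : ℝ) ≤ 148.4131 * 1.77884 := by norm_num
      _ ≤ _ := by gcongr; norm_num; linarith
  · rw [b]
    calc (16.2 : ℝ) ≤ 7.389 * 2.1975 := by norm_num
      _ ≤ _ := by gcongr; norm_num; linarith

/-- The optimised error term for the smoothing argument. -/
theorem smoothing_error_le {X y : ℝ} (hX : 2.788 ≤ X) (hy : y = √X * Real.exp (-X)) {h b N : ℝ}
    (hh : h = 0.38 * y) (hb : b = 2 / h)
    (hN : N = (b + 1) * (1 / b + Real.log ((b + 3) / (2 * Real.pi)) / 2)) :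
    0 < h ∧ h ≤ 0.0391 ∧ 1.03 * h + Real.exp (2 * h) *
      (Real.exp (-(2 * X)) / 8 * (N + 11.24)) ≤ 0.764 * y ∧ 
    0 ≤ N ∧ Real.exp (2 * h) * N ≤ 4 * Real.exp (2 * X) := by
  obtain ⟨e1, e2, e3, e4⟩ := exp_numeric_bounds
  set s := √X with hs
  set q := Real.exp (-X) with hq
  have hs2 : s ^ 2 = X := Real.sq_sqrt (by linarith)
  have hs1 : 1.6697 ≤ s := Real.le_sqrt_of_sq_le (by norm_num; linarith)
  have hq0 : 0 < q := Real.exp_pos _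
  have hq2 : Real.exp (-(2 * X)) = q ^ 2 := by rw [hq, ← Real.exp_nat_mul]; push_cast; ring_nf
  have hy0 : 0 < y := by rw [hy]; positivity
  have hy2 : y ^ 2 = X * Real.exp (-(2 * X)) := by rw [hy, mul_pow, hs2, hq2]
  have hy1 : y ≤ 0.1028 := by
    have := mul_exp_neg_le (by norm_num) hX
    rw [← hy2, Real.exp_neg, show (2 * 2.788 : ℝ) = 5.576 by norm_num] at this
    have h2 : (Real.exp 5.576)⁻¹ ≤ 264⁻¹ := by gcongr
    nlinarith
  have hh0 : 0 < h := by rw [hh]; positivity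
  have hb0 : 0 < b := by rw [hb]; positivity
  have hQ1 : q ≤ 1 / 16.2 := by
    rw [hq, Real.exp_neg, one_div]; gcongr; exact e2.trans (Real.exp_le_exp.2 hX)
  set ℓ := Real.log ((b + 3) / (2 * Real.pi)) with hℓ
  have hbv : b * (0.19 * (s * q)) = 1 := by rw [hb, hh, hy]; field_simp; norm_num
  have hℓ1 : ℓ ≤ X - 0.6 := by
    rw [hℓ, Real.log_le_iff_le_exp (by positivity), div_le_iff₀ (by positivity), Real.exp_sub]
    have : Real.exp X = q⁻¹ := by rw [hq, Real.exp_neg, inv_inv]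
    rw [this, ← one_div, div_div, div_mul_eq_mul_div, le_div_iff₀ (by positivity)]
    have b1 : b * q ≤ 3.1523 := by
      have : b * q * (0.19 * 1.6697) ≤ b * q * (0.19 * s) := by gcongr
      nlinarith
    have b2 : (b + 3) * q ≤ 3.338 := by linarith
    have := Real.pi_gt_d2
    calc (b + 3) * (q * Real.exp 0.6) = (b + 3) * q * Real.exp 0.6 := by ring
      _ ≤ 3.338 * 1.825 := by gcongr
      _ ≤ _ := by linarith
  have hℓ0 : 0 ≤ ℓ := by
    apply Real.log_nonneg
    rw [one_le_div (by positivity)]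
    have : 1 ≤ b * (0.19 * 0.1028) := by
      rw [← hbv, ← hy]; gcongr
    have := Real.pi_lt_d2
    linarith
  have hX0 : 0 < X := by linarith
  have hid : q ^ 2 / 8 * (N + 11.24)
      = y * ((1 + 0.19 * y) * (ℓ / X) / 3.04 + y / X * (12.24 + 0.19 * y) / 8) := by
    have hb' : b = 1 / (0.19 * (s * q)) := by rw [eq_div_iff (by positivity)]; exact hbv
    rw [hN, hb', hy, ← hs2]
    field_simp
    ring
  have hexp : Real.exp (2 * h) ≤ 1 / (1 - 2 * h) :=
    Real.exp_bound_div_one_sub_of_interval (by linarith) (by linarith)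
  have hNn : 0 ≤ N := by rw [hN]; positivity
  have main : 1.03 * h + Real.exp (2 * h) * (q ^ 2 / 8 * (N + 11.24)) ≤ 0.764 * y := by
    rw [hid]
    rcases le_total X 4 with h4 | h4
    · have c1 : ℓ / X ≤ 0.85 := by rw [div_le_iff₀ hX0]; linarith
      have c2 : y / X ≤ 0.1028 / 2.788 := by gcongr
      have c3 : Real.exp (2 * h) ≤ 1.085 := hexp.trans (by
        rw [div_le_iff₀ (by linarith)]; linarith)
      calc _ ≤ 1.03 * h + 1.085 * (y * ((1 + 0.19 * 0.1028) * 0.85 / 3.04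
            + 0.1028 / 2.788 * (12.24 + 0.19 * 0.1028) / 8)) := by gcongr
        _ ≤ _ := by rw [hh]; clear * - hy0; linarith
    · have hy3 : y ≤ 0.0367 := by
        have := mul_exp_neg_le (by norm_num) h4
        rw [← hy2, Real.exp_neg, show (2 * 4 : ℝ) = 8 by norm_num] at this
        have h2 : (Real.exp 8)⁻¹ ≤ 2980⁻¹ := by gcongr
        nlinarith
      have c1 : ℓ / X ≤ 1 := by rw [div_le_iff₀ hX0]; linarith
      have c2 : y / X ≤ 0.0367 / 4 := by gcongr
      have c3 : Real.exp (2 * h) ≤ 1.03 := hexp.trans (by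
        rw [div_le_iff₀ (by linarith)]; linarith)
      calc _ ≤ 1.03 * h + 1.03 * (y * ((1 + 0.19 * 0.0367) * 1 / 3.04
            + 0.0367 / 4 * (12.24 + 0.19 * 0.0367) / 8)) := by gcongr
        _ ≤ _ := by rw [hh]; clear * - hy0; linarith
  refine ⟨hh0, by linarith, by rw [hq2]; exact main, hNn, ?_⟩
  have : Real.exp (2 * X) = (q ^ 2)⁻¹ := by rw [← hq2, Real.exp_neg, inv_inv]
  rw [this, ← div_eq_mul_inv, le_div_iff₀ (by positivity)]
  have : 0 ≤ Real.exp (2 * h) * q ^ 2 := by positivity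
  nlinarith

theorem sq_exp_sub_one_div_le {h : ℝ} (h0 : 0 < h) (h1 : h ≤ 0.0391) :
    ((Real.exp h - 1) / h) ^ 2 ≤ 1 + 1.03 * h := by
  have l := Real.exp_bound' (x := h) h0.le (by linarith) (n := 3) (by norm_num)
  norm_num [Finset.sum_range_succ, Nat.factorial] at l
  have : (Real.exp h - 1) / h ≤ 1 + h / 2 + h ^ 2 * (2 / 9) := by
    rw [div_le_iff₀ h0]; nlinarith
  have h2 : 0 ≤ (Real.exp h - 1) / h := div_nonneg (by linarith [Real.add_one_le_exp h]) h0.le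
  calc _ ≤ (1 + h / 2 + h ^ 2 * (2 / 9)) ^ 2 := by gcongr
    _ ≤ _ := by nlinarith [mul_pos h0 h0, pow_pos h0 3, mul_pos h0 (mul_pos h0 h0)]

theorem le_sq_exp_sub_one_div {h : ℝ} (h0 : 0 < h) (h1 : h ≤ 0.0391) :
    1 - h ≤ Real.exp (-(2 * h)) * ((Real.exp h - 1) / h) ^ 2 := by
  have e : Real.exp (-(2 * h)) * ((Real.exp h - 1) / h) ^ 2
      = ((1 - Real.exp (-h)) / h) ^ 2 := by
    rw [show -(2 * h) = -h + -h by ring, Real.exp_add, Real.exp_neg]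
    have := Real.exp_ne_zero h
    field_simp
  rw [e]
  have l := Real.quadratic_le_exp_of_nonneg h0.le
  have : Real.exp (-h) ≤ 1 - h + h ^ 2 / 2 := by
    rw [Real.exp_neg, inv_le_iff_one_le_mul₀ (Real.exp_pos _)]
    have : 0 ≤ 1 - h + h ^ 2 / 2 := by nlinarith
    nlinarith [sq_nonneg (h ^ 2)]
  have h2 : 1 - h / 2 ≤ (1 - Real.exp (-h)) / h := by rw [le_div_iff₀ h0]; nlinarith
  calc 1 - h ≤ (1 - h / 2) ^ 2 := by nlinarith
    _ ≤ _ := by gcongr; linarith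

/-- The relative error allowed for `θ x`, as a function of `L = log x`. -/
noncomputable def thetaErr (L : ℝ) : ℝ :=
  0.4394 * L ^ (1 / 4 : ℝ) * Real.exp (-√(L / 9.646))

theorem smoothing_le_thetaErr {L X : ℝ} (hL : 0 ≤ L) (hX : X = √(L / 9.646)) :
    0.774 * (√X * Real.exp (-X)) ≤ thetaErr L := by
  rw [thetaErr, ← hX, ← mul_assoc]
  refine mul_le_mul_of_nonneg_right ?_ (Real.exp_pos _).le
  have hX0 : 0 ≤ X := hX ▸ Real.sqrt_nonneg _
  have h1 : √X ^ 4 * 9.646 = L := by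
    rw [show √X ^ 4 = (√X ^ 2) ^ 2 by ring, Real.sq_sqrt hX0, hX, Real.sq_sqrt (by positivity)]
    ring
  have h2 : (L ^ (1 / 4 : ℝ)) ^ 4 = L := by
    rw [← Real.rpow_natCast, ← Real.rpow_mul hL]; norm_num
  have h3 : 1.7622 * √X ≤ L ^ (1 / 4 : ℝ) := by
    refine le_of_pow_le_pow_left₀ (n := 4) (by norm_num) (by positivity) ?_
    rw [h2, ← h1, mul_pow, mul_comm]
    gcongr; norm_num
  have := Real.sqrt_nonneg X
  linarith

theorem large_tail_le {L X : ℝ} (hX : 2.788 ≤ X) (hL : L = 9.646 * X ^ 2) :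
    4 / 5 * Real.exp (2 * X - L / 2) + 2 * Real.exp (-L) + 2 * L * Real.exp (-(L / 2))
      ≤ 0.01 * (√X * Real.exp (-X)) := by
  have e3 := exp_numeric_bounds.2.2.1
  have hL2 : 26.8 * X ≤ L := by rw [hL]; nlinarith
  have hs1 : 1.6697 ≤ √X := Real.le_sqrt_of_sq_le (by norm_num; linarith)
  have key {u : ℝ} (hu : u ≤ -X - 8) : Real.exp u ≤ Real.exp (-X) * 2980⁻¹ := by
    calc Real.exp u ≤ Real.exp (-X - 8) := Real.exp_le_exp.2 hu
      _ = Real.exp (-X) * (Real.exp 8)⁻¹ := by rw [Real.exp_sub, div_eq_mul_inv]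
      _ ≤ _ := by gcongr
  have h1 := key (u := 2 * X - L / 2) (by linarith)
  have h2 := key (u := -L) (by linarith)
  have h3 := key (u := -(L / 4)) (by linarith)
  have h4 : 2 * L * Real.exp (-(L / 2)) ≤ 8 * Real.exp (-(L / 4)) := by
    have : Real.exp (-(L / 4)) = Real.exp (L / 4) * Real.exp (-(L / 2)) := by
      rw [← Real.exp_add]; ring_nf
    rw [this, ← mul_assoc]
    exact mul_le_mul_of_nonneg_right (by linarith [Real.add_one_le_exp (L / 4)])
      (Real.exp_pos _).le
  have h5 : 1.6697 * Real.exp (-X) ≤ √X * Real.exp (-X) := by gcongr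
  have := Real.exp_pos (-X)
  linarith

theorem sqrt_sub_ge {L h : ℝ} (hL : 75 ≤ L) (h0 : 0 ≤ h) (h1 : h ≤ 1) :
    √(L / 9.646) - h / 2 ≤ √((L - 2 * h) / 9.646) := by
  have hX : 2.788 ≤ √(L / 9.646) := Real.le_sqrt_of_sq_le (by norm_num; linarith)
  have h2 : √(L / 9.646) ^ 2 = L / 9.646 := Real.sq_sqrt (by positivity)
  apply Real.le_sqrt_of_sq_le
  rw [sub_div, ← h2, Real.sqrt_sq (by linarith)]
  generalize √(L / 9.646) = s at hX
  have a1 : h * 2.788 ≤ h * s := mul_le_mul_of_nonneg_left hX h0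
  have a2 : h * h ≤ h * 1 := mul_le_mul_of_nonneg_left h1 h0
  have a3 : (s - h / 2) ^ 2 = s ^ 2 - h * s + h * h / 4 := by ring
  have a4 : 2 * h / 9.646 ≤ h := by rw [div_le_iff₀ (by norm_num)]; linarith
  rw [a3]
  linarith

theorem abs_theta_sub_le_of_large {x : ℝ} (hx0 : 0 < x) (hx : 75 ≤ Real.log x) :
    |Chebyshev.theta x - x| ≤ thetaErr (Real.log x) * x := by
  set L := Real.log x with hL
  have hxe : Real.exp L = x := Real.exp_log hx0
  set X := √(L / 9.646) with hXd
  have hX : 2.788 ≤ X := Real.le_sqrt_of_sq_le (by norm_num; linarith)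
  have hLX : L = 9.646 * X ^ 2 := by
    rw [hXd, Real.sq_sqrt (by positivity)]; ring
  obtain ⟨h, hh⟩ : ∃ h, h = 0.38 * (√X * Real.exp (-X)) := ⟨_, rfl⟩
  obtain ⟨b, hb⟩ : ∃ b, b = 2 / h := ⟨_, rfl⟩
  obtain ⟨N, hN⟩ : ∃ N, N = (b + 1) * (1 / b + Real.log ((b + 3) / (2 * Real.pi)) / 2) := ⟨_, rfl⟩
  obtain ⟨h0, h1, hmain, hN0, hNe⟩ := smoothing_error_le hX rfl hh hb hN
  have htail := large_tail_le hX hLX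
  have hfin := smoothing_le_thetaErr (by linarith : 0 ≤ L) hXd
  have hT : Real.exp (2 * h) * (Real.exp (-(L / 2)) / 5 * N)
      ≤ 4 / 5 * Real.exp (2 * X - L / 2) := by
    have e : Real.exp (2 * X - L / 2) = Real.exp (2 * X) * Real.exp (-(L / 2)) := by
      rw [← Real.exp_add]; ring_nf
    rw [e]
    have := Real.exp_pos (-(L / 2))
    nlinarith
  have hup := psi_exp_le h0 (by linarith : 1 / 2 ≤ L) hb hN.ge
  have hlo := le_psi_exp h0 (by linarith : 1 / 2 ≤ L - 2 * h) hb hN.ge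
  rw [hxe, ← hXd] at hup
  rw [show L - 2 * h + 2 * h = L by ring, hxe] at hlo
  have htail' : 0 ≤ 2 * Real.exp (-L) + 2 * L * Real.exp (-(L / 2)) := by positivity
  rw [abs_le]
  constructor
  · have g1 := le_sq_exp_sub_one_div h0 h1
    have g2 : Real.exp (-(2 * √((L - 2 * h) / 9.646))) ≤ Real.exp h * Real.exp (-(2 * X)) := by
      rw [← Real.exp_add]
      exact Real.exp_le_exp.2 (by linarith [sqrt_sub_ge hx h0.le (by linarith)])
    have g3 : Real.exp (-((L - 2 * h) / 2)) = Real.exp h * Real.exp (-(L / 2)) := by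
      rw [← Real.exp_add]; ring_nf
    have g4 : Real.exp (L - 2 * h) = x * Real.exp (-(2 * h)) := by
      rw [← hxe, ← Real.exp_add]; ring_nf
    have g5 : Real.exp (-(2 * h)) * Real.exp (2 * h) = 1 := by
      rw [← Real.exp_add]; simp
    have g6 : Real.exp (-(2 * √((L - 2 * h) / 9.646))) / 8 * (N + 11.24)
        + Real.exp (-((L - 2 * h) / 2)) / 5 * N
        ≤ Real.exp (2 * h) * (Real.exp (-(2 * X)) / 8 * (N + 11.24)
          + Real.exp (-(L / 2)) / 5 * N) := by
      rw [g3]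
      calc _ ≤ Real.exp h * Real.exp (-(2 * X)) / 8 * (N + 11.24)
            + Real.exp h * Real.exp (-(L / 2)) / 5 * N := by gcongr
        _ = Real.exp h * (Real.exp (-(2 * X)) / 8 * (N + 11.24)
            + Real.exp (-(L / 2)) / 5 * N) := by ring
        _ ≤ _ := by gcongr; linarith
    have g7 : x * (1 - h - Real.exp (2 * h) * (Real.exp (-(2 * X)) / 8 * (N + 11.24)
          + Real.exp (-(L / 2)) / 5 * N)) ≤ Chebyshev.psi x + Real.log (2 * Real.pi) := by
      rw [← sub_le_iff_le_add]
      refine le_trans ?_ hlo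
      rw [g4, mul_assoc, mul_sub (Real.exp (-(2 * h))), ← mul_assoc (Real.exp (-(2 * h)))
        (Real.exp (2 * h)), g5, one_mul]
      gcongr
    have g8 : Real.log (2 * Real.pi) ≤ 2 := by
      rw [Real.log_le_iff_le_exp (by positivity), show (2 : ℝ) = 1 + 1 by norm_num, Real.exp_add]
      nlinarith [Real.exp_one_gt_d9, Real.pi_lt_d2]
    have g9 := Chebyshev.psi_sub_theta_le (x := x) (by rw [← hxe]; exact Real.one_le_exp (by linarith))
    have g10 : √x = x * Real.exp (-(L / 2)) := by
      have : √x = Real.exp (L / 2) := by rw [Real.exp_half, hxe]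
      rw [this, ← hxe, ← Real.exp_add]; ring_nf
    have g11 : (2 : ℝ) = x * (2 * Real.exp (-L)) := by
      rw [Real.exp_neg, hxe]; field_simp
    rw [g10, ← hL] at g9
    have : x * (h + Real.exp (2 * h) * (Real.exp (-(2 * X)) / 8 * (N + 11.24)
          + Real.exp (-(L / 2)) / 5 * N) + 2 * Real.exp (-L) + 2 * L * Real.exp (-(L / 2)))
          ≤ x * thetaErr L := by
      refine mul_le_mul_of_nonneg_left ?_ hx0.le
      rw [mul_add]
      linarith
    linarith
  · have : x * (((Real.exp h - 1) / h) ^ 2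
      + Real.exp (2 * h) * (Real.exp (-(2 * X)) / 8 * (N + 11.24) + Real.exp (-(L / 2)) / 5 * N))
      ≤ x * (1 + thetaErr L) := by
      refine mul_le_mul_of_nonneg_left ?_ hx0.le
      rw [mul_add]
      linarith [sq_exp_sub_one_div_le h0 h1]
    linarith [Chebyshev.theta_le_psi x]

section ChebyshevBounds
open Finset

/-- Chebyshev's alternating combination `log (n! ⌊n/30⌋! / (⌊n/2⌋! ⌊n/3⌋! ⌊n/5⌋!))`. -/
noncomputable def chebyshevSum (n : ℕ) : ℝ :=
  Real.log n.factorial - Real.log (n / 2).factorial - Real.log (n / 3).factorial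
    - Real.log (n / 5).factorial + Real.log (n / 30).factorial

theorem log_factorial_eq_sum_vonMangoldt (n : ℕ) :
    Real.log n.factorial = ∑ d ∈ Ioc 0 n, ArithmeticFunction.vonMangoldt d * ((n / d : ℕ) : ℝ) := by
  rw [← ArithmeticFunction.sum_Ioc_mul_zeta_eq_sum, ArithmeticFunction.vonMangoldt_mul_zeta]
  induction n with
  | zero => simp
  | succ n ih =>
    rw [Nat.factorial_succ, Nat.cast_mul, Real.log_mul (by positivity) (by positivity), ih,
      ← Finset.insert_Ioc_right_eq_Ioc_add_one (by omega : 0 ≤ n), sum_insert (by simp)]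
    simp [ArithmeticFunction.log_apply]

theorem log_factorial_div_eq_sum_vonMangoldt (n k : ℕ) :
    Real.log (n / k).factorial
      = ∑ d ∈ Ioc 0 n, ArithmeticFunction.vonMangoldt d * ((n / d / k : ℕ) : ℝ) := by
  rw [log_factorial_eq_sum_vonMangoldt]
  refine Eq.trans (sum_congr rfl fun d _ ↦ ?_)
    (sum_subset (Ioc_subset_Ioc_right (Nat.div_le_self n k)) fun d hd hd' ↦ ?_)
  · rw [Nat.div_div_eq_div_mul, Nat.div_div_eq_div_mul, mul_comm k]
  · simp only [mem_Ioc, not_and, not_le] at hd hd'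
    have : n / k / d = 0 := Nat.div_eq_of_lt (hd' hd.1)
    rw [Nat.div_div_eq_div_mul, mul_comm d, ← Nat.div_div_eq_div_mul, this]
    simp

theorem chebyshevSum_eq (n : ℕ) :
    chebyshevSum n = ∑ d ∈ Ioc 0 n, ArithmeticFunction.vonMangoldt d *
      (((n / d : ℕ) : ℝ) - (n / d / 2 : ℕ) - (n / d / 3 : ℕ) - (n / d / 5 : ℕ)
        + (n / d / 30 : ℕ)) := by
  rw [chebyshevSum, log_factorial_eq_sum_vonMangoldt,
    log_factorial_div_eq_sum_vonMangoldt n 2,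
    log_factorial_div_eq_sum_vonMangoldt n 3,
    log_factorial_div_eq_sum_vonMangoldt n 5,
    log_factorial_div_eq_sum_vonMangoldt n 30]
  simp only [← sum_sub_distrib, ← sum_add_distrib]
  exact sum_congr rfl fun d _ ↦ by ring

theorem psi_div_eq_sum (x : ℝ) {k : ℕ} (hk : 0 < k) :
    Chebyshev.psi (x / k) = ∑ d ∈ Ioc 0 ⌊x⌋₊, ArithmeticFunction.vonMangoldt d *
      (if k ≤ ⌊x⌋₊ / d then 1 else 0) := by
  rw [Chebyshev.psi, Nat.floor_div_natCast]
  simp only [mul_ite, mul_one, mul_zero, ← sum_filter]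
  refine sum_congr (ext fun d ↦ ?_) fun _ _ ↦ rfl
  simp only [mem_Ioc, mem_filter]
  constructor
  · rintro ⟨h1, h2⟩
    have := (Nat.le_div_iff_mul_le hk).1 h2
    exact ⟨⟨h1, le_trans (Nat.le_mul_of_pos_right d hk) this⟩,
      (Nat.le_div_iff_mul_le h1).2 (by linarith [mul_comm d k])⟩
  · rintro ⟨⟨h1, _⟩, h3⟩
    have := (Nat.le_div_iff_mul_le h1).1 h3
    exact ⟨h1, (Nat.le_div_iff_mul_le hk).2 (by linarith [mul_comm d k])⟩

theorem chebyshevSum_le_psi (x : ℝ) : chebyshevSum ⌊x⌋₊ ≤ Chebyshev.psi x := by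
  rw [chebyshevSum_eq, Chebyshev.psi]
  refine sum_le_sum fun d _ ↦ mul_le_of_le_one_right ArithmeticFunction.vonMangoldt_nonneg ?_
  generalize ⌊x⌋₊ / d = m
  have : m + m / 30 ≤ 1 + m / 2 + m / 3 + m / 5 := by omega
  have : (m : ℝ) + (m / 30 : ℕ) ≤ 1 + (m / 2 : ℕ) + (m / 3 : ℕ) + (m / 5 : ℕ) := by
    exact_mod_cast this
  linarith

theorem psi_le_chebyshevSum_add (x : ℝ) :
    Chebyshev.psi x + Chebyshev.psi (x / 7)
      ≤ chebyshevSum ⌊x⌋₊ + Chebyshev.psi (x / 6) + Chebyshev.psi (x / 10) := by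
  have h1 := psi_div_eq_sum x one_pos
  have h6 := psi_div_eq_sum x (by norm_num : 0 < 6)
  have h7 := psi_div_eq_sum x (by norm_num : 0 < 7)
  have h10 := psi_div_eq_sum x (by norm_num : 0 < 10)
  norm_num only [Nat.cast_one, Nat.cast_ofNat, div_one] at h1 h6 h7 h10
  rw [h1, h6, h7, h10, chebyshevSum_eq, ← sum_add_distrib, ← sum_add_distrib, ← sum_add_distrib]
  refine sum_le_sum fun d _ ↦ ?_
  simp only [← mul_add]
  refine mul_le_mul_of_nonneg_left ?_ ArithmeticFunction.vonMangoldt_nonneg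
  generalize ⌊x⌋₊ / d = m
  have : (if 1 ≤ m then 1 else 0) + (if 7 ≤ m then 1 else 0) + (m / 2 + m / 3 + m / 5)
      ≤ m + m / 30 + (if 6 ≤ m then 1 else 0) + (if 10 ≤ m then 1 else 0) := by
    split_ifs <;> omega
  have : (if 1 ≤ m then (1 : ℝ) else 0) + (if 7 ≤ m then 1 else 0)
      + ((m / 2 : ℕ) + (m / 3 : ℕ) + (m / 5 : ℕ))
      ≤ m + (m / 30 : ℕ) + (if 6 ≤ m then 1 else 0) + (if 10 ≤ m then 1 else 0) := by
    exact_mod_cast this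
  linarith

theorem psi_le_chebyshevSum_add_psi_div_six (x : ℝ) (hx : 0 ≤ x) :
    Chebyshev.psi x ≤ chebyshevSum ⌊x⌋₊ + Chebyshev.psi (x / 6) := by
  have h : Chebyshev.psi (x / 10) ≤ Chebyshev.psi (x / 7) :=
    Chebyshev.psi_mono (by linarith)
  linarith [psi_le_chebyshevSum_add x]

theorem log_factorial_le {n : ℕ} (hn : n ≠ 0) :
    Real.log n.factorial ≤ n * Real.log n - n + 1 + Real.log n := by
  induction n with
  | zero => exact absurd rfl hn
  | succ n ih =>
    rcases eq_or_ne n 0 with rfl | h0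
    · simp
    · have h1 := ih h0
      have hn0 : (0 : ℝ) < n := by positivity
      have h2 := Real.log_le_sub_one_of_pos (show 0 < (n : ℝ) / (n + 1) by positivity)
      rw [Real.log_div (by positivity) (by positivity)] at h2
      have h3 : ((n : ℝ) + 1) * (Real.log n - Real.log (n + 1)) ≤ -1 := by
        calc _ ≤ ((n : ℝ) + 1) * (n / (n + 1) - 1) := by gcongr
          _ = -1 := by field_simp; ring
      rw [Nat.factorial_succ, Nat.cast_mul, Real.log_mul (by positivity) (by positivity)]
      push_cast
      linarith

theorem log_factorial_floor_le {y : ℝ} (hy : 0 < y) :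
    Real.log ⌊y⌋₊.factorial ≤ y * Real.log y - y + 1 + max (Real.log y) 0 := by
  rcases lt_or_ge y 1 with h | h
  · have h1 : -Real.log y ≤ y⁻¹ - 1 := by
      simpa [Real.log_inv] using Real.log_le_sub_one_of_pos (inv_pos.2 hy)
    have h2 : y * -Real.log y ≤ y * (y⁻¹ - 1) := by gcongr
    rw [mul_sub, mul_inv_cancel₀ hy.ne'] at h2
    rw [Nat.floor_eq_zero.2 h]
    simp only [Nat.factorial_zero, Nat.cast_one, Real.log_one]
    linarith [le_max_right (Real.log y) 0]
  · have hn : ⌊y⌋₊ ≠ 0 := (Nat.floor_pos.2 h).ne'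
    have h1 := log_factorial_le hn
    have hny : (⌊y⌋₊ : ℝ) ≤ y := Nat.floor_le hy.le
    have hn1 : (1 : ℝ) ≤ ⌊y⌋₊ := by exact_mod_cast Nat.floor_pos.2 h
    have h2 := Real.log_le_sub_one_of_pos (show 0 < (⌊y⌋₊ : ℝ) / y by positivity)
    rw [Real.log_div (by positivity) (by positivity)] at h2
    have h3 : y * (Real.log ⌊y⌋₊ - Real.log y) ≤ ⌊y⌋₊ - y := by
      calc _ ≤ y * ((⌊y⌋₊ : ℝ) / y - 1) := by gcongr
        _ = _ := by field_simp
    have h4 : Real.log ⌊y⌋₊ ≤ Real.log y := Real.log_le_log (by positivity) hny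
    have h5 : 0 ≤ Real.log ⌊y⌋₊ := Real.log_nonneg hn1
    have h6 : 0 ≤ (y - ⌊y⌋₊) * Real.log ⌊y⌋₊ := mul_nonneg (by linarith) h5
    linarith [le_max_left (Real.log y) 0]

theorem le_log_factorial_floor {y : ℝ} (hy : 0 < y) :
    y * Real.log y - y - max (Real.log y) 0 ≤ Real.log ⌊y⌋₊.factorial := by
  rcases lt_or_ge y 1 with h | h
  · rw [Nat.floor_eq_zero.2 h]
    have h1 : y * Real.log y ≤ 0 := mul_nonpos_of_nonneg_of_nonpos hy.le
      (Real.log_nonpos hy.le h.le)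
    simp only [Nat.factorial_zero, Nat.cast_one, Real.log_one]
    linarith [le_max_right (Real.log y) 0]
  · have hn : ⌊y⌋₊ ≠ 0 := (Nat.floor_pos.2 h).ne'
    have hn1 : (1 : ℝ) ≤ ⌊y⌋₊ := by exact_mod_cast Nat.floor_pos.2 h
    have h1 := Stirling.le_log_factorial_stirling hn
    have hpi : 0 ≤ Real.log (2 * Real.pi) := Real.log_nonneg (by linarith [Real.pi_gt_three])
    have h5 : 0 ≤ Real.log ⌊y⌋₊ := Real.log_nonneg hn1
    have h6 : 0 ≤ Real.log y := Real.log_nonneg h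
    have h2 := Real.log_le_sub_one_of_pos (show 0 < y / (⌊y⌋₊ : ℝ) by positivity)
    rw [Real.log_div (by positivity) (by positivity)] at h2
    have h3 : ⌊y⌋₊ * (Real.log y - Real.log ⌊y⌋₊) ≤ y - ⌊y⌋₊ := by
      calc _ ≤ (⌊y⌋₊ : ℝ) * (y / (⌊y⌋₊ : ℝ) - 1) := by gcongr
        _ = _ := by field_simp
    have h4 : (y - ⌊y⌋₊) * Real.log y ≤ 1 * Real.log y := by
      gcongr
      linarith [Nat.lt_floor_add_one y]
    linarith [le_max_left (Real.log y) 0]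

theorem chebyshevSum_bounds {x : ℝ} (hx : 1 ≤ x) :
    0.9212 * x - 5 * Real.log x - 3 ≤ chebyshevSum ⌊x⌋₊ ∧
      chebyshevSum ⌊x⌋₊ ≤ 0.9213 * x + 5 * Real.log x + 2 := by
  have hx0 : 0 < x := by linarith
  have hL : 0 ≤ Real.log x := Real.log_nonneg hx
  have hmax {k : ℝ} (hk : 1 ≤ k) : max (Real.log (x / k)) 0 ≤ Real.log x :=
    max_le (Real.log_le_log (by positivity) (div_le_self hx0.le hk)) hL
  have h30 : Real.log 30 = Real.log 2 + Real.log 3 + Real.log 5 := by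
    rw [← Real.log_mul, ← Real.log_mul] <;> norm_num
  have e2 : Real.log (x / 2) = Real.log x - Real.log 2 := Real.log_div hx0.ne' (by norm_num)
  have e3 : Real.log (x / 3) = Real.log x - Real.log 3 := Real.log_div hx0.ne' (by norm_num)
  have e5 : Real.log (x / 5) = Real.log x - Real.log 5 := Real.log_div hx0.ne' (by norm_num)
  have e30 : Real.log (x / 30) = Real.log x - (Real.log 2 + Real.log 3 + Real.log 5) :=
    h30 ▸ Real.log_div hx0.ne' (by norm_num)
  have m1 : max (Real.log x) 0 = Real.log x := max_eq_left hL
  have m2 := hmax (show (1 : ℝ) ≤ 2 by norm_num)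
  have m3 := hmax (show (1 : ℝ) ≤ 3 by norm_num)
  have m5 := hmax (show (1 : ℝ) ≤ 5 by norm_num)
  have m30 := hmax (show (1 : ℝ) ≤ 30 by norm_num)
  have u1 := log_factorial_floor_le hx0
  have u2 := log_factorial_floor_le (show 0 < x / 2 by positivity)
  have u3 := log_factorial_floor_le (show 0 < x / 3 by positivity)
  have u5 := log_factorial_floor_le (show 0 < x / 5 by positivity)
  have u30 := log_factorial_floor_le (show 0 < x / 30 by positivity)
  have l1 := le_log_factorial_floor hx0
  have l2 := le_log_factorial_floor (show 0 < x / 2 by positivity)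
  have l3 := le_log_factorial_floor (show 0 < x / 3 by positivity)
  have l5 := le_log_factorial_floor (show 0 < x / 5 by positivity)
  have l30 := le_log_factorial_floor (show 0 < x / 30 by positivity)
  have f2 : ⌊x / 2⌋₊ = ⌊x⌋₊ / 2 := Nat.floor_div_ofNat x 2
  have f3 : ⌊x / 3⌋₊ = ⌊x⌋₊ / 3 := Nat.floor_div_ofNat x 3
  have f5 : ⌊x / 5⌋₊ = ⌊x⌋₊ / 5 := Nat.floor_div_ofNat x 5
  have f30 : ⌊x / 30⌋₊ = ⌊x⌋₊ / 30 := Nat.floor_div_ofNat x 30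
  rw [f2] at u2 l2
  rw [f3] at u3 l3
  rw [f5] at u5 l5
  rw [f30] at u30 l30
  have hA1 : 0.9212 ≤ 7 / 15 * Real.log 2 + 3 / 10 * Real.log 3 + 1 / 6 * Real.log 5 := by
    linarith [Real.log_two_gt_d9, Real.log_three_gt_d9, Real.log_five_gt_d9]
  have hA2 : 7 / 15 * Real.log 2 + 3 / 10 * Real.log 3 + 1 / 6 * Real.log 5 ≤ 0.9213 := by
    linarith [Real.log_two_lt_d9, Real.log_three_lt_d9, Real.log_five_lt_d9]
  have hB1 := mul_le_mul_of_nonneg_left hA1 hx0.le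
  have hB2 := mul_le_mul_of_nonneg_left hA2 hx0.le
  rw [m1] at u1 l1
  have key : x * Real.log x - x - (x / 2 * Real.log (x / 2) - x / 2)
      - (x / 3 * Real.log (x / 3) - x / 3) - (x / 5 * Real.log (x / 5) - x / 5)
      + (x / 30 * Real.log (x / 30) - x / 30)
      = x * (7 / 15 * Real.log 2 + 3 / 10 * Real.log 3 + 1 / 6 * Real.log 5) := by
    rw [e2, e3, e5, e30]; ring
  rw [chebyshevSum]
  constructor <;> linarith

end ChebyshevBounds

theorem thetaErr_eq {L : ℝ} (hL : 0 ≤ L) : thetaErr L =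
    0.4394 * 9.646 ^ (1 / 4 : ℝ) * √(√(L / 9.646) * Real.exp (-(2 * √(L / 9.646)))) := by
  have h1 : L ^ (1 / 4 : ℝ) = 9.646 ^ (1 / 4 : ℝ) * √(√(L / 9.646)) := by
    rw [Real.sqrt_eq_rpow, Real.sqrt_eq_rpow, ← Real.rpow_mul (by positivity),
      show (1 / 2 * (1 / 2) : ℝ) = 1 / 4 by norm_num, ← Real.mul_rpow (by norm_num) (by positivity)]
    congr 1
    field_simp
  have h2 : √(Real.exp (-(2 * √(L / 9.646)))) = Real.exp (-√(L / 9.646)) := by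
    rw [Real.sqrt_eq_iff_mul_self_eq (Real.exp_pos _).le (Real.exp_pos _).le, ← Real.exp_add]
    ring_nf
  rw [thetaErr, Real.sqrt_mul (Real.sqrt_nonneg _), h1, h2]
  ring

theorem thetaErr_antitone {a L : ℝ} (ha : 2.4115 ≤ a) (hL : a ≤ L) : thetaErr L ≤ thetaErr a := by
  rw [thetaErr_eq (by linarith), thetaErr_eq (by linarith)]
  refine mul_le_mul_of_nonneg_left (Real.sqrt_le_sqrt (mul_exp_neg_le ?_ ?_)) (by positivity)
  · refine Real.le_sqrt_of_sq_le ?_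
    rw [le_div_iff₀ (by norm_num)]
    linarith
  · gcongr

theorem le_thetaErr {L c t q : ℝ} (hc : c ^ 4 ≤ L) (ht0 : 0 ≤ t)
    (ht : L ≤ t ^ 2 * 9.646) (hq : Real.exp t ≤ q) : 0.4394 * c / q ≤ thetaErr L := by
  have hL : 0 ≤ L := le_trans (by positivity) hc
  have h1 : c ≤ L ^ (1 / 4 : ℝ) := by
    refine le_of_pow_le_pow_left₀ (n := 4) (by norm_num) (by positivity) (hc.trans_eq ?_)
    rw [← Real.rpow_natCast, ← Real.rpow_mul hL]; norm_num
  have h2 : √(L / 9.646) ≤ t := by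
    rw [Real.sqrt_le_left ht0, div_le_iff₀ (by norm_num)]; exact ht
  have h3 : q⁻¹ ≤ Real.exp (-√(L / 9.646)) := by
    rw [Real.exp_neg]
    exact inv_anti₀ (Real.exp_pos _) ((Real.exp_le_exp.2 h2).trans hq)
  have hq0 : 0 < q := (Real.exp_pos t).trans_le hq
  rw [thetaErr, div_eq_mul_inv]
  exact mul_le_mul (mul_le_mul_of_nonneg_left h1 (by norm_num)) h3 (by positivity) (by positivity)

theorem exp_one_pow_le (n : ℕ) : Real.exp n ≤ 2.7182818286 ^ n := by
  rw [← mul_one (n : ℝ), Real.exp_nat_mul]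
  exact pow_le_pow_left₀ (Real.exp_pos _).le Real.exp_one_lt_d9.le n

theorem le_exp_one_pow (n : ℕ) : 2.7182818283 ^ n ≤ Real.exp n := by
  rw [← mul_one (n : ℝ), Real.exp_nat_mul]
  exact pow_le_pow_left₀ (by norm_num) Real.exp_one_gt_d9.le n

theorem le_thetaErr_fifteen : 0.24 ≤ thetaErr 15 := by
  have h : Real.exp 1.25 ≤ 3.491 := by
    refine le_of_pow_le_pow_left₀ (n := 4) (by norm_num) (by norm_num) ?_
    rw [← Real.exp_nat_mul]
    have := exp_one_pow_le 5
    norm_num at this ⊢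
    linarith
  refine le_trans (by norm_num) (le_thetaErr (c := 1.96) ?_ ?_ ?_ h) <;> norm_num

theorem le_thetaErr_forty : 0.14 ≤ thetaErr 40 := by
  have h : Real.exp 2.04 ≤ 7.7 := by
    refine le_of_pow_le_pow_left₀ (n := 25) (by norm_num) (by norm_num) ?_
    rw [← Real.exp_nat_mul]
    have := exp_one_pow_le 51
    norm_num at this ⊢
    linarith
  refine le_trans (by norm_num) (le_thetaErr (c := 2.51) ?_ ?_ ?_ h) <;> norm_num

theorem le_thetaErr_seventy_five : 0.0795 ≤ thetaErr 75 := by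
  have h1 : Real.exp 2.8 ≤ 16.4448 := by
    refine le_of_pow_le_pow_left₀ (n := 5) (by norm_num) (by norm_num) ?_
    rw [← Real.exp_nat_mul]
    have := exp_one_pow_le 14
    norm_num at this ⊢
    linarith
  have h : Real.exp 2.7885 ≤ 16.26 := by
    have h2 := Real.add_one_le_exp (0.0115 : ℝ)
    have h3 : Real.exp 2.8 = Real.exp 2.7885 * Real.exp 0.0115 := by
      rw [← Real.exp_add]; norm_num
    have h4 : Real.exp 2.7885 * (0.0115 + 1) ≤ Real.exp 2.7885 * Real.exp 0.0115 := by gcongr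
    linarith
  refine le_trans (by norm_num) (le_thetaErr (c := 2.9428) ?_ ?_ ?_ h) <;> norm_num

section PsiBounds
open Chebyshev

theorem le_psi {x : ℝ} (hx : 1 ≤ x) : 0.9212 * x - 5 * Real.log x - 3 ≤ psi x :=
  (chebyshevSum_bounds hx).1.trans (chebyshevSum_le_psi x)

theorem psi_le_quadratic {x : ℝ} (hx : 1 ≤ x) :
    psi x ≤ 1.1056 * x + 1.4 * Real.log x ^ 2 + 4 * Real.log x + 2 := by
  obtain ⟨n, hn⟩ := pow_unbounded_of_one_lt x (show (1 : ℝ) < 6 by norm_num)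
  induction n generalizing x with
  | zero => simp at hn; linarith
  | succ n ih =>
    have h1 := psi_le_chebyshevSum_add_psi_div_six x (by linarith)
    have h2 := (chebyshevSum_bounds hx).2
    have hL : 0 ≤ Real.log x := Real.log_nonneg hx
    rcases lt_or_ge x 6 with h | h
    · have h3 : psi (x / 6) = 0 := psi_eq_zero_of_le_one (by linarith)
      have h4 := Real.quadratic_le_exp_of_nonneg hL
      rw [Real.exp_log (by linarith)] at h4
      nlinarith [sq_nonneg (Real.log x - 0.27)]
    · have h3 := ih (x := x / 6) (by linarith) (by rw [pow_succ] at hn; linarith)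
      have h6 : Real.log 6 = Real.log 2 + Real.log 3 := by
        rw [← Real.log_mul (by norm_num) (by norm_num)]; norm_num
      have h7 : Real.log (x / 6) = Real.log x - (Real.log 2 + Real.log 3) := by
        rw [Real.log_div (by linarith) (by norm_num), h6]
      have h8 : 1.7917 ≤ Real.log 2 + Real.log 3 := by
        linarith [Real.log_two_gt_d9, Real.log_three_gt_d9]
      have h9 : Real.log 2 + Real.log 3 ≤ 1.7918 := by
        linarith [Real.log_two_lt_d9, Real.log_three_lt_d9]
      rw [h7] at h3
      nlinarith [mul_nonneg hL (sub_nonneg.2 h8)]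

theorem exp_mul_quadratic_le {a m x : ℝ} (ha : m ≤ Real.exp a) (hx0 : 0 < x)
    (hx : a ≤ Real.log x) :
    m * (1 + (Real.log x - a) + (Real.log x - a) ^ 2 / 2) ≤ x := by
  calc _ ≤ Real.exp a * Real.exp (Real.log x - a) :=
        mul_le_mul ha (Real.quadratic_le_exp_of_nonneg (by linarith))
          (by have := sub_nonneg.2 hx; positivity) (Real.exp_pos _).le
    _ = x := by rw [← Real.exp_add, add_sub_cancel, Real.exp_log hx0]

theorem log_sq_add_log_le {x : ℝ} (hx0 : 0 < x) (hx : 25 ≤ Real.log x) :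
    2 * Real.log x ^ 2 + 20 * Real.log x + 20 ≤ 0.00001 * x := by
  have h1 : (70000000000 : ℝ) ≤ Real.exp 25 := by
    have := le_exp_one_pow 25
    norm_num at this ⊢
    linarith
  have h2 := exp_mul_quadratic_le h1 hx0 hx
  nlinarith

theorem psi_le_mul_of_psi_le_mul {a U : ℝ} (ha : 25 ≤ a)
    (hU : ∀ x : ℝ, 0 < x → a ≤ Real.log x → psi x ≤ U * x) {x : ℝ} (hx0 : 0 < x)
    (hx : a + 3 ≤ Real.log x) : psi x ≤ (0.78973 + 4 / 15 * U) * x := by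
  have hx1 : 1 ≤ x / 7 := by
    have := Real.add_one_le_exp (Real.log x)
    rw [Real.exp_log hx0] at this
    linarith
  have hlog {k : ℝ} (hk0 : 0 < k) (hk : k ≤ 10) : a ≤ Real.log (x / k) := by
    have h1 : Real.log k ≤ Real.log 10 := Real.log_le_log hk0 hk
    have h2 : Real.log 10 = Real.log 2 + Real.log 5 := by
      rw [← Real.log_mul (by norm_num) (by norm_num)]; norm_num
    rw [Real.log_div hx0.ne' hk0.ne']
    linarith [Real.log_two_lt_d9, Real.log_five_lt_d9]
  have h1 := psi_le_chebyshevSum_add x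
  have h2 := (chebyshevSum_bounds (x := x) (by linarith)).2
  have h6 := hU (x / 6) (by positivity) (hlog (by norm_num) (by norm_num))
  have h10 := hU (x / 10) (by positivity) (hlog (by norm_num) (by norm_num))
  have h7 := le_psi hx1
  have h8 : Real.log (x / 7) ≤ Real.log x :=
    Real.log_le_log (by positivity) (div_le_self hx0.le (by norm_num))
  have h9 := log_sq_add_log_le hx0 (by linarith)
  nlinarith [sq_nonneg (Real.log x)]

theorem psi_le_of_log_ge_forty {x : ℝ} (hx0 : 0 < x) (hx : 40 ≤ Real.log x) :
    psi x ≤ 1.0776 * x := by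
  have u0 : ∀ x : ℝ, 0 < x → 25 ≤ Real.log x → psi x ≤ 1.1057 * x := fun x h0 h ↦ by
    have h1 : 1 ≤ x := by
      have := Real.add_one_le_exp (Real.log x)
      rw [Real.exp_log h0] at this
      linarith
    have := psi_le_quadratic h1
    have := log_sq_add_log_le h0 h
    nlinarith [sq_nonneg (Real.log x)]
  have u1 : ∀ x : ℝ, 0 < x → 28 ≤ Real.log x → psi x ≤ 1.0846 * x := fun x h0 h ↦
    (psi_le_mul_of_psi_le_mul (by norm_num) u0 h0 (by linarith)).trans (by gcongr; norm_num)
  have u2 : ∀ x : ℝ, 0 < x → 31 ≤ Real.log x → psi x ≤ 1.079 * x := fun x h0 h ↦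
    (psi_le_mul_of_psi_le_mul (by norm_num) u1 h0 (by linarith)).trans (by gcongr; norm_num)
  exact (psi_le_mul_of_psi_le_mul (a := 31) (by norm_num) u2 hx0 (by linarith)).trans
    (by gcongr; norm_num)

theorem le_theta {x : ℝ} (hx : 1 ≤ x) :
    0.9212 * x - 3.3168 * √x - 1.05 * Real.log x ^ 2 - 11 * Real.log x - 9 ≤ theta x := by
  have hL : 0 ≤ Real.log x := Real.log_nonneg hx
  have h1 := psi_sub_theta_le_psi_add_psi_add_psi x
  have hmono {p : ℝ} (hp : p ≤ 1 / 2) : psi (x ^ p) ≤ psi (√x) :=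
    psi_mono (by rw [Real.sqrt_eq_rpow]; exact Real.rpow_le_rpow_of_exponent_le hx hp)
  have h2 := psi_le_quadratic (Real.one_le_sqrt.2 hx)
  have h3 : Real.log √x = Real.log x / 2 := Real.log_sqrt (by linarith)
  have h4 := le_psi hx
  have a2 := hmono (p := 2⁻¹) (by norm_num)
  have a3 := hmono (p := 3⁻¹) (by norm_num)
  have a5 := hmono (p := 5⁻¹) (by norm_num)
  rw [h3] at h2
  nlinarith

theorem abs_theta_sub_le_of_medium {x : ℝ} (hx0 : 0 < x) (hx1 : 7.6 ≤ Real.log x)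
    (hx2 : Real.log x ≤ 75) : |theta x - x| ≤ thetaErr (Real.log x) * x := by
  have h1 : 1 ≤ x := by
    have := Real.add_one_le_exp (Real.log x)
    rw [Real.exp_log hx0] at this
    linarith
  have hlo := le_theta h1
  have hup := (theta_le_psi x).trans (psi_le_quadratic h1)
  have hs0 := Real.sqrt_nonneg x
  have hss := Real.mul_self_sqrt hx0.le
  suffices ∃ e, e ≤ thetaErr (Real.log x) ∧ (1 - e) * x ≤ theta x ∧ theta x ≤ (1 + e) * x by
    obtain ⟨e, he, hl, hu⟩ := this
    have := mul_le_mul_of_nonneg_right he hx0.le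
    rw [abs_le]
    constructor <;> linarith
  have anti {b : ℝ} (hb : Real.log x ≤ b) : thetaErr b ≤ thetaErr (Real.log x) :=
    thetaErr_antitone (by linarith) hb
  rcases le_total (Real.log x) 15 with h15 | h15
  · refine ⟨0.24, le_thetaErr_fifteen.trans (anti h15), ?_⟩
    have e1 : (1996 : ℝ) ≤ Real.exp 7.6 := by
      refine le_of_pow_le_pow_left₀ (n := 5) (by norm_num) (Real.exp_pos _).le ?_
      rw [← Real.exp_nat_mul]
      have := le_exp_one_pow 38
      norm_num at this ⊢
      linarith
    have h2 := exp_mul_quadratic_le e1 hx0 hx1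
    have h3 : 44.65 ≤ √x := Real.le_sqrt_of_sq_le (by nlinarith)
    constructor <;> nlinarith
  rcases le_total (Real.log x) 40 with h40 | h40
  · refine ⟨0.14, le_thetaErr_forty.trans (anti h40), ?_⟩
    have e1 : (3000000 : ℝ) ≤ Real.exp 15 := by
      have := le_exp_one_pow 15
      norm_num at this ⊢
      linarith
    have h2 := exp_mul_quadratic_le e1 hx0 h15
    have h3 : 1000 ≤ √x := Real.le_sqrt_of_sq_le (by nlinarith)
    constructor <;> nlinarith
  · refine ⟨0.0795, le_thetaErr_seventy_five.trans (anti hx2), ?_⟩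
    have h2 := log_sq_add_log_le hx0 (by linarith)
    have h3 : 10000 ≤ √x := Real.le_sqrt_of_sq_le (by nlinarith)
    exact ⟨by nlinarith, (theta_le_psi x).trans
      ((psi_le_of_log_ge_forty hx0 h40).trans (by gcongr; norm_num))⟩

end PsiBounds

section ThetaSmall
open Chebyshev

theorem prime_iff_coprime_primorial {n : ℕ} (h1 : 43 < n) (h2 : n < 47 ^ 2) :
    n.Prime ↔ n.Coprime (primorial 43) := by
  constructor
  · intro hn
    refine (Nat.Prime.coprime_iff_not_dvd hn).2 fun h ↦ ?_
    have := (Nat.Prime.dvd_primorial_iff hn).1 h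
    omega
  · intro h
    by_contra hn
    have hp := Nat.minFac_prime (show n ≠ 1 by omega)
    have hlt : n.minFac < 47 := by
      have := Nat.minFac_sq_le_self (by omega) hn
      exact lt_of_pow_lt_pow_left₀ 2 (by norm_num) (this.trans_lt h2)
    have hle : n.minFac ≤ 43 := by
      by_contra h43
      have : n.minFac = 44 ∨ n.minFac = 45 ∨ n.minFac = 46 := by omega
      rcases this with h | h | h <;> rw [h] at hp <;> norm_num at hp
    exact Nat.not_coprime_of_dvd_of_dvd hp.one_lt (Nat.minFac_dvd n)
      ((Nat.Prime.dvd_primorial_iff hp).2 hle) h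

/-- `primorial (59 + k)` in a form suited to kernel evaluation, valid for `59 + k < 47 ^ 2`. -/
def sievedPrimorial : ℕ → ℕ
  | 0 => 1922760350154212639070
  | k + 1 => if Nat.gcd (60 + k) 13082761331670030 = 1 then sievedPrimorial k * (60 + k)
      else sievedPrimorial k

theorem primorial_forty_three : primorial 43 = 13082761331670030 := by
  norm_num [primorial, Finset.prod_filter, Finset.prod_range_succ]

theorem sievedPrimorial_eq (k : ℕ) (hk : 59 + k < 47 ^ 2) :
    sievedPrimorial k = primorial (59 + k) := by
  induction k with
  | zero => norm_num [sievedPrimorial, primorial, Finset.prod_filter, Finset.prod_range_succ]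
  | succ k ih =>
    have h := prime_iff_coprime_primorial (n := 60 + k) (by omega) (by omega)
    rw [primorial_forty_three, Nat.Coprime] at h
    rw [sievedPrimorial, ih (by omega), primorial, primorial, Finset.prod_filter,
      Finset.prod_filter, Finset.prod_range_succ _ (59 + (k + 1)),
      show 59 + (k + 1) = 60 + k by omega, show 60 + k = 59 + k + 1 by omega]
    rw [show 60 + k = 59 + k + 1 by omega] at h
    simp only [← h]
    split_ifs <;> simp

/-- Certificate for `0.76 x ≤ θ x ≤ 1.24 x` on each interval between consecutive elements of
`59 + a :: l`. -/
def thetaCheck : ℕ → List ℕ → Bool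
  | _, [] => true
  | a, b :: l =>
    27182818286 ^ ((76 * (59 + b) + 99) / 100)
        ≤ sievedPrimorial a * 10 ^ (10 * ((76 * (59 + b) + 99) / 100)) &&
      sievedPrimorial b * 10 ^ (10 * (124 * (59 + a) / 100))
        ≤ 27182818283 ^ (124 * (59 + a) / 100) && thetaCheck b l

theorem thetaCheck_true : thetaCheck 0
    [5, 10, 16, 26, 38, 50, 75, 93, 119, 147, 188, 238, 305, 381, 484, 605, 783, 1001, 1280, 1639,
      2041] = true := by
  decide +kernel

theorem theta_natCast_eq_log_sievedPrimorial {k : ℕ} (hk : 59 + k < 47 ^ 2) :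
    theta (59 + k) = Real.log (sievedPrimorial k) ∧ (0 : ℝ) < sievedPrimorial k := by
  rw [sievedPrimorial_eq k hk, theta_eq_log_primorial]
  refine ⟨?_, by exact_mod_cast primorial_pos _⟩
  congr 3
  exact_mod_cast Nat.floor_natCast (59 + k)

theorem theta_bounds_of_thetaCheck {l : List ℕ} {a : ℕ} (h : thetaCheck a l = true)
    (hl : ∀ b ∈ a :: l, 59 + b < 47 ^ 2) {x : ℝ} (hx : 59 + a ≤ x)
    (hx' : ∃ b ∈ l, x ≤ 59 + (b : ℝ)) : 0.76 * x ≤ theta x ∧ theta x ≤ 1.24 * x := by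
  induction l generalizing a with
  | nil => simp at hx'
  | cons b l ih =>
    simp only [thetaCheck, Bool.and_eq_true, decide_eq_true_eq] at h
    obtain ⟨⟨h1, h2⟩, h3⟩ := h
    rcases le_or_gt x (59 + b) with hb | hb
    · obtain ⟨ea, pa⟩ := theta_natCast_eq_log_sievedPrimorial (hl a (by simp))
      obtain ⟨eb, pb⟩ := theta_natCast_eq_log_sievedPrimorial (hl b (by simp))
      have m1 : theta (59 + a) ≤ theta x := theta_mono hx
      have m2 : theta x ≤ theta (59 + b) := theta_mono hb
      constructor
      · set c := (76 * (59 + b) + 99) / 100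
        have hc : 0.76 * (59 + b : ℝ) ≤ c := by
          have : 76 * (59 + b) ≤ 100 * c := by omega
          have : (76 * (59 + b) : ℝ) ≤ 100 * c := by exact_mod_cast this
          linarith
        have h4 : (c : ℝ) ≤ Real.log (sievedPrimorial a) := by
          rw [Real.le_log_iff_exp_le pa]
          refine (exp_one_pow_le c).trans ?_
          rw [show (2.7182818286 : ℝ) = 27182818286 / 10 ^ 10 by norm_num, div_pow, ← pow_mul,
            div_le_iff₀ (by positivity)]
          exact_mod_cast h1
        linarith
      · set c := 124 * (59 + a) / 100
        have hc : (c : ℝ) ≤ 1.24 * (59 + a : ℝ) := by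
          have : 100 * c ≤ 124 * (59 + a) := by omega
          have : (100 * c : ℝ) ≤ 124 * (59 + a) := by exact_mod_cast this
          linarith
        have h4 : Real.log (sievedPrimorial b) ≤ c := by
          rw [Real.log_le_iff_le_exp pb]
          refine le_trans ?_ (le_exp_one_pow c)
          rw [show (2.7182818283 : ℝ) = 27182818283 / 10 ^ 10 by norm_num, div_pow, ← pow_mul,
            le_div_iff₀ (by positivity)]
          exact_mod_cast h2
        linarith
    · refine ih h3 (fun c hc ↦ hl c (by simp [List.mem_cons.1 hc])) hb.le ?_
      obtain ⟨c, hc, hxc⟩ := hx'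
      rcases List.mem_cons.1 hc with rfl | hc
      · linarith
      · exact ⟨c, hc, hxc⟩

theorem le_log_of_fifty_nine_le {x : ℝ} (hx : 59 ≤ x) : 2.4115 ≤ Real.log x := by
  rw [Real.le_log_iff_exp_le (by linarith)]
  refine (Real.exp_le_exp.2 (by norm_num : (2.4115 : ℝ) ≤ (3 : ℕ))).trans ?_
  refine (exp_one_pow_le 3).trans ?_
  norm_num
  linarith

theorem abs_theta_sub_le_of_small {x : ℝ} (hx : 59 ≤ x) (hx' : x ≤ 2100) :
    |theta x - x| ≤ thetaErr (Real.log x) * x := by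
  obtain ⟨h1, h2⟩ := theta_bounds_of_thetaCheck thetaCheck_true (by simp) (x := x)
    (by simpa using hx) ⟨2041, by simp, by norm_num; exact hx'⟩
  have hlo := le_log_of_fifty_nine_le hx
  have hup : Real.log x ≤ 15 := by
    rw [Real.log_le_iff_le_exp (by linarith)]
    have := le_exp_one_pow 15
    norm_num at this
    linarith
  have h3 := le_thetaErr_fifteen.trans (thetaErr_antitone hlo hup)
  rw [abs_le]
  constructor <;> nlinarith

/-- The Chebyshev function satisfies the prime number theorem with explicit error `thetaErr`. -/
theorem abs_theta_sub_le {x : ℝ} (hx : 59 ≤ x) :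
    |theta x - x| ≤ thetaErr (Real.log x) * x := by
  rcases le_total x 2100 with h | h
  · exact abs_theta_sub_le_of_small hx h
  rcases le_total 75 (Real.log x) with h' | h'
  · exact abs_theta_sub_le_of_large (by linarith) h'
  · refine abs_theta_sub_le_of_medium (by linarith) ?_ h'
    rw [Real.le_log_iff_exp_le (by linarith)]
    refine le_of_pow_le_pow_left₀ (n := 5) (by norm_num) (by linarith)
      (le_trans ?_ (pow_le_pow_left₀ (by norm_num) h 5))
    rw [← Real.exp_nat_mul]
    have := exp_one_pow_le 38
    norm_num at this ⊢
    linarith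

end ThetaSmall

section SecondDifference
open Chebyshev

/-- An antiderivative of `1 / log`, differing from the logarithmic integral by a constant. -/
noncomputable def logIntegral (x : ℝ) : ℝ :=
  x / Real.log x + ∫ t in (2 : ℝ)..x, 1 / Real.log t ^ 2

theorem hasDerivAt_logIntegral {x : ℝ} (hx : 1 < x) :
    HasDerivAt logIntegral (1 / Real.log x) x := by
  have hL : 0 < Real.log x := Real.log_pos hx
  have hx0 : x ≠ 0 := by linarith
  have h1 : HasDerivAt (fun t ↦ t / Real.log t) ((1 * Real.log x - x * x⁻¹) / Real.log x ^ 2) x :=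
    (hasDerivAt_id x).div (Real.hasDerivAt_log hx0) hL.ne'
  have hc : ContinuousOn (fun t : ℝ ↦ 1 / Real.log t ^ 2) (Set.Ioi 1) := fun t ht ↦ by
    have h0 : t ≠ 0 := by linarith [Set.mem_Ioi.1 ht]
    have h0' : Real.log t ^ 2 ≠ 0 := pow_ne_zero 2 (Real.log_pos ht).ne'
    exact ContinuousAt.continuousWithinAt (by fun_prop)
  have h2 : HasDerivAt (fun u ↦ ∫ t in (2 : ℝ)..u, 1 / Real.log t ^ 2) (1 / Real.log x ^ 2) x :=
    intervalIntegral.integral_hasDerivAt_right (intervalIntegrable_one_div_log_sq (by norm_num) hx)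
      (hc.stronglyMeasurableAtFilter isOpen_Ioi x hx) (hc.continuousAt (Ioi_mem_nhds hx))
  refine (h1.add h2).congr_deriv ?_
  field_simp
  ring

theorem logIntegral_second_diff_ge {x y : ℝ} (hx : 1 < x) (hy : 0 < y) :
    y ^ 2 / ((x + 2 * y) * Real.log (x + 2 * y) ^ 2) ≤
      2 * logIntegral (x + y) - logIntegral x - logIntegral (x + 2 * y) := by
  have hd (u : ℝ) (hu : 0 ≤ u) : HasDerivAt (fun u ↦ logIntegral (x + u) - logIntegral (x + y + u))
      (1 / Real.log (x + u) - 1 / Real.log (x + y + u)) u :=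
    ((hasDerivAt_logIntegral (by linarith)).comp_const_add x u).sub
      ((hasDerivAt_logIntegral (by linarith)).comp_const_add (x + y) u)
  obtain ⟨u, ⟨hu0, huy⟩, hu⟩ := exists_hasDerivAt_eq_slope _ _ hy
    (fun u hu ↦ (hd u hu.1).continuousAt.continuousWithinAt) (fun u hu ↦ hd u hu.1.le)
  have hM : 2 * logIntegral (x + y) - logIntegral x - logIntegral (x + 2 * y)
      = y * (1 / Real.log (x + u) - 1 / Real.log (x + y + u)) := by
    rw [hu, sub_zero, add_zero, add_zero, mul_div_cancel₀ _ hy.ne',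
      show x + y + y = x + 2 * y by ring]
    ring
  have ha : 0 < Real.log (x + u) := Real.log_pos (by linarith)
  have hab : Real.log (x + u) ≤ Real.log (x + y + u) :=
    Real.log_le_log (by linarith) (by linarith)
  have hb : Real.log (x + y + u) ≤ Real.log (x + 2 * y) :=
    Real.log_le_log (by linarith) (by linarith)
  have hdiff : y / (x + 2 * y) ≤ Real.log (x + y + u) - Real.log (x + u) := by
    have h1 := Real.log_le_sub_one_of_pos (show 0 < (x + u) / (x + y + u) by
      apply div_pos <;> linarith)
    rw [Real.log_div (by linarith) (by linarith)] at h1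
    have h2 : (x + u) / (x + y + u) - 1 = -(y / (x + y + u)) := by
      have : x + y + u ≠ 0 := by linarith
      field_simp; ring
    have h3 : y / (x + 2 * y) ≤ y / (x + y + u) := by
      apply div_le_div_of_nonneg_left <;> linarith
    linarith
  rw [hM, div_sub_div _ _ ha.ne' (by linarith), one_mul, mul_one, pow_two, mul_div_assoc,
    ← div_div]
  refine mul_le_mul_of_nonneg_left ?_ hy.le
  refine div_le_div₀ (by linarith) hdiff (mul_pos ha (by linarith)) ?_
  rw [pow_two]
  exact mul_le_mul (by linarith) hb (by linarith) (by linarith)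

theorem primePi_eq_primeCounting (x : ℝ) : primePi x = Nat.primeCounting ⌊x⌋₊ := by
  rw [primePi, Nat.primeCounting, Nat.primeCounting', Nat.count_eq_card_filter_range]

theorem intervalIntegrable_theta_div {a b : ℝ} (ha : 2 ≤ a) (hb : 2 ≤ b) :
    IntervalIntegrable (fun t ↦ theta t / (t * Real.log t ^ 2)) MeasureTheory.volume a b := by
  refine ((integrableOn_theta_div_id_mul_log_sq (max a b)).mono_set
    fun t ht ↦ ⟨(le_min ha hb).trans ht.1, ht.2⟩).intervalIntegrable

theorem primePi_sub_primePi {a b : ℝ} (ha : 2 ≤ a) (hab : a ≤ b) :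
    (primePi b : ℝ) - primePi a = logIntegral b - logIntegral a
      + (theta b - b) / Real.log b - (theta a - a) / Real.log a
      + ∫ t in a..b, (theta t - t) / (t * Real.log t ^ 2) := by
  have hb : 2 ≤ b := ha.trans hab
  have i1 := intervalIntegrable_theta_div ha hb
  have i2 := intervalIntegrable_one_div_log_sq (a := a) (b := b) (by linarith) (by linarith)
  have e : ∫ t in a..b, (theta t - t) / (t * Real.log t ^ 2)
      = (∫ t in a..b, theta t / (t * Real.log t ^ 2)) - ∫ t in a..b, 1 / Real.log t ^ 2 := by
    rw [← intervalIntegral.integral_sub i1 i2]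
    refine intervalIntegral.integral_congr fun t ht ↦ ?_
    rw [Set.uIcc_of_le hab] at ht
    have h0 : t ≠ 0 := by linarith [ht.1]
    have h1 : Real.log t ≠ 0 := (Real.log_pos (by linarith [ht.1])).ne'
    field_simp
  rw [e, ← intervalIntegral.integral_interval_sub_left
      (intervalIntegrable_theta_div le_rfl hb) (intervalIntegrable_theta_div le_rfl ha),
    ← intervalIntegral.integral_interval_sub_left
      (intervalIntegrable_one_div_log_sq one_lt_two (by linarith : 1 < b))
      (intervalIntegrable_one_div_log_sq one_lt_two (by linarith : 1 < a)),
    primePi_eq_primeCounting, primePi_eq_primeCounting,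
    primeCounting_eq_theta_div_log_add_integral ha, primeCounting_eq_theta_div_log_add_integral hb,
    logIntegral, logIntegral]
  ring

theorem abs_theta_sub_le_of_le {x t : ℝ} (hx : 59 ≤ x) (ht : x ≤ t) :
    |theta t - t| ≤ thetaErr (Real.log x) * t := by
  refine (abs_theta_sub_le (hx.trans ht)).trans
    (mul_le_mul_of_nonneg_right (thetaErr_antitone (le_log_of_fifty_nine_le hx)
      (Real.log_le_log (by linarith) ht)) (by linarith))

theorem abs_theta_sub_div_log_le {x t : ℝ} (hx : 59 ≤ x) (ht : x ≤ t) :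
    |(theta t - t) / Real.log t| ≤ thetaErr (Real.log x) * t / Real.log x := by
  have hL : 0 < Real.log x := Real.log_pos (by linarith)
  have hLt : Real.log x ≤ Real.log t := Real.log_le_log (by linarith) ht
  have h := abs_theta_sub_le_of_le hx ht
  rw [abs_div, abs_of_pos (hL.trans_le hLt)]
  exact div_le_div₀ ((abs_nonneg _).trans h) h hL hLt

theorem abs_integral_theta_sub_le {x a b : ℝ} (hx : 59 ≤ x) (ha : x ≤ a) (hab : a ≤ b) :
    |∫ t in a..b, (theta t - t) / (t * Real.log t ^ 2)|
      ≤ thetaErr (Real.log x) / Real.log x ^ 2 * (b - a) := by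
  have hL : 0 < Real.log x := Real.log_pos (by linarith)
  rw [← abs_of_nonneg (sub_nonneg.2 hab), ← Real.norm_eq_abs]
  refine intervalIntegral.norm_integral_le_of_norm_le_const fun t ht ↦ ?_
  rw [Set.uIoc_of_le hab] at ht
  have hxt : x ≤ t := ha.trans ht.1.le
  have ht0 : 0 < t := by linarith
  have hLt : Real.log x ≤ Real.log t := Real.log_le_log (by linarith) hxt
  have h := abs_theta_sub_le_of_le hx hxt
  rw [Real.norm_eq_abs, abs_div, abs_of_nonneg (a := t * Real.log t ^ 2) (by positivity),
    ← div_div]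
  have h1 : |theta t - t| / t ≤ thetaErr (Real.log x) := (div_le_iff₀ ht0).2 h
  exact div_le_div₀ ((by positivity : 0 ≤ |theta t - t| / t).trans h1) h1 (by positivity)
    (by gcongr)

theorem four_mul_thetaErr_div {L : ℝ} (hL : 0 < L) (z : ℝ) :
    4 * thetaErr L * z / L
      = 1.7576 * z / L ^ ((3 : ℝ) / 4) * Real.exp (-√(L / 9.646)) := by
  have h : L = L ^ ((3 : ℝ) / 4) * L ^ ((1 : ℝ) / 4) := by
    rw [← Real.rpow_add hL]; norm_num
  have h3 : 0 < L ^ ((3 : ℝ) / 4) := by positivity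
  have h1 : 0 < L ^ ((1 : ℝ) / 4) := by positivity
  rw [thetaErr]
  conv_lhs => rw [div_eq_mul_inv]; arg 2; rw [h]
  generalize Real.exp (-√(L / 9.646)) = q
  field_simp
  ring

end SecondDifference

theorem second_difference_lower_bound (x y : ℝ) (hy : 0 < y) (hyx : y < x) (hx : 59 ≤ x) :
    y ^ 2 / ((x + 2 * y) * Real.log (x + 2 * y) ^ 2) -
      1.7576 * (x + 2 * y) / Real.log x ^ ((3 : ℝ) / 4) *
        Real.exp (-Real.sqrt (Real.log x / 9.646)) <
    2 * (primePi (x + y) : ℝ) - primePi x - primePi (x + 2 * y) := by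
  have hL : 1 < Real.log x := by
    rw [Real.lt_log_iff_exp_lt (by linarith)]
    linarith [Real.exp_one_lt_d9]
  have hmain := logIntegral_second_diff_ge (by linarith : 1 < x) hy
  have h1 := primePi_sub_primePi (a := x) (b := x + y) (by linarith) (by linarith)
  have h2 := primePi_sub_primePi (a := x + y) (b := x + 2 * y) (by linarith) (by linarith)
  have b0 := abs_le.1 (abs_theta_sub_div_log_le hx le_rfl)
  have b1 := abs_le.1 (abs_theta_sub_div_log_le hx (by linarith : x ≤ x + y))
  have b2 := abs_le.1 (abs_theta_sub_div_log_le hx (by linarith : x ≤ x + 2 * y))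
  have b3 := abs_le.1 (abs_integral_theta_sub_le hx le_rfl (by linarith : x ≤ x + y))
  have b4 := abs_le.1 (abs_integral_theta_sub_le hx (by linarith : x ≤ x + y)
    (by linarith : x + y ≤ x + 2 * y))
  rw [← four_mul_thetaErr_div (by linarith)]
  set ε := thetaErr (Real.log x) with hε
  have hε0 : 0 < ε := by rw [hε, thetaErr]; positivity
  set L := Real.log x
  have key : ε * (x + y) / L * 2 + ε * x / L + ε * (x + 2 * y) / L + ε / L ^ 2 * (2 * y)
      < 4 * ε * (x + 2 * y) / L := by
    have : 4 * ε * (x + 2 * y) / L - (ε * (x + y) / L * 2 + ε * x / L + ε * (x + 2 * y) / L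
        + ε / L ^ 2 * (2 * y)) = 2 * ε * y / L ^ 2 * (2 * L - 1) := by
      field_simp
      ring
    have : 0 < 2 * ε * y / L ^ 2 * (2 * L - 1) := mul_pos (by positivity) (by linarith)
    linarith
  linarith [b0.1, b0.2, b1.1, b1.2, b2.1, b2.2, b3.1, b3.2, b4.1, b4.2]
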